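/- arXiv:solv-int/9810016 — 7 statements merged into one kernel-verified Lean document; each statement's English description precedes it below -/
import Mathlib

section
/- Let t>0, λ₀∈ℝ and set τ(u)=it(u−λ₀)²−itλ₀². For j=1,2 let S₊^{(j)},S₋^{(j)}:ℝ×ℝ→ℂ be such that for some δ>0 and C>0, for each fixed w∈ℝ the maps ν↦S₊^{(j)}(w,ν), ν↦S₊^{(j)}(ν,w), ν↦S₋^{(j)}(w,ν), ν↦S₋^{(j)}(ν,w) extend holomorphically to the strip {ν∈ℂ:|Im ν|≤δ} with modulus bounded by C/(1+|Re ν|²) there, and suppose S₊^{(j)}(ν,ν)=−S₋^{(j)}(ν,ν) for all real ν. For 0<ε<δ define the regularized kernels V^{(j)}_ε(α,β)=[e^{(τ(α)−τ(β))/2}S₊^{(j)}(α,β)+e^{(τ(β)−τ(α))/2}S₋^{(j)}(α,β)]/(α−β−iε). Fix real λ≠μ with λ≠λ₀ and μ≠λ₀. Then for every sufficiently large t the iterated limit V^{(12)}(λ,μ)=lim_{ε→0⁺}∫_ℝ V^{(1)}_ε(λ,ν)V^{(2)}_ε(ν,μ)dν exists, and for every γ>0, as t→+∞, V^{(12)}(λ,μ)=[e^{(τ(λ)−τ(μ))/2}S₊^{(12)}(λ,μ)+e^{(τ(μ)−τ(λ))/2}S₋^{(12)}(λ,μ)]/(λ−μ)+O(t^{−1/2+γ}),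 where S₊^{(12)}(λ,μ)=lim_{ε→0⁺}∫_ℝ S₊^{(1)}(λ,ν)S₊^{(2)}(ν,μ)[θ(ν−λ₀)/(ν−μ−iε)+θ(λ₀−ν)/(ν−μ+iε)−θ(ν−λ₀)/(ν−λ+iε)−θ(λ₀−ν)/(ν−λ−iε)]dν and S₋^{(12)}(λ,μ)=lim_{ε→0⁺}∫_ℝ S₋^{(1)}(λ,ν)S₋^{(2)}(ν,μ)[θ(ν−λ₀)/(ν−μ+iε)+θ(λ₀−ν)/(ν−μ−iε)−θ(ν−λ₀)/(ν−λ−iε)−θ(λ₀−ν)/(ν−λ+iε)]dν. -/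
open MeasureTheory Filter Complex Topology Asymptotics

/-- The Heaviside step function: `θ(x) = 1` for `x > 0` and `θ(x) = 0` otherwise. -/
noncomputable def heaviside (x : ℝ) : ℝ := if 0 < x then 1 else 0

/-- The phase `τ(u) = it(u−λ₀)² − itλ₀²`. -/
noncomputable def tauFun (lam0 t u : ℝ) : ℂ :=
  I * (t : ℂ) * ((u : ℂ) - (lam0 : ℂ))^2 - I * (t : ℂ) * (lam0 : ℂ)^2

/-- `f : ℝ → ℂ` extends holomorphically to the strip `{ν : |Im ν| ≤ δ}` with modulus
bounded there by `C/(1+|Re ν|²)`. -/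
def HasStripExtension (δ C : ℝ) (f : ℝ → ℂ) : Prop :=
  ∃ F : ℂ → ℂ, DifferentiableOn ℂ F {z : ℂ | |z.im| ≤ δ} ∧
    (∀ x : ℝ, F (x : ℂ) = f x) ∧
    ∀ z ∈ {z : ℂ | |z.im| ≤ δ}, ‖F z‖ ≤ C / (1 + |z.re|^2)

/-- The regularized kernel
`V_ε(α,β) = [e^{(τ(α)−τ(β))/2} S₊(α,β) + e^{(τ(β)−τ(α))/2} S₋(α,β)]/(α−β−iε)`. -/
noncomputable def Vreg (lam0 t ε : ℝ) (Sp Sm : ℝ → ℝ → ℂ) (α β : ℝ) : ℂ :=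
  (Complex.exp ((tauFun lam0 t α - tauFun lam0 t β) / 2) * Sp α β +
    Complex.exp ((tauFun lam0 t β - tauFun lam0 t α) / 2) * Sm α β) /
    ((α : ℂ) - (β : ℂ) - I * (ε : ℂ))

/-- The part of the strip `|Im z| ≤ δ` in the closed first (`σ = 1`) or fourth (`σ = -1`)
quadrant. -/
def quadrantStrip (σ δ : ℝ) : Set ℂ := {z | 0 ≤ z.re ∧ 0 ≤ σ * z.im ∧ |z.im| ≤ δ}

/-- A curve in `quadrantStrip σ δ`, asymptotic to the positive real axis, which leaves the
origin with slope `σ * δ`. -/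
noncomputable def descentCurve (σ δ x : ℝ) : ℂ := x + ((σ * (δ * x / (1 + x ^ 2)) : ℝ) : ℂ) * I

lemma convex_quadrantStrip (σ δ : ℝ) : Convex ℝ (quadrantStrip σ δ) := by
  intro z hz w hw a b ha hb hab
  obtain ⟨h1, h2, h3⟩ := hz
  obtain ⟨k1, k2, k3⟩ := hw
  rw [abs_le] at h3 k3
  refine ⟨?_, ?_, ?_⟩
  · simp only [add_re, real_smul, re_ofReal_mul]
    positivity
  · simp only [add_im, real_smul, im_ofReal_mul]
    nlinarith [mul_nonneg ha h2, mul_nonneg hb k2]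
  · simp only [add_im, real_smul, im_ofReal_mul, abs_le]
    constructor <;> nlinarith

lemma ofReal_mem_quadrantStrip {σ δ x : ℝ} (hδ : 0 < δ) (hx : 0 ≤ x) :
    (x : ℂ) ∈ quadrantStrip σ δ := by
  simp [quadrantStrip, hx, hδ.le]

lemma descentCurve_re (σ δ x : ℝ) : (descentCurve σ δ x).re = x := by
  simp only [descentCurve, add_re, ofReal_re, re_ofReal_mul, I_re, mul_zero, add_zero]

lemma descentCurve_im (σ δ x : ℝ) :
    (descentCurve σ δ x).im = σ * (δ * x / (1 + x ^ 2)) := by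
  simp only [descentCurve, add_im, ofReal_im, im_ofReal_mul, I_im, mul_one, zero_add]

lemma descentCurve_mem_quadrantStrip {σ δ x : ℝ} (hσ : σ = 1 ∨ σ = -1) (hδ : 0 < δ) (hx : 0 ≤ x) :
    descentCurve σ δ x ∈ quadrantStrip σ δ := by
  have h : 0 ≤ δ * x / (1 + x ^ 2) := by positivity
  have h' : δ * x / (1 + x ^ 2) ≤ δ := by
    rw [div_le_iff₀ (by positivity)]
    nlinarith [sq_nonneg (x - 1)]
  refine ⟨by rwa [descentCurve_re], ?_, ?_⟩
  · rw [descentCurve_im]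
    rcases hσ with rfl | rfl <;> linarith
  · rw [descentCurve_im, abs_mul, abs_of_nonneg h]
    rcases hσ with rfl | rfl <;> simpa

/-- The derivative of `descentCurve`. -/
noncomputable def descentCurveDeriv (σ δ x : ℝ) : ℂ :=
  1 + ((σ * (δ * (1 - x ^ 2) / (1 + x ^ 2) ^ 2) : ℝ) : ℂ) * I

lemma hasDerivAt_descentCurve (σ δ x : ℝ) :
    HasDerivAt (descentCurve σ δ) (descentCurveDeriv σ δ x) x := by
  have h : HasDerivAt (fun x : ℝ => σ * (δ * x / (1 + x ^ 2)))
      (σ * (δ * (1 - x ^ 2) / (1 + x ^ 2) ^ 2)) x := by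
    have h1 : HasDerivAt (fun x : ℝ => δ * x) δ x := by
      simpa using (hasDerivAt_id x).const_mul δ
    have h2 : HasDerivAt (fun x : ℝ => 1 + x ^ 2) (2 * x) x := by
      simpa using (hasDerivAt_pow 2 x).const_add 1
    refine ((h1.div h2 (by positivity)).const_mul σ).congr_deriv ?_
    ring
  exact (hasDerivAt_id x).ofReal_comp.add (h.ofReal_comp.mul_const I)

lemma norm_descentCurveDeriv_le {σ δ : ℝ} (hσ : σ = 1 ∨ σ = -1) (hδ : 0 < δ) (x : ℝ) :
    ‖descentCurveDeriv σ δ x‖ ≤ 1 + δ := by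
  refine (norm_add_le _ _).trans ?_
  have h : |δ * (1 - x ^ 2) / (1 + x ^ 2) ^ 2| ≤ δ := by
    rw [abs_div, abs_mul, abs_of_pos hδ, abs_of_pos (a := (1 + x ^ 2) ^ 2) (by positivity),
      div_le_iff₀ (by positivity)]
    refine mul_le_mul_of_nonneg_left ?_ hδ.le
    rw [abs_le]
    constructor <;> nlinarith [sq_nonneg x, sq_nonneg (x ^ 2)]
  have h' : ‖((σ * (δ * (1 - x ^ 2) / (1 + x ^ 2) ^ 2) : ℝ) : ℂ) * I‖ ≤ δ := by
    rw [norm_mul, norm_I, mul_one, norm_real, Real.norm_eq_abs, abs_mul]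
    rcases hσ with rfl | rfl <;> simpa only [abs_neg, abs_one, one_mul] using h
  simpa using h'

lemma continuous_descentCurve (σ δ : ℝ) : Continuous (descentCurve σ δ) :=
  continuous_iff_continuousAt.2 fun x => (hasDerivAt_descentCurve σ δ x).continuousAt

lemma continuous_descentCurveDeriv (σ δ : ℝ) : Continuous (descentCurveDeriv σ δ) := by
  unfold descentCurveDeriv
  have : Continuous fun x : ℝ => σ * (δ * (1 - x ^ 2) / (1 + x ^ 2) ^ 2) := by
    refine continuous_const.mul (Continuous.div (by fun_prop) (by fun_prop) fun x => ?_)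
    positivity
  fun_prop

lemma integrableOn_Ioi_of_continuousOn_of_norm_le {f : ℝ → ℂ} {B : ℝ}
    (hf : ContinuousOn f (Set.Ici 0)) (hB : ∀ x, 0 ≤ x → ‖f x‖ ≤ B / (1 + x ^ 2)) :
    IntegrableOn f (Set.Ioi 0) := by
  refine Integrable.mono' (g := fun x => B * (1 + x ^ 2)⁻¹) ?_ ?_ ?_
  · exact (integrable_inv_one_add_sq.const_mul B).integrableOn
  · exact (hf.mono Set.Ioi_subset_Ici_self).aestronglyMeasurable measurableSet_Ioi
  · filter_upwards [ae_restrict_mem measurableSet_Ioi] with x hx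
    simpa [div_eq_mul_inv] using hB x (le_of_lt hx)

lemma tendsto_descentCurve_sub (σ δ : ℝ) :
    Tendsto (fun x : ℝ => ‖descentCurve σ δ x - x‖) atTop (𝓝 0) := by
  have h : Tendsto (fun x : ℝ => |σ| * |δ| * x⁻¹) atTop (𝓝 0) := by
    simpa using tendsto_inv_atTop_zero.const_mul (|σ| * |δ|)
  refine squeeze_zero' (Eventually.of_forall fun _ => norm_nonneg _) ?_ h
  filter_upwards [eventually_gt_atTop 0] with x hx
  simp only [descentCurve, add_sub_cancel_left, norm_mul, norm_I, mul_one, norm_real,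
    Real.norm_eq_abs, abs_mul, abs_div, mul_assoc]
  gcongr
  rw [mul_div_assoc]
  gcongr
  rw [abs_of_pos hx, abs_of_pos (by positivity), div_le_iff₀ (by positivity)]
  field_simp
  linarith

/-- Deformation of the positive half-line onto `descentCurve`. -/
lemma integral_Ioi_eq_integral_descentCurve {f : ℂ → ℂ} {σ δ B : ℝ} (hσ : σ = 1 ∨ σ = -1)
    (hδ : 0 < δ) (hf : DifferentiableOn ℂ f (quadrantStrip σ δ))
    (hB : ∀ z ∈ quadrantStrip σ δ, ‖f z‖ ≤ B / (1 + z.re ^ 2)) :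
    ∫ x : ℝ in Set.Ioi 0, f x =
      ∫ x : ℝ in Set.Ioi 0, descentCurveDeriv σ δ x * f (descentCurve σ δ x) := by
  set U := quadrantStrip σ δ
  set c := descentCurve σ δ
  have hcU : ∀ x, 0 ≤ x → c x ∈ U := fun x hx => descentCurve_mem_quadrantStrip hσ hδ hx
  have hrU : ∀ x : ℝ, 0 ≤ x → (x : ℂ) ∈ U := fun x hx => ofReal_mem_quadrantStrip hδ hx
  have hB0 : 0 ≤ B := by
    simpa using (norm_nonneg _).trans (hB 0 (by simpa using hrU 0 le_rfl))
  obtain ⟨g, hg⟩ := (convex_quadrantStrip σ δ).exists_forall_hasDerivWithinAt hf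
  have ftc : ∀ k k' : ℝ → ℂ, (∀ x, HasDerivAt k (k' x) x) → (∀ x, 0 ≤ x → k x ∈ U) →
      Continuous k' → ∀ R, 0 ≤ R →
      ∫ x in (0 : ℝ)..R, k' x * f (k x) = g (k R) - g (k 0) := by
    intro k k' hk hkU hk' R hR
    have hd : ∀ x ∈ Set.Ici (0 : ℝ),
        HasDerivWithinAt (fun y => g (k y)) (k' x * f (k x)) (Set.Ici 0) x := fun x hx =>
      (hg _ (hkU x hx)).scomp x (hk x).hasDerivWithinAt fun y hy => hkU y hy
    have hc : ContinuousOn (fun x => k' x * f (k x)) (Set.Icc 0 R) := by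
      refine hk'.continuousOn.mul (hf.continuousOn.comp ?_ fun x hx => hkU x hx.1)
      exact fun x _ => (hk x).continuousAt.continuousWithinAt
    refine intervalIntegral.integral_eq_sub_of_hasDerivAt_of_le hR
      (fun x hx => ((hd x hx.1).continuousWithinAt).mono Set.Icc_subset_Ici_self)
      (fun x hx => (hd x hx.1.le).hasDerivAt (Ici_mem_nhds hx.1)) ?_
    exact hc.intervalIntegrable_of_Icc hR
  have i1 : IntegrableOn (fun x : ℝ => f x) (Set.Ioi 0) := by
    refine integrableOn_Ioi_of_continuousOn_of_norm_le (B := B) ?_ fun x hx => ?_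
    · exact hf.continuousOn.comp continuous_ofReal.continuousOn fun x hx => hrU x hx
    · simpa using hB x (hrU x hx)
  have i2 : IntegrableOn (fun x : ℝ => descentCurveDeriv σ δ x * f (c x)) (Set.Ioi 0) := by
    refine integrableOn_Ioi_of_continuousOn_of_norm_le (B := (1 + δ) * B) ?_ fun x hx => ?_
    · exact (continuous_descentCurveDeriv σ δ).continuousOn.mul
        (hf.continuousOn.comp (continuous_descentCurve σ δ).continuousOn fun x hx => hcU x hx)
    · have := hB _ (hcU x hx)
      rw [descentCurve_re] at this
      rw [norm_mul, mul_div_assoc]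
      gcongr
      exact norm_descentCurveDeriv_le hσ hδ x
  have t1 := intervalIntegral_tendsto_integral_Ioi 0 i1 tendsto_id
  have t2 := intervalIntegral_tendsto_integral_Ioi 0 i2 tendsto_id
  have hc0 : c 0 = 0 := by simp [c, descentCurve]
  have t3 : Tendsto (fun R : ℝ => (∫ x in (0 : ℝ)..R, descentCurveDeriv σ δ x * f (c x)) -
      ∫ x in (0 : ℝ)..R, f x) atTop (𝓝 0) := by
    have hz : Tendsto (fun R : ℝ => B * ‖c R - R‖) atTop (𝓝 0) := by
      simpa using (tendsto_descentCurve_sub σ δ).const_mul B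
    refine squeeze_zero_norm' ?_ hz
    filter_upwards [eventually_ge_atTop 0] with R hR
    have e1 := ftc c _ (hasDerivAt_descentCurve σ δ) hcU (continuous_descentCurveDeriv σ δ) R hR
    have e2 := ftc (fun x => (x : ℂ)) (fun _ => 1) (fun x => (hasDerivAt_id x).ofReal_comp) hrU
      continuous_const R hR
    simp only [one_mul, ofReal_zero] at e2
    rw [e1, e2, hc0, sub_sub_sub_cancel_right]
    have hseg : segment ℝ (R : ℂ) (c R) ⊆ U :=
      (convex_quadrantStrip σ δ).segment_subset (hrU R hR) (hcU R hR)
    refine (convex_segment _ _).norm_image_sub_le_of_norm_hasDerivWithin_le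
      (fun z hz => (hg z (hseg hz)).mono hseg) (fun z hz => ?_)
      (left_mem_segment ℝ _ _) (right_mem_segment ℝ _ _)
    refine (hB z (hseg hz)).trans (div_le_self hB0 ?_)
    nlinarith [sq_nonneg z.re]
  have := tendsto_nhds_unique (t2.sub t1) t3
  exact (sub_eq_zero.1 this).symm

lemma norm_exp_quadratic {σ : ℝ} (hσ : σ = 1 ∨ σ = -1) (t : ℝ) (z : ℂ) :
    ‖exp (σ * (I * t * z ^ 2))‖ = Real.exp (-(2 * t * (z.re * (σ * z.im)))) := by
  rw [norm_exp]
  congr 1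
  rcases hσ with rfl | rfl <;> simp [pow_two] <;> ring

lemma exists_le_norm_descentCurve_sub {σ δ c : ℝ} (hσ : σ = 1 ∨ σ = -1) (hδ : 0 < δ) (hc : 0 < c) :
    ∃ m : ℝ, 0 < m ∧ ∀ ε : ℝ, 0 < ε → ∀ x : ℝ, 0 ≤ x →
      m ≤ ‖descentCurve σ δ x - (c - I * (σ * ε))‖ ∧
      m ≤ ‖descentCurve σ δ x + (c - I * (σ * ε))‖ := by
  refine ⟨min (c / 2) (δ * (c / 2) / (1 + (3 * c / 2) ^ 2)), by positivity, ?_⟩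
  intro ε hε x hx
  constructor
  · by_cases h : c / 2 ≤ |x - c|
    · refine (min_le_left _ _).trans (h.trans ?_)
      refine le_trans (le_of_eq ?_) (abs_re_le_norm _)
      simp [descentCurve_re]
    · refine (min_le_right _ _).trans (le_trans ?_ (abs_im_le_norm _))
      have e : |(descentCurve σ δ x - (c - I * (σ * ε))).im| = δ * x / (1 + x ^ 2) + ε := by
        have h0 : 0 < δ * x / (1 + x ^ 2) + ε := by positivity
        have : (descentCurve σ δ x - (c - I * (σ * ε))).im = σ * (δ * x / (1 + x ^ 2) + ε) := by
          simp [descentCurve_im]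
          ring
        rw [this, abs_mul, abs_of_pos h0]
        rcases hσ with rfl | rfl <;> simp
      rw [e]
      rw [not_le, abs_lt] at h
      have h1 : δ * (c / 2) / (1 + (3 * c / 2) ^ 2) ≤ δ * x / (1 + x ^ 2) := by
        gcongr <;> linarith
      linarith
  · refine (min_le_left _ _).trans (le_trans ?_ (abs_re_le_norm _))
    have : (descentCurve σ δ x + (c - I * (σ * ε))).re = x + c := by
      simp [descentCurve_re]
    rw [this, abs_of_pos (by linarith)]
    linarith

lemma setIntegral_descent_weight_le {δ t : ℝ} (hδ : 0 < δ) (ht : 0 < t) :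
    IntegrableOn (fun x : ℝ => (1 + (1 + 2 * t * δ) * x ^ 2)⁻¹) (Set.Ioi 0) ∧
    ∫ x : ℝ in Set.Ioi 0, (1 + (1 + 2 * t * δ) * x ^ 2)⁻¹ ≤ Real.pi / √(2 * δ) / √t := by
  set r := √(1 + 2 * t * δ)
  have hr : 0 < r := Real.sqrt_pos.2 (by positivity)
  have hr2 : r ^ 2 = 1 + 2 * t * δ := Real.sq_sqrt (by positivity)
  have e : (fun x : ℝ => (1 + (1 + 2 * t * δ) * x ^ 2)⁻¹) = fun x => (1 + (r * x) ^ 2)⁻¹ := by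
    ext x
    rw [mul_pow, hr2]
  have hi : Integrable fun x : ℝ => (1 + (r * x) ^ 2)⁻¹ :=
    integrable_inv_one_add_sq.comp_mul_left' hr.ne'
  rw [e]
  refine ⟨hi.integrableOn, ?_⟩
  calc ∫ x : ℝ in Set.Ioi 0, (1 + (r * x) ^ 2)⁻¹
      ≤ ∫ x : ℝ, (1 + (r * x) ^ 2)⁻¹ :=
        setIntegral_le_integral hi (Eventually.of_forall fun x => by positivity)
    _ = Real.pi / r := by
        rw [Measure.integral_comp_mul_left (fun x : ℝ => (1 + x ^ 2)⁻¹) r,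
          integral_univ_inv_one_add_sq, abs_of_pos (by positivity), smul_eq_mul]
        field_simp
    _ ≤ Real.pi / √(2 * δ) / √t := by
        rw [div_div, ← Real.sqrt_mul (by positivity)]
        gcongr
        exact Real.sqrt_le_sqrt (by linarith)

/-- Steepest descent bound for an oscillatory Cauchy integral whose pole `c - iσε` or
`-(c - iσε)` lies off the side towards which the contour is deformed. -/
lemma exists_norm_integral_quadrant_le {f : ℂ → ℂ} {σ δ K c : ℝ} (hσ : σ = 1 ∨ σ = -1)
    (hδ : 0 < δ) (hc : 0 < c) (hf : DifferentiableOn ℂ f {z : ℂ | |z.im| ≤ δ})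
    (hK : ∀ z ∈ {z : ℂ | |z.im| ≤ δ}, ‖f z‖ ≤ K / (1 + z.re ^ 2)) :
    ∃ M : ℝ, ∀ t : ℝ, 0 < t → ∀ ε : ℝ, 0 < ε →
      ‖∫ x : ℝ, exp (σ * (I * t * (x : ℂ) ^ 2)) * f x / (x - (c - I * (σ * ε)))‖ ≤ M / √t := by
  obtain ⟨m, hm, hmc⟩ := exists_le_norm_descentCurve_sub hσ hδ hc
  have hK0 : 0 ≤ K := by
    have := (norm_nonneg _).trans (hK 0 (by simp [hδ.le]))
    simpa using this
  refine ⟨(1 + δ) * (2 * K / m) * (Real.pi / √(2 * δ)), fun t ht ε hε => ?_⟩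
  set p : ℂ := c - I * (σ * ε)
  have hpre : p.re = c := by simp [p]
  have hpim : σ * p.im = -ε := by rcases hσ with rfl | rfl <;> simp [p]
  set E : ℂ → ℂ := fun z => exp (σ * (I * t * z ^ 2))
  set g : ℂ → ℂ := fun z => E z * f z / (z - p) - E z * f (-z) / (z + p)
  have hE : Differentiable ℂ E := by fun_prop
  have hEneg : ∀ z, E (-z) = E z := fun z => by simp [E]
  have hstrip : quadrantStrip σ δ ⊆ {z : ℂ | |z.im| ≤ δ} := fun z hz => hz.2.2
  have hneg : ∀ z ∈ {z : ℂ | |z.im| ≤ δ}, -z ∈ {z : ℂ | |z.im| ≤ δ} := fun z hz => by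
    simpa using hz
  have dist1 : ∀ z ∈ quadrantStrip σ δ, ε ≤ ‖z - p‖ := by
    intro z hz
    refine le_trans ?_ (abs_im_le_norm _)
    have h : σ * (z - p).im = σ * z.im + ε := by rw [sub_im, mul_sub, hpim]; ring
    have h' : |(z - p).im| = |σ * (z - p).im| := by
      rw [abs_mul]; rcases hσ with rfl | rfl <;> simp
    rw [h', h]
    exact le_trans (by linarith [hz.2.1]) (le_abs_self _)
  have dist2 : ∀ z ∈ quadrantStrip σ δ, c ≤ ‖z + p‖ := by
    intro z hz
    refine le_trans ?_ (re_le_norm _)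
    rw [add_re, hpre]
    linarith [hz.1]
  have hEle : ∀ z ∈ quadrantStrip σ δ, ‖E z‖ ≤ 1 := by
    intro z hz
    rw [norm_exp_quadratic hσ, Real.exp_le_one_iff, neg_nonpos]
    have := hz.1
    have := hz.2.1
    positivity
  have hfle : ∀ z ∈ quadrantStrip σ δ, ‖f z‖ ≤ K / (1 + z.re ^ 2) ∧
      ‖f (-z)‖ ≤ K / (1 + z.re ^ 2) := fun z hz =>
    ⟨hK z (hstrip hz), by simpa using hK _ (hneg z (hstrip hz))⟩
  have gbound : ∀ z ∈ quadrantStrip σ δ, ∀ m₁ m₂ : ℝ, 0 < m₁ → 0 < m₂ → m₁ ≤ ‖z - p‖ →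
      m₂ ≤ ‖z + p‖ → ‖g z‖ ≤ ‖E z‖ * (K / (1 + z.re ^ 2)) * (1 / m₁ + 1 / m₂) := by
    intro z hz m₁ m₂ h₁ h₂ h₁' h₂'
    refine (norm_sub_le _ _).trans ?_
    rw [norm_div, norm_mul, norm_div, norm_mul, mul_add, mul_one_div, mul_one_div]
    gcongr
    · exact (hfle z hz).1
    · exact (hfle z hz).2
  have hgd : DifferentiableOn ℂ g (quadrantStrip σ δ) := by
    have h1 : DifferentiableOn ℂ (fun z => f (-z)) (quadrantStrip σ δ) :=
      hf.comp differentiable_neg.differentiableOn fun z hz => hneg z (hstrip hz)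
    refine DifferentiableOn.sub (DifferentiableOn.div (hE.differentiableOn.mul (hf.mono hstrip))
      (by fun_prop) fun z hz => ?_) (DifferentiableOn.div (hE.differentiableOn.mul h1)
      (by fun_prop) fun z hz => ?_)
    · exact norm_pos_iff.1 (hε.trans_le (dist1 z hz))
    · exact norm_pos_iff.1 (hc.trans_le (dist2 z hz))
  have hfold : ∫ x : ℝ, E x * f x / (x - p) = ∫ x : ℝ in Set.Ioi 0, g x := by
    have hpx : ∀ x : ℝ, (x : ℂ) - p ≠ 0 := by
      intro x hx
      have := congrArg Complex.im hx
      simp only [sub_im, ofReal_im, zero_im] at this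
      have h0 : p.im = 0 := by linarith
      rw [h0, mul_zero] at hpim
      linarith
    have hcont : Continuous fun x : ℝ => E x * f x / (x - p) := by
      have : Continuous fun x : ℝ => f x :=
        hf.continuousOn.comp_continuous continuous_ofReal fun x => by simp [hδ.le]
      have hEc : Continuous fun x : ℝ => E x := hE.continuous.comp continuous_ofReal
      exact (hEc.mul this).div (by fun_prop) hpx
    have hle : ∀ x : ℝ, ‖E x * f x / (x - p)‖ ≤ K / ε / (1 + x ^ 2) := by
      intro x
      have h1 : ‖E x‖ = 1 := by rw [norm_exp_quadratic hσ]; simp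
      have h2 : ε ≤ ‖(x : ℂ) - p‖ := by
        refine le_trans ?_ (abs_im_le_norm _)
        have : |((x : ℂ) - p).im| = |σ * p.im| := by
          rw [abs_mul]; rcases hσ with rfl | rfl <;> simp
        rw [this, hpim, abs_neg]
        exact le_abs_self _
      have h3 : ‖f x‖ ≤ K / (1 + x ^ 2) := by simpa using hK x (by simp [hδ.le])
      rw [norm_div, norm_mul, h1, one_mul, div_right_comm]
      gcongr
    have hint : Integrable fun x : ℝ => E x * f x / (x - p) := by
      refine Integrable.mono' (g := fun x => K / ε * (1 + x ^ 2)⁻¹)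
        (integrable_inv_one_add_sq.const_mul _) hcont.aestronglyMeasurable
        (Eventually.of_forall fun x => ?_)
      simpa [div_eq_mul_inv] using hle x
    rw [← intervalIntegral.integral_Iic_add_Ioi hint.integrableOn hint.integrableOn (b := 0),
      ← neg_zero, ← integral_comp_neg_Ioi, neg_zero, ← integral_add]
    · refine setIntegral_congr_fun measurableSet_Ioi fun x _ => ?_
      simp only [ofReal_neg, hEneg, g]
      rw [show -(x : ℂ) - p = -(x + p) by ring, div_neg]
      ring
    · exact hint.comp_neg.integrableOn
    · exact hint.integrableOn
  rw [hfold, integral_Ioi_eq_integral_descentCurve (B := K * (1 / ε + 1 / c)) hσ hδ hgd]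
  · obtain ⟨hwi, hwle⟩ := setIntegral_descent_weight_le hδ ht
    calc ‖∫ x : ℝ in Set.Ioi 0, descentCurveDeriv σ δ x * g (descentCurve σ δ x)‖
        ≤ ∫ x : ℝ in Set.Ioi 0,
            (1 + δ) * (2 * K / m) * (1 + (1 + 2 * t * δ) * x ^ 2)⁻¹ := by
          refine norm_integral_le_of_norm_le (hwi.const_mul _) ?_
          filter_upwards [ae_restrict_mem measurableSet_Ioi] with x hx
          have hx : 0 ≤ x := le_of_lt hx
          obtain ⟨hm1, hm2⟩ := hmc ε hε x hx
          have hgx := gbound _ (descentCurve_mem_quadrantStrip hσ hδ hx) m m hm hm hm1 hm2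
          rw [descentCurve_re, norm_exp_quadratic hσ, descentCurve_re, descentCurve_im] at hgx
          have hσ2 : σ * σ = 1 := by rcases hσ with rfl | rfl <;> norm_num
          set y := 2 * t * (x * (δ * x / (1 + x ^ 2)))
          have hy0 : 0 ≤ y := by positivity
          have hy : 2 * t * (x * (σ * (σ * (δ * x / (1 + x ^ 2))))) = y := by
            rw [← mul_assoc σ σ, hσ2, one_mul]
          rw [hy] at hgx
          have hexp : Real.exp (-y) ≤ (1 + y)⁻¹ := by
            rw [Real.exp_neg]
            gcongr
            linarith [Real.add_one_le_exp y]
          rw [norm_mul, mul_assoc (1 + δ)]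
          gcongr
          · exact norm_descentCurveDeriv_le hσ hδ x
          · refine hgx.trans ?_
            calc Real.exp (-y) * (K / (1 + x ^ 2)) * (1 / m + 1 / m)
                ≤ (1 + y)⁻¹ * (K / (1 + x ^ 2)) * (1 / m + 1 / m) := by gcongr
              _ = 2 * K / m * ((1 + x ^ 2) * (1 + y))⁻¹ := by
                field_simp
                ring
              _ = 2 * K / m * (1 + (1 + 2 * t * δ) * x ^ 2)⁻¹ := by
                congr 2
                simp only [y]
                field_simp
                ring
      _ ≤ (1 + δ) * (2 * K / m) * (Real.pi / √(2 * δ) / √t) := by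
          rw [integral_const_mul]
          gcongr
      _ = _ := by ring
  · intro z hz
    refine (gbound z hz ε c hε hc (dist1 z hz) (dist2 z hz)).trans ?_
    have := hEle z hz
    calc ‖E z‖ * (K / (1 + z.re ^ 2)) * (1 / ε + 1 / c)
        ≤ 1 * (K / (1 + z.re ^ 2)) * (1 / ε + 1 / c) := by gcongr
      _ = _ := by ring

/-- Oscillatory Cauchy integrals with stationary point `lam0`, when the pole lies on the side
opposite to the direction of steepest descent. -/
lemma exists_norm_integral_oscillatory_le {f : ℂ → ℂ} {σ s δ K a lam0 : ℝ}
    (hσ : σ = 1 ∨ σ = -1) (hs : s = 1 ∨ s = -1) (hsa : 0 < s * (a - lam0)) (hδ : 0 < δ)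
    (hf : DifferentiableOn ℂ f {z : ℂ | |z.im| ≤ δ})
    (hK : ∀ z ∈ {z : ℂ | |z.im| ≤ δ}, ‖f z‖ ≤ K / (1 + z.re ^ 2)) :
    ∃ M : ℝ, ∀ t : ℝ, 0 < t → ∀ ε : ℝ, 0 < ε →
      ‖∫ x : ℝ, exp (σ * (I * t * ((x : ℂ) - lam0) ^ 2)) * f x / (x - a + I * (σ * s * ε))‖
        ≤ M / √t := by
  have hs2 : s * s = 1 := by rcases hs with rfl | rfl <;> norm_num
  have hsabs : |s| = 1 := by rcases hs with rfl | rfl <;> norm_num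
  have hsne : s ≠ 0 := by rintro rfl; simp at hs2
  have hs2c : (s : ℂ) * s = 1 := by exact_mod_cast hs2
  have hsc : (s : ℂ) ≠ 0 := by exact_mod_cast hsne
  have hK0 : 0 ≤ K := by
    have := (norm_nonneg _).trans (hK 0 (by simp [hδ.le]))
    simpa using this
  have hmaps : ∀ z ∈ {z : ℂ | |z.im| ≤ δ}, (lam0 : ℂ) + s * z ∈ {z : ℂ | |z.im| ≤ δ} := by
    intro z hz
    simpa [abs_mul, hsabs] using hz
  obtain ⟨M, hM⟩ := exists_norm_integral_quadrant_le (f := fun z => f (lam0 + s * z))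
    (K := K * (2 * (1 + lam0 ^ 2))) hσ hδ hsa
    (hf.comp (by fun_prop) hmaps) (fun z hz => by
      refine (hK _ (hmaps z hz)).trans ?_
      have hre : ((lam0 : ℂ) + s * z).re = lam0 + s * z.re := by simp
      rw [hre, mul_div_assoc, div_eq_mul_inv]
      gcongr
      rw [inv_eq_one_div, div_le_div_iff₀ (by positivity) (by positivity)]
      have : z.re ^ 2 = (s * z.re) ^ 2 := by rw [mul_pow, pow_two s, hs2, one_mul]
      rw [this]
      nlinarith [sq_nonneg (s * z.re + 2 * lam0), sq_nonneg (lam0 * (lam0 + s * z.re))])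
  refine ⟨M, fun t ht ε hε => ?_⟩
  refine le_of_eq_of_le ?_ (hM t ht ε hε)
  set h : ℝ → ℂ := fun x =>
    exp (σ * (I * t * ((x : ℂ) - lam0) ^ 2)) * f x / (x - a + I * (σ * s * ε)) with hh
  have e1 : ∫ x : ℝ, h x = ∫ y : ℝ, h (lam0 + s * y) := by
    rw [Measure.integral_comp_mul_left (fun y : ℝ => h (lam0 + y)) s, abs_inv, hsabs, inv_one,
      one_smul, integral_add_left_eq_self]
  have e2 : ∀ y : ℝ, h (lam0 + s * y) = s * (exp (σ * (I * t * (y : ℂ) ^ 2)) *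
      f (lam0 + s * y) / (y - ((s * (a - lam0) : ℝ) - I * (σ * ε)))) := by
    intro y
    simp only [hh, ofReal_add, ofReal_mul, ofReal_sub, add_sub_cancel_left]
    have h1 : ((s : ℂ) * y) ^ 2 = (y : ℂ) ^ 2 := by rw [mul_pow, pow_two, hs2c, one_mul]
    have h2 : (lam0 : ℂ) + s * y - a + I * (σ * s * ε) =
        s * (y - (s * (a - lam0) - I * (σ * ε))) := by
      linear_combination (a - lam0 : ℂ) * hs2c
    have h3 : (s : ℂ)⁻¹ = s := inv_eq_of_mul_eq_one_left hs2c
    rw [h1, h2, div_mul_eq_div_div_swap, div_eq_mul_inv _ (s : ℂ), h3]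
    ring
  rw [e1, integral_congr_ae (Eventually.of_forall e2), integral_const_mul, norm_mul, norm_real,
    Real.norm_eq_abs, hsabs, one_mul]

lemma tendsto_integral_poisson {G : ℝ → ℂ} (hG : Integrable G) {a : ℝ} (ha : ContinuousAt G a) :
    Tendsto (fun ε : ℝ => ∫ x : ℝ, G x * ((ε / ((x - a) ^ 2 + ε ^ 2) : ℝ) : ℂ)) (𝓝[>] 0)
      (𝓝 (Real.pi * G a)) := by
  have h := tendsto_integral_comp_smul_smul_of_integrable' (μ := volume) (F := ℝ)
    (φ := fun x => Real.pi⁻¹ * (1 + x ^ 2)⁻¹) (fun x => by positivity)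
    (by rw [integral_const_mul, integral_univ_inv_one_add_sq, inv_mul_cancel₀ Real.pi_ne_zero])
    ?_ hG ha
  · have h' := (h.comp tendsto_inv_nhdsGT_zero).const_mul (Real.pi : ℂ)
    refine h'.congr' ?_
    filter_upwards [self_mem_nhdsWithin] with ε hε
    have hε : 0 < ε := hε
    simp only [Function.comp]
    rw [← integral_const_mul]
    refine integral_congr_ae (Eventually.of_forall fun x => ?_)
    simp only [Module.finrank_self, pow_one, smul_eq_mul, real_smul]
    have e : ε / ((x - a) ^ 2 + ε ^ 2) =
        Real.pi * (ε⁻¹ * (Real.pi⁻¹ * (1 + (ε⁻¹ * (a - x)) ^ 2)⁻¹)) := by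
      have := Real.pi_ne_zero
      field_simp
      ring
    rw [e]
    push_cast
    ring
  · have h0 : Tendsto (fun x : ℝ => Real.pi⁻¹ * ‖x‖⁻¹) (Bornology.cobounded ℝ) (𝓝 0) := by
      simpa using
        (tendsto_inv_atTop_zero.comp (tendsto_norm_cobounded_atTop (E := ℝ))).const_mul Real.pi⁻¹
    refine squeeze_zero (fun x => by positivity) (fun x => ?_) h0
    have : ‖x‖ * (1 + x ^ 2)⁻¹ ≤ ‖x‖⁻¹ := by
      rcases eq_or_ne x 0 with rfl | hx
      · simp
      have hx' : 0 < ‖x‖ := norm_pos_iff.2 hx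
      rw [← div_eq_mul_inv, inv_eq_one_div, div_le_div_iff₀ (by positivity) hx', ← pow_two,
        Real.norm_eq_abs, sq_abs]
      linarith
    rw [Module.finrank_self, pow_one, mul_left_comm]
    gcongr

lemma exists_tendsto_integral_conj_poisson {G : ℝ → ℂ} (hG : Integrable G) {a : ℝ}
    (ha : DifferentiableAt ℝ G a) :
    ∃ P : ℂ, Tendsto (fun ε : ℝ => ∫ x : ℝ, G x * (((x - a) / ((x - a) ^ 2 + ε ^ 2) : ℝ) : ℂ))
      (𝓝[>] 0) (𝓝 P) := by
  set J : ℝ → ℂ := (Set.Ioo (a - 1) (a + 1)).indicator fun _ => G a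
  have hJ : Integrable J := by
    refine (integrable_indicator_iff measurableSet_Ioo).2 ?_
    exact integrableOn_const (by simp)
  set D : ℝ → ℂ := fun x => (G x - J x) / ((x - a : ℝ) : ℂ)
  have hGJ : Integrable fun x => G x - J x := hG.sub hJ
  obtain ⟨L, hL⟩ := ha.isBigO_sub.bound
  obtain ⟨r, hr, hrL⟩ := Metric.eventually_nhds_iff.1 hL
  have hJ1 : ∀ x, |x - a| < 1 → J x = G a := fun x hx => by
    rw [abs_lt] at hx
    exact Set.indicator_of_mem (by constructor <;> linarith) _
  set r' := min r 1
  have hr' : 0 < r' := by positivity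
  have hDmeas : AEStronglyMeasurable D := by
    have : Measurable fun x : ℝ => (((x - a : ℝ) : ℂ))⁻¹ := by fun_prop
    exact hGJ.aestronglyMeasurable.mul this.aestronglyMeasurable
  have hDle : ∀ x, ‖D x‖ ≤ (Set.Ioo (a - r') (a + r')).indicator (fun _ => |L|) x +
      r'⁻¹ * ‖G x - J x‖ := by
    intro x
    simp only [D, norm_div, norm_real, Real.norm_eq_abs]
    by_cases hx : |x - a| < r'
    · have hxm : x ∈ Set.Ioo (a - r') (a + r') := by
        rw [abs_lt] at hx
        constructor <;> linarith
      rw [Set.indicator_of_mem hxm, hJ1 x (hx.trans_le (min_le_right _ _))]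
      have h1 := hrL (y := x) (by rw [Real.dist_eq]; exact hx.trans_le (min_le_left _ _))
      have h2 : ‖G x - G a‖ / |x - a| ≤ |L| := by
        refine div_le_of_le_mul₀ (abs_nonneg _) (abs_nonneg _) (h1.trans ?_)
        rw [Real.norm_eq_abs]
        gcongr
        exact le_abs_self L
      have : 0 ≤ r'⁻¹ * ‖G x - G a‖ := by positivity
      linarith
    · rw [not_lt] at hx
      have h1 : ‖G x - J x‖ / |x - a| ≤ r'⁻¹ * ‖G x - J x‖ := by
        rw [div_eq_inv_mul]
        gcongr
      have h2 : 0 ≤ (Set.Ioo (a - r') (a + r')).indicator (fun _ => |L|) x :=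
        Set.indicator_nonneg (fun _ _ => abs_nonneg _) _
      linarith
  have hDint : Integrable D := by
    refine Integrable.mono' (Integrable.add ?_ (hGJ.norm.const_mul r'⁻¹)) hDmeas
      (Eventually.of_forall hDle)
    exact (integrable_indicator_iff measurableSet_Ioo).2 (integrableOn_const (by simp))
  refine ⟨∫ x, D x, ?_⟩
  have hlim : Tendsto (fun ε : ℝ => ∫ x, D x * (((x - a) ^ 2 / ((x - a) ^ 2 + ε ^ 2) : ℝ) : ℂ))
      (𝓝[>] 0) (𝓝 (∫ x, D x)) := by
    refine tendsto_integral_filter_of_dominated_convergence (fun x => ‖D x‖) ?_ ?_ hDint.norm ?_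
    · refine Eventually.of_forall fun ε => hDmeas.mul ?_
      have : Measurable fun x : ℝ => (((x - a) ^ 2 / ((x - a) ^ 2 + ε ^ 2) : ℝ) : ℂ) := by fun_prop
      exact this.aestronglyMeasurable
    · refine Eventually.of_forall fun ε => Eventually.of_forall fun x => ?_
      rw [norm_mul, norm_real, Real.norm_eq_abs, abs_of_nonneg (by positivity)]
      refine mul_le_of_le_one_right (norm_nonneg _) (div_le_one_of_le₀ ?_ (by positivity))
      nlinarith [sq_nonneg ε]
    · have hne : ∀ᵐ x : ℝ, x ≠ a := by simp [ae_iff]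
      filter_upwards [hne] with x hx
      have hx' : (x - a) ^ 2 ≠ 0 := pow_ne_zero 2 (sub_ne_zero.2 hx)
      have h1 : ContinuousAt (fun ε : ℝ => (x - a) ^ 2 / ((x - a) ^ 2 + ε ^ 2)) 0 :=
        ContinuousAt.div (by fun_prop) (by fun_prop) (by simpa using hx')
      have h2 : Tendsto (fun ε : ℝ => (x - a) ^ 2 / ((x - a) ^ 2 + ε ^ 2)) (𝓝[>] 0) (𝓝 1) := by
        simpa [hx'] using h1.tendsto.mono_left nhdsWithin_le_nhds
      have h3 := (continuous_ofReal.tendsto 1).comp h2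
      simpa using h3.const_mul (D x)
  refine hlim.congr' ?_
  filter_upwards [self_mem_nhdsWithin] with ε hε
  have hε : 0 < ε := hε
  set k : ℝ → ℂ := fun x => (((x - a) / ((x - a) ^ 2 + ε ^ 2) : ℝ) : ℂ)
  have hkmeas : Measurable k := by fun_prop
  have hkle : ∀ x, ‖k x‖ ≤ ε⁻¹ := by
    intro x
    simp only [k, norm_real, Real.norm_eq_abs, abs_div]
    rw [abs_of_pos (a := (x - a) ^ 2 + ε ^ 2) (by positivity), div_le_iff₀ (by positivity),
      inv_mul_eq_div, le_div_iff₀ hε, ← sq_abs (x - a)]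
    nlinarith [sq_nonneg (|x - a| - ε), sq_nonneg (|x - a|), sq_nonneg ε]
  have hodd : ∫ x, J x * k x = 0 := by
    have h1 : ∫ x, J x * k x = ∫ x, J (2 * a - x) * k (2 * a - x) :=
      (integral_sub_left_eq_self (fun x => J x * k x) volume (2 * a)).symm
    have h2 : ∀ x, J (2 * a - x) * k (2 * a - x) = -(J x * k x) := by
      intro x
      have hk : k (2 * a - x) = -k x := by
        simp only [k]
        rw [show 2 * a - x - a = -(x - a) by ring, neg_sq, neg_div, ofReal_neg]
      have hJx : J (2 * a - x) = J x := by
        simp only [J, Set.indicator, Set.mem_Ioo]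
        congr 1
        exact propext ⟨fun h => ⟨by linarith [h.2], by linarith [h.1]⟩,
          fun h => ⟨by linarith [h.2], by linarith [h.1]⟩⟩
      rw [hk, hJx, mul_neg]
    rw [integral_congr_ae (Eventually.of_forall h2), integral_neg] at h1
    exact self_eq_neg.1 h1
  have i1 : Integrable fun x => (G x - J x) * k x :=
    hGJ.mul_bdd hkmeas.aestronglyMeasurable (Eventually.of_forall hkle)
  have i2 : Integrable fun x => J x * k x :=
    hJ.mul_bdd hkmeas.aestronglyMeasurable (Eventually.of_forall hkle)
  calc ∫ x, D x * (((x - a) ^ 2 / ((x - a) ^ 2 + ε ^ 2) : ℝ) : ℂ)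
      = ∫ x, (G x - J x) * k x := by
        refine integral_congr_ae (Eventually.of_forall fun x => ?_)
        rcases eq_or_ne x a with rfl | hx
        · simp [D, k]
        · have : ((x - a : ℝ) : ℂ) ≠ 0 := by exact_mod_cast sub_ne_zero.2 hx
          simp only [D, k]
          push_cast at this ⊢
          field_simp
    _ = ∫ x, ((G x - J x) * k x + J x * k x) := by rw [integral_add i1 i2, hodd, add_zero]
    _ = ∫ x, G x * k x := integral_congr_ae (Eventually.of_forall fun x => by ring)

lemma measurable_poisson (a ε : ℝ) :
    Measurable fun x : ℝ => ((ε / ((x - a) ^ 2 + ε ^ 2) : ℝ) : ℂ) := by fun_prop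

lemma measurable_conj_poisson (a ε : ℝ) :
    Measurable fun x : ℝ => (((x - a) / ((x - a) ^ 2 + ε ^ 2) : ℝ) : ℂ) := by fun_prop

lemma norm_poisson_le (a x : ℝ) {ε : ℝ} (hε : 0 < ε) :
    ‖((ε / ((x - a) ^ 2 + ε ^ 2) : ℝ) : ℂ)‖ ≤ ε⁻¹ := by
  rw [norm_real, Real.norm_eq_abs, abs_of_pos (by positivity), div_le_iff₀ (by positivity),
    inv_mul_eq_div, le_div_iff₀ hε]
  nlinarith [sq_nonneg (x - a)]

lemma norm_conj_poisson_le (a x : ℝ) {ε : ℝ} (hε : 0 < ε) :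
    ‖(((x - a) / ((x - a) ^ 2 + ε ^ 2) : ℝ) : ℂ)‖ ≤ ε⁻¹ := by
  rw [norm_real, Real.norm_eq_abs, abs_div, abs_of_pos (a := (x - a) ^ 2 + ε ^ 2) (by positivity),
    div_le_iff₀ (by positivity), inv_mul_eq_div, le_div_iff₀ hε, ← sq_abs (x - a)]
  nlinarith [sq_nonneg (|x - a| - ε), sq_nonneg (|x - a|), sq_nonneg ε]

lemma inv_sub_mul_I (a x : ℝ) {ε : ℝ} (hε : 0 < ε) :
    ((x : ℂ) - a - I * ε)⁻¹ = (((x - a) / ((x - a) ^ 2 + ε ^ 2) : ℝ) : ℂ) +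
      I * ((ε / ((x - a) ^ 2 + ε ^ 2) : ℝ) : ℂ) := by
  have hd : (((x - a) ^ 2 + ε ^ 2 : ℝ) : ℂ) ≠ 0 := by
    rw [ofReal_ne_zero]
    positivity
  push_cast at hd ⊢
  refine inv_eq_of_mul_eq_one_right ?_
  field_simp
  linear_combination -(ε : ℂ) ^ 2 * I_sq

lemma inv_add_mul_I (a x : ℝ) {ε : ℝ} (hε : 0 < ε) :
    ((x : ℂ) - a + I * ε)⁻¹ = (((x - a) / ((x - a) ^ 2 + ε ^ 2) : ℝ) : ℂ) -
      I * ((ε / ((x - a) ^ 2 + ε ^ 2) : ℝ) : ℂ) := by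
  have hd : (((x - a) ^ 2 + ε ^ 2 : ℝ) : ℂ) ≠ 0 := by
    rw [ofReal_ne_zero]
    positivity
  push_cast at hd ⊢
  refine inv_eq_of_mul_eq_one_right ?_
  field_simp
  linear_combination -(ε : ℂ) ^ 2 * I_sq

lemma integrable_mul_inv_sub {G : ℝ → ℂ} (hG : Integrable G) (a : ℝ) {ε : ℝ} (hε : 0 < ε) :
    Integrable fun x : ℝ => G x * ((x : ℂ) - a - I * ε)⁻¹ := by
  simp only [inv_sub_mul_I a _ hε, mul_add]
  refine (hG.mul_bdd (measurable_conj_poisson a ε).aestronglyMeasurable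
    (Eventually.of_forall fun x => norm_conj_poisson_le a x hε)).add ?_
  simp only [mul_left_comm _ I]
  exact (hG.mul_bdd (measurable_poisson a ε).aestronglyMeasurable
    (Eventually.of_forall fun x => norm_poisson_le a x hε)).const_mul I

lemma integrable_mul_inv_add {G : ℝ → ℂ} (hG : Integrable G) (a : ℝ) {ε : ℝ} (hε : 0 < ε) :
    Integrable fun x : ℝ => G x * ((x : ℂ) - a + I * ε)⁻¹ := by
  simp only [inv_add_mul_I a _ hε, mul_sub]
  refine (hG.mul_bdd (measurable_conj_poisson a ε).aestronglyMeasurable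
    (Eventually.of_forall fun x => norm_conj_poisson_le a x hε)).sub ?_
  simp only [mul_left_comm _ I]
  exact (hG.mul_bdd (measurable_poisson a ε).aestronglyMeasurable
    (Eventually.of_forall fun x => norm_poisson_le a x hε)).const_mul I

lemma measurable_heaviside : Measurable heaviside :=
  Measurable.ite measurableSet_Ioi measurable_const measurable_const

lemma norm_heaviside_le (x : ℝ) : ‖(heaviside x : ℂ)‖ ≤ 1 := by
  unfold heaviside
  split_ifs <;> simp

lemma heaviside_of_pos {x : ℝ} (hx : 0 < x) : heaviside x = 1 := if_pos hx

lemma heaviside_of_neg {x : ℝ} (hx : x < 0) : heaviside x = 0 := if_neg hx.not_gt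

lemma integrable_mul_heaviside_sub {G : ℝ → ℂ} (hG : Integrable G) (lam0 : ℝ) :
    Integrable fun x : ℝ => G x * heaviside (x - lam0) := by
  have : Measurable fun x : ℝ => (heaviside (x - lam0) : ℂ) :=
    measurable_ofReal.comp (measurable_heaviside.comp (by fun_prop))
  exact hG.mul_bdd this.aestronglyMeasurable (Eventually.of_forall fun x => norm_heaviside_le _)

lemma integrable_mul_sub_heaviside {G : ℝ → ℂ} (hG : Integrable G) (lam0 : ℝ) :
    Integrable fun x : ℝ => G x * heaviside (lam0 - x) := by
  have : Measurable fun x : ℝ => (heaviside (lam0 - x) : ℂ) :=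
    measurable_ofReal.comp (measurable_heaviside.comp (by fun_prop))
  exact hG.mul_bdd this.aestronglyMeasurable (Eventually.of_forall fun x => norm_heaviside_le _)

/-- Sokhotski–Plemelj formulas: `P` is the principal value, and the imaginary shift of the pole
may change sign at a point `lam0 ≠ a`. -/
lemma exists_tendsto_cauchy_integral {G : ℝ → ℂ} (hG : Integrable G) {a lam0 s : ℝ}
    (hs : s = 1 ∨ s = -1) (hsa : 0 < s * (a - lam0)) (ha : DifferentiableAt ℝ G a) :
    ∃ P : ℂ,
      Tendsto (fun ε : ℝ => ∫ x : ℝ, G x * ((x : ℂ) - a - I * ε)⁻¹) (𝓝[>] 0)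
        (𝓝 (P + I * (Real.pi * G a))) ∧
      Tendsto (fun ε : ℝ => ∫ x : ℝ, G x * ((x : ℂ) - a + I * ε)⁻¹) (𝓝[>] 0)
        (𝓝 (P - I * (Real.pi * G a))) ∧
      Tendsto (fun ε : ℝ => ∫ x : ℝ, G x * (heaviside (x - lam0) / ((x : ℂ) - a - I * ε) +
        heaviside (lam0 - x) / ((x : ℂ) - a + I * ε))) (𝓝[>] 0)
        (𝓝 (P + I * (Real.pi * (s * G a)))) ∧
      Tendsto (fun ε : ℝ => ∫ x : ℝ, G x * (heaviside (x - lam0) / ((x : ℂ) - a + I * ε) +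
        heaviside (lam0 - x) / ((x : ℂ) - a - I * ε))) (𝓝[>] 0)
        (𝓝 (P - I * (Real.pi * (s * G a)))) := by
  obtain ⟨P, hP⟩ := exists_tendsto_integral_conj_poisson hG ha
  have key : ∀ H : ℝ → ℂ, Integrable H → ContinuousAt H a → ∀ c : ℂ,
      Tendsto (fun ε : ℝ => ∫ x : ℝ, (G x * (((x - a) / ((x - a) ^ 2 + ε ^ 2) : ℝ) : ℂ) +
        c * (H x * ((ε / ((x - a) ^ 2 + ε ^ 2) : ℝ) : ℂ)))) (𝓝[>] 0)
        (𝓝 (P + c * (Real.pi * H a))) := by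
    intro H hH hHa c
    refine (hP.add ((tendsto_integral_poisson hH hHa).const_mul c)).congr' ?_
    filter_upwards [self_mem_nhdsWithin] with ε hε
    rw [integral_add, integral_const_mul]
    · exact hG.mul_bdd (measurable_conj_poisson a ε).aestronglyMeasurable
        (Eventually.of_forall fun x => norm_conj_poisson_le a x hε)
    · exact (hH.mul_bdd (measurable_poisson a ε).aestronglyMeasurable
        (Eventually.of_forall fun x => norm_poisson_le a x hε)).const_mul c
  set W : ℝ → ℂ := fun x => G x * heaviside (x - lam0) - G x * heaviside (lam0 - x)
  have hW : Integrable W :=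
    (integrable_mul_heaviside_sub hG lam0).sub (integrable_mul_sub_heaviside hG lam0)
  have hWev : ∀ x, 0 < s * (x - lam0) → W x = s * G x := by
    intro x hx
    rcases hs with rfl | rfl
    · have h1 : 0 < x - lam0 := by linarith
      have h2 : lam0 - x < 0 := by linarith
      simp [W, heaviside_of_pos h1, heaviside_of_neg h2]
    · have h1 : x - lam0 < 0 := by linarith
      have h2 : 0 < lam0 - x := by linarith
      simp [W, heaviside_of_pos h2, heaviside_of_neg h1]
  have hWa : ContinuousAt W a := by
    have h1 : ContinuousAt (fun x => (s : ℂ) * G x) a := ha.continuousAt.const_mul _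
    refine h1.congr ?_
    have h2 : ContinuousAt (fun x => s * (x - lam0)) a := by fun_prop
    filter_upwards [h2.eventually (lt_mem_nhds hsa)] with x hx
    exact (hWev x hx).symm
  have hne : ∀ᵐ x : ℝ, x ≠ lam0 := by simp [ae_iff]
  have hsum : ∀ x, x ≠ lam0 → heaviside (x - lam0) = 1 ∧ heaviside (lam0 - x) = 0 ∨
      heaviside (x - lam0) = 0 ∧ heaviside (lam0 - x) = 1 := by
    intro x hx
    rcases lt_or_gt_of_ne hx with h | h
    · exact Or.inr ⟨heaviside_of_neg (by linarith), heaviside_of_pos (by linarith)⟩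
    · exact Or.inl ⟨heaviside_of_pos (by linarith), heaviside_of_neg (by linarith)⟩
  refine ⟨P, ?_, ?_, ?_, ?_⟩
  · refine (key G hG ha.continuousAt I).congr' ?_
    filter_upwards [self_mem_nhdsWithin] with ε hε
    refine integral_congr_ae (Eventually.of_forall fun x => ?_)
    simp only [inv_sub_mul_I a x hε]
    ring
  · rw [sub_eq_add_neg, ← neg_mul]
    refine (key G hG ha.continuousAt (-I)).congr' ?_
    filter_upwards [self_mem_nhdsWithin] with ε hε
    refine integral_congr_ae (Eventually.of_forall fun x => ?_)
    simp only [inv_add_mul_I a x hε]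
    ring
  · rw [← hWev a hsa]
    refine (key W hW hWa I).congr' ?_
    filter_upwards [self_mem_nhdsWithin] with ε hε
    refine integral_congr_ae ?_
    filter_upwards [hne] with x hx
    rcases hsum x hx with ⟨h1, h2⟩ | ⟨h1, h2⟩ <;>
    · simp only [W, div_eq_mul_inv, inv_add_mul_I a x hε, inv_sub_mul_I a x hε, h1, h2]
      push_cast
      ring
  · rw [← hWev a hsa, sub_eq_add_neg, ← neg_mul]
    refine (key W hW hWa (-I)).congr' ?_
    filter_upwards [self_mem_nhdsWithin] with ε hε
    refine integral_congr_ae ?_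
    filter_upwards [hne] with x hx
    rcases hsum x hx with ⟨h1, h2⟩ | ⟨h1, h2⟩ <;>
    · simp only [W, div_eq_mul_inv, inv_add_mul_I a x hε, inv_sub_mul_I a x hε, h1, h2]
      push_cast
      ring

/-- The product of two functions with strip extensions extends with the same decay. -/
lemma HasStripExtension.mul {δ C : ℝ} {f g : ℝ → ℂ} (hδ : 0 < δ) (hf : HasStripExtension δ C f)
    (hg : HasStripExtension δ C g) : HasStripExtension δ (C * C) fun x => f x * g x := by
  obtain ⟨F, hFd, hFe, hFb⟩ := hf
  obtain ⟨H, hHd, hHe, hHb⟩ := hg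
  have hC : 0 ≤ C := by
    have := (norm_nonneg _).trans (hFb 0 (by simp [hδ.le]))
    simpa using this
  refine ⟨fun z => F z * H z, hFd.mul hHd, fun x => by simp only [hFe, hHe], fun z hz => ?_⟩
  have h1 : C / (1 + |z.re| ^ 2) ≤ C := div_le_self hC (by nlinarith [sq_nonneg |z.re|])
  rw [norm_mul, mul_div_right_comm]
  exact mul_le_mul (hFb z hz) ((hHb z hz).trans h1) (norm_nonneg _)
    ((norm_nonneg _).trans (hFb z hz))

lemma HasStripExtension.differentiable {δ C : ℝ} {f : ℝ → ℂ} (hδ : 0 < δ)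
    (hf : HasStripExtension δ C f) : Differentiable ℝ f := by
  obtain ⟨F, hFd, hFe, -⟩ := hf
  intro x
  have hmem : {z : ℂ | |z.im| ≤ δ} ∈ 𝓝 (x : ℂ) := by
    have h : ContinuousAt (fun z : ℂ => |z.im|) x := by fun_prop
    have h' : (fun z : ℂ => |z.im|) (x : ℂ) < δ := by simpa using hδ
    filter_upwards [h.eventually (gt_mem_nhds h')] with z hz using hz.le
  have h := (hFd.differentiableAt hmem).hasDerivAt.comp_ofReal
  simp only [hFe] at h
  exact h.differentiableAt

lemma HasStripExtension.integrable {δ C : ℝ} {f : ℝ → ℂ} (hδ : 0 < δ)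
    (hf : HasStripExtension δ C f) : Integrable f := by
  have hc := (hf.differentiable hδ).continuous
  obtain ⟨F, -, hFe, hFb⟩ := hf
  refine Integrable.mono' (g := fun x => C * (1 + x ^ 2)⁻¹)
    (integrable_inv_one_add_sq.const_mul _) hc.aestronglyMeasurable
    (Eventually.of_forall fun x => ?_)
  have := hFb x (by simp [hδ.le])
  simpa [hFe, div_eq_mul_inv] using this

lemma integral_mul_sub_inv {G : ℝ → ℂ} (hG : Integrable G) (lam mu : ℝ) {ε : ℝ} (hε : 0 < ε) :
    ∫ x : ℝ, G x * (((x : ℂ) - mu - I * ε)⁻¹ - ((x : ℂ) - lam + I * ε)⁻¹) =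
      (∫ x : ℝ, G x * ((x : ℂ) - mu - I * ε)⁻¹) - ∫ x : ℝ, G x * ((x : ℂ) - lam + I * ε)⁻¹ := by
  rw [← integral_sub (integrable_mul_inv_sub hG mu hε) (integrable_mul_inv_add hG lam hε)]
  exact integral_congr_ae (Eventually.of_forall fun x => by ring)

/-- Integrability of the Cauchy kernel whose imaginary shift changes sign at `lam0`. -/
lemma integrable_mul_heaviside_kernel {G : ℝ → ℂ} (hG : Integrable G) (lam0 a : ℝ) {ε : ℝ}
    (hε : 0 < ε) :
    Integrable (fun x : ℝ => G x * (heaviside (x - lam0) / ((x : ℂ) - a - I * ε) +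
        heaviside (lam0 - x) / ((x : ℂ) - a + I * ε))) ∧
    Integrable fun x : ℝ => G x * (heaviside (x - lam0) / ((x : ℂ) - a + I * ε) +
        heaviside (lam0 - x) / ((x : ℂ) - a - I * ε)) := by
  have h1 := integrable_mul_heaviside_sub hG lam0
  have h2 := integrable_mul_sub_heaviside hG lam0
  constructor
  · refine ((integrable_mul_inv_sub h1 a hε).add (integrable_mul_inv_add h2 a hε)).congr
      (Eventually.of_forall fun x => ?_)
    simp only [Pi.add_apply]
    ring
  · refine ((integrable_mul_inv_add h1 a hε).add (integrable_mul_inv_sub h2 a hε)).congr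
      (Eventually.of_forall fun x => ?_)
    simp only [Pi.add_apply]
    ring

/-- Comparison of the Cauchy integral of a non-oscillating product with the integrals in which
the sign of the imaginary shift changes at `lam0`. -/
lemma exists_tendsto_heaviside_integrals {G : ℝ → ℂ} (hG : Integrable G)
    (hd : Differentiable ℝ G) {lam mu lam0 sl sm : ℝ} (hsl : sl = 1 ∨ sl = -1)
    (hsm : sm = 1 ∨ sm = -1) (hl : 0 < sl * (lam - lam0)) (hm : 0 < sm * (mu - lam0)) :
    ∃ N : ℂ,
      Tendsto (fun ε : ℝ => ∫ x : ℝ, G x * (((x : ℂ) - mu - I * ε)⁻¹ -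
        ((x : ℂ) - lam + I * ε)⁻¹)) (𝓝[>] 0) (𝓝 N) ∧
      Tendsto (fun ε : ℝ => ∫ x : ℝ, G x *
          ((heaviside (x - lam0) : ℂ) / ((x : ℂ) - (mu : ℂ) - I * (ε : ℂ))
            + (heaviside (lam0 - x) : ℂ) / ((x : ℂ) - (mu : ℂ) + I * (ε : ℂ))
            - (heaviside (x - lam0) : ℂ) / ((x : ℂ) - (lam : ℂ) + I * (ε : ℂ))
            - (heaviside (lam0 - x) : ℂ) / ((x : ℂ) - (lam : ℂ) - I * (ε : ℂ))))
        (𝓝[>] 0) (𝓝 (N - I * Real.pi * ((1 - sm) * G mu + (1 - sl) * G lam))) ∧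
      Tendsto (fun ε : ℝ => ∫ x : ℝ, G x *
          ((heaviside (x - lam0) : ℂ) / ((x : ℂ) - (mu : ℂ) + I * (ε : ℂ))
            + (heaviside (lam0 - x) : ℂ) / ((x : ℂ) - (mu : ℂ) - I * (ε : ℂ))
            - (heaviside (x - lam0) : ℂ) / ((x : ℂ) - (lam : ℂ) - I * (ε : ℂ))
            - (heaviside (lam0 - x) : ℂ) / ((x : ℂ) - (lam : ℂ) + I * (ε : ℂ))))
        (𝓝[>] 0) (𝓝 (N - I * Real.pi * ((1 + sm) * G mu + (1 + sl) * G lam))) := by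
  obtain ⟨P, hP1, -, hP3, hP4⟩ := exists_tendsto_cauchy_integral hG hsm hm (hd mu)
  obtain ⟨Q, -, hQ2, hQ3, hQ4⟩ := exists_tendsto_cauchy_integral hG hsl hl (hd lam)
  refine ⟨_, (hP1.sub hQ2).congr' ?_, ?_, ?_⟩
  · filter_upwards [self_mem_nhdsWithin] with ε hε
    exact (integral_mul_sub_inv hG lam mu hε).symm
  · convert (hP3.sub hQ4).congr' ?_ using 2
    · ring
    · filter_upwards [self_mem_nhdsWithin] with ε hε
      rw [← integral_sub (integrable_mul_heaviside_kernel hG lam0 mu hε).1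
        (integrable_mul_heaviside_kernel hG lam0 lam hε).2]
      exact integral_congr_ae (Eventually.of_forall fun x => by ring)
  · convert (hP4.sub hQ3).congr' ?_ using 2
    · ring
    · filter_upwards [self_mem_nhdsWithin] with ε hε
      rw [← integral_sub (integrable_mul_heaviside_kernel hG lam0 mu hε).2
        (integrable_mul_heaviside_kernel hG lam0 lam hε).1]
      exact integral_congr_ae (Eventually.of_forall fun x => by ring)

/-- The oscillating factor `e^{σ i t (x - λ₀)²}`. -/
noncomputable def quadraticPhase (lam0 σ t x : ℝ) : ℂ := exp (σ * (I * t * ((x : ℂ) - lam0) ^ 2))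

lemma differentiable_quadraticPhase (lam0 σ t : ℝ) :
    Differentiable ℝ (quadraticPhase lam0 σ t) := by
  unfold quadraticPhase
  have : Differentiable ℝ fun x : ℝ => (x : ℂ) := ofRealCLM.differentiable
  fun_prop

lemma norm_quadraticPhase (lam0 σ t x : ℝ) : ‖quadraticPhase lam0 σ t x‖ = 1 := by
  have : (σ : ℂ) * (I * t * ((x : ℂ) - lam0) ^ 2) = ((σ * (t * (x - lam0) ^ 2) : ℝ) : ℂ) * I := by
    push_cast
    ring
  rw [quadraticPhase, this, norm_exp_ofReal_mul_I]

lemma HasStripExtension.integrable_quadraticPhase_mul {δ C : ℝ} {G : ℝ → ℂ} (hδ : 0 < δ)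
    (hG : HasStripExtension δ C G) (lam0 σ t : ℝ) :
    Integrable fun x => quadraticPhase lam0 σ t x * G x :=
  (hG.integrable hδ).bdd_mul
    (differentiable_quadraticPhase lam0 σ t).continuous.aestronglyMeasurable
    (Eventually.of_forall fun x => (norm_quadraticPhase lam0 σ t x).le)

/-- The principal value of an oscillatory Cauchy integral, up to `O(t^{-1/2})`. -/
lemma HasStripExtension.exists_norm_principal_value_sub_le {δ C : ℝ} {G : ℝ → ℂ} (hδ : 0 < δ)
    (hG : HasStripExtension δ C G) {a lam0 s σ : ℝ} (hσ : σ = 1 ∨ σ = -1) (hs : s = 1 ∨ s = -1)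
    (hsa : 0 < s * (a - lam0)) :
    ∃ M : ℝ, ∀ t : ℝ, 0 < t → ∃ P : ℂ,
      Tendsto (fun ε : ℝ => ∫ x : ℝ, quadraticPhase lam0 σ t x * G x * ((x : ℂ) - a - I * ε)⁻¹)
        (𝓝[>] 0) (𝓝 (P + I * (Real.pi * (quadraticPhase lam0 σ t a * G a)))) ∧
      Tendsto (fun ε : ℝ => ∫ x : ℝ, quadraticPhase lam0 σ t x * G x * ((x : ℂ) - a + I * ε)⁻¹)
        (𝓝[>] 0) (𝓝 (P - I * (Real.pi * (quadraticPhase lam0 σ t a * G a)))) ∧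
      ‖P - σ * s * (I * (Real.pi * (quadraticPhase lam0 σ t a * G a)))‖ ≤ M / √t := by
  obtain ⟨F, hFd, hFe, hFb⟩ := id hG
  obtain ⟨M, hM⟩ := exists_norm_integral_oscillatory_le hσ hs hsa hδ hFd
    (fun z hz => by simpa only [sq_abs] using hFb z hz)
  refine ⟨M, fun t ht => ?_⟩
  obtain ⟨P, h1, h2, -⟩ := exists_tendsto_cauchy_integral
    (hG.integrable_quadraticPhase_mul hδ lam0 σ t) hs hsa
    (((differentiable_quadraticPhase lam0 σ t).mul (hG.differentiable hδ)) a)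
  refine ⟨P, h1, h2, ?_⟩
  have hσs : σ * s = 1 ∨ σ * s = -1 := by
    rcases hσ with rfl | rfl <;> rcases hs with rfl | rfl <;> norm_num
  have hσs' : (σ : ℂ) * s = ((σ * s : ℝ) : ℂ) := by push_cast; rfl
  simp only [hFe, hσs'] at hM
  rw [hσs']
  rcases hσs with h | h
  · rw [h, ofReal_one, one_mul]
    refine le_of_tendsto h2.norm ?_
    filter_upwards [self_mem_nhdsWithin] with ε hε
    have := hM t ht ε hε
    simpa only [quadraticPhase, h, ofReal_one, one_mul, div_eq_mul_inv] using this
  · rw [h, ofReal_neg, ofReal_one, neg_one_mul, sub_neg_eq_add]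
    refine le_of_tendsto h1.norm ?_
    filter_upwards [self_mem_nhdsWithin] with ε hε
    have := hM t ht ε hε
    simpa only [quadraticPhase, h, ofReal_neg, ofReal_one, neg_one_mul, mul_neg, ← sub_eq_add_neg,
      div_eq_mul_inv] using this

lemma HasStripExtension.exists_norm_oscillatory_limit_sub_le {δ C : ℝ} {G : ℝ → ℂ} (hδ : 0 < δ)
    (hG : HasStripExtension δ C G) {lam mu lam0 sl sm σ : ℝ} (hσ : σ = 1 ∨ σ = -1)
    (hsl : sl = 1 ∨ sl = -1) (hsm : sm = 1 ∨ sm = -1) (hl : 0 < sl * (lam - lam0))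
    (hm : 0 < sm * (mu - lam0)) :
    ∃ M : ℝ, ∀ t : ℝ, 0 < t → ∃ N : ℂ,
      Tendsto (fun ε : ℝ => ∫ x : ℝ, quadraticPhase lam0 σ t x * G x *
        (((x : ℂ) - mu - I * ε)⁻¹ - ((x : ℂ) - lam + I * ε)⁻¹)) (𝓝[>] 0) (𝓝 N) ∧
      ‖N - I * Real.pi * ((1 + σ * sm) * (quadraticPhase lam0 σ t mu * G mu) +
        (1 - σ * sl) * (quadraticPhase lam0 σ t lam * G lam))‖ ≤ M / √t := by
  obtain ⟨M₁, h₁⟩ := hG.exists_norm_principal_value_sub_le hδ hσ hsm hm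
  obtain ⟨M₂, h₂⟩ := hG.exists_norm_principal_value_sub_le hδ hσ hsl hl
  refine ⟨M₁ + M₂, fun t ht => ?_⟩
  obtain ⟨P, hP, -, hPM⟩ := h₁ t ht
  obtain ⟨Q, -, hQ, hQM⟩ := h₂ t ht
  refine ⟨_, (hP.sub hQ).congr' ?_, ?_⟩
  · filter_upwards [self_mem_nhdsWithin] with ε hε
    exact (integral_mul_sub_inv (hG.integrable_quadraticPhase_mul hδ lam0 σ t) lam mu hε).symm
  · rw [add_div]
    refine le_trans (le_of_eq ?_) ((norm_sub_le _ _).trans (add_le_add hPM hQM))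
    congr 1
    ring

lemma quadraticPhase_eq_exp_tauFun (lam0 σ t x : ℝ) :
    quadraticPhase lam0 σ t x = exp (σ * (tauFun lam0 t x + I * t * (lam0 : ℂ) ^ 2)) := by
  rw [quadraticPhase, tauFun, sub_add_cancel]

/-- Expansion of the product of two regularized kernels into partial fractions. -/
lemma Vreg_mul_Vreg (lam mu lam0 t : ℝ) {ε : ℝ} (hε : 0 < ε)
    (Sp1 Sm1 Sp2 Sm2 : ℝ → ℝ → ℂ) (x : ℝ) :
    Vreg lam0 t ε Sp1 Sm1 lam x * Vreg lam0 t ε Sp2 Sm2 x mu =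
      ((lam : ℂ) - mu - 2 * I * ε)⁻¹ *
      (exp ((tauFun lam0 t lam - tauFun lam0 t mu) / 2) * (Sp1 lam x * Sp2 x mu *
          (((x : ℂ) - mu - I * ε)⁻¹ - ((x : ℂ) - lam + I * ε)⁻¹)) +
        exp ((tauFun lam0 t mu - tauFun lam0 t lam) / 2) * (Sm1 lam x * Sm2 x mu *
          (((x : ℂ) - mu - I * ε)⁻¹ - ((x : ℂ) - lam + I * ε)⁻¹)) +
        exp ((tauFun lam0 t lam + tauFun lam0 t mu) / 2 + I * t * (lam0 : ℂ) ^ 2) *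
          (quadraticPhase lam0 (-1) t x * (Sp1 lam x * Sm2 x mu) *
          (((x : ℂ) - mu - I * ε)⁻¹ - ((x : ℂ) - lam + I * ε)⁻¹)) +
        exp (-((tauFun lam0 t lam + tauFun lam0 t mu) / 2 + I * t * (lam0 : ℂ) ^ 2)) *
          (quadraticPhase lam0 1 t x * (Sm1 lam x * Sp2 x mu) *
          (((x : ℂ) - mu - I * ε)⁻¹ - ((x : ℂ) - lam + I * ε)⁻¹))) := by
  have n1 : (x : ℂ) - mu - I * ε ≠ 0 := by
    intro h
    have := congrArg Complex.im h
    simp at this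
    exact hε.ne' this
  have n2 : (lam : ℂ) - x - I * ε ≠ 0 := by
    intro h
    have := congrArg Complex.im h
    simp at this
    exact hε.ne' this
  have n3 : (lam : ℂ) - mu - 2 * I * ε ≠ 0 := by
    intro h
    have := congrArg Complex.im h
    simp at this
    exact hε.ne' this
  have hbr : ((x : ℂ) - mu - I * ε)⁻¹ - ((x : ℂ) - lam + I * ε)⁻¹ =
      ((lam : ℂ) - mu - 2 * I * ε) * (((lam : ℂ) - x - I * ε)⁻¹ * ((x : ℂ) - mu - I * ε)⁻¹) := by
    rw [show (x : ℂ) - lam + I * ε = -((lam : ℂ) - x - I * ε) by ring, inv_neg]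
    field_simp
    ring
  rw [hbr]
  simp only [Vreg, quadraticPhase_eq_exp_tauFun]
  set a := tauFun lam0 t lam
  set b := tauFun lam0 t mu
  set c := tauFun lam0 t x
  set d := I * (t : ℂ) * (lam0 : ℂ) ^ 2
  have e1 : exp ((a - b) / 2) = exp ((a - c) / 2) * exp ((c - b) / 2) := by
    rw [← exp_add]; congr 1; ring
  have e2 : exp ((b - a) / 2) = exp ((c - a) / 2) * exp ((b - c) / 2) := by
    rw [← exp_add]; congr 1; ring
  have e3 : exp ((a + b) / 2 + d) * exp (((-1 : ℝ) : ℂ) * (c + d)) =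
      exp ((a - c) / 2) * exp ((b - c) / 2) := by
    rw [← exp_add, ← exp_add]; congr 1; push_cast; ring
  have e4 : exp (-((a + b) / 2 + d)) * exp (((1 : ℝ) : ℂ) * (c + d)) =
      exp ((c - a) / 2) * exp ((c - b) / 2) := by
    rw [← exp_add, ← exp_add]; congr 1; push_cast; ring
  simp only [← mul_assoc]
  rw [e3, e4, e1, e2]
  simp only [div_eq_mul_inv _ ((lam : ℂ) - x - I * ε), div_eq_mul_inv _ ((x : ℂ) - mu - I * ε)]
  field_simp
  ring

lemma exists_sign {x y : ℝ} (h : x ≠ y) : ∃ s : ℝ, (s = 1 ∨ s = -1) ∧ 0 < s * (x - y) := by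
  rcases lt_or_gt_of_ne h with h | h
  · exact ⟨-1, Or.inr rfl, by linarith⟩
  · exact ⟨1, Or.inl rfl, by linarith⟩

lemma integral_linear_combination {c₁ c₂ c₃ c₄ : ℂ} {f₁ f₂ f₃ f₄ : ℝ → ℂ} (h₁ : Integrable f₁)
    (h₂ : Integrable f₂) (h₃ : Integrable f₃) (h₄ : Integrable f₄) :
    ∫ x, c₁ * f₁ x + c₂ * f₂ x + c₃ * f₃ x + c₄ * f₄ x =
      c₁ * (∫ x, f₁ x) + c₂ * (∫ x, f₂ x) + c₃ * (∫ x, f₃ x) + c₄ * ∫ x, f₄ x := by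
  have h₁₂ : Integrable fun x => c₁ * f₁ x + c₂ * f₂ x := (h₁.const_mul c₁).add (h₂.const_mul c₂)
  have h₁₂₃ : Integrable fun x => c₁ * f₁ x + c₂ * f₂ x + c₃ * f₃ x := h₁₂.add (h₃.const_mul c₃)
  rw [integral_add h₁₂₃ (h₄.const_mul c₄), integral_add h₁₂ (h₃.const_mul c₃),
    integral_add (h₁.const_mul c₁) (h₂.const_mul c₂)]
  simp only [integral_const_mul]

/-- **Lemma 1 of the paper.**  The operator product of two kernels of the type
`V(λ,μ) = [e^{(τ(λ)−τ(μ))/2}S₊(λ,μ) + e^{(τ(μ)−τ(λ))/2}S₋(λ,μ)]/(λ−μ)`, nonsingular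
on the diagonal since `S₊(ν,ν) = −S₋(ν,ν)`, is asymptotically (as `t → +∞` with
`λ₀ = x/2t` fixed) a kernel of the same type, with `S₊^{(12)}`, `S₋^{(12)}` given by
(Splus), (Sminus). -/
theorem kernel_product_lemma (lam0 : ℝ) (Sp1 Sm1 Sp2 Sm2 : ℝ → ℝ → ℂ)
    (δ C : ℝ) (hδ : 0 < δ) (hC : 0 < C)
    (hreg : ∀ S ∈ ([Sp1, Sm1, Sp2, Sm2] : List (ℝ → ℝ → ℂ)), ∀ w : ℝ,
      HasStripExtension δ C (fun ν : ℝ => S w ν) ∧ HasStripExtension δ C (fun ν : ℝ => S ν w))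
    (hdiag1 : ∀ ν : ℝ, Sp1 ν ν = - Sm1 ν ν) (hdiag2 : ∀ ν : ℝ, Sp2 ν ν = - Sm2 ν ν)
    (lam mu : ℝ) (hlm : lam ≠ mu) (hl : lam ≠ lam0) (hm : mu ≠ lam0) :
    ∃ S12p S12m : ℂ,
      Tendsto (fun ε : ℝ => ∫ ν : ℝ, Sp1 lam ν * Sp2 ν mu *
          ((heaviside (ν - lam0) : ℂ) / ((ν : ℂ) - (mu : ℂ) - I * (ε : ℂ))
            + (heaviside (lam0 - ν) : ℂ) / ((ν : ℂ) - (mu : ℂ) + I * (ε : ℂ))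
            - (heaviside (ν - lam0) : ℂ) / ((ν : ℂ) - (lam : ℂ) + I * (ε : ℂ))
            - (heaviside (lam0 - ν) : ℂ) / ((ν : ℂ) - (lam : ℂ) - I * (ε : ℂ))))
        (𝓝[>] 0) (𝓝 S12p) ∧
      Tendsto (fun ε : ℝ => ∫ ν : ℝ, Sm1 lam ν * Sm2 ν mu *
          ((heaviside (ν - lam0) : ℂ) / ((ν : ℂ) - (mu : ℂ) + I * (ε : ℂ))
            + (heaviside (lam0 - ν) : ℂ) / ((ν : ℂ) - (mu : ℂ) - I * (ε : ℂ))
            - (heaviside (ν - lam0) : ℂ) / ((ν : ℂ) - (lam : ℂ) - I * (ε : ℂ))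
            - (heaviside (lam0 - ν) : ℂ) / ((ν : ℂ) - (lam : ℂ) + I * (ε : ℂ))))
        (𝓝[>] 0) (𝓝 S12m) ∧
      ∃ T : ℝ, ∃ V12 : ℝ → ℂ,
        (∀ t : ℝ, T ≤ t → Tendsto (fun ε : ℝ =>
            ∫ ν : ℝ, Vreg lam0 t ε Sp1 Sm1 lam ν * Vreg lam0 t ε Sp2 Sm2 ν mu)
          (𝓝[>] 0) (𝓝 (V12 t))) ∧
        ∀ γ : ℝ, 0 < γ →
          (fun t : ℝ => V12 t -
              (Complex.exp ((tauFun lam0 t lam - tauFun lam0 t mu) / 2) * S12p +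
                Complex.exp ((tauFun lam0 t mu - tauFun lam0 t lam) / 2) * S12m) /
                ((lam : ℂ) - (mu : ℂ)))
            =O[atTop] fun t : ℝ => t ^ (-(1/2) + γ) := by
  have hS : ∀ S ∈ ([Sp1, Sm1, Sp2, Sm2] : List (ℝ → ℝ → ℂ)),
      HasStripExtension δ C (S lam) ∧ HasStripExtension δ C fun ν => S ν mu :=
    fun S hS => ⟨(hreg S hS lam).1, (hreg S hS mu).2⟩
  have hpp := (hS Sp1 (by simp)).1.mul hδ (hS Sp2 (by simp)).2
  have hmm := (hS Sm1 (by simp)).1.mul hδ (hS Sm2 (by simp)).2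
  have hpm := (hS Sp1 (by simp)).1.mul hδ (hS Sm2 (by simp)).2
  have hmp := (hS Sm1 (by simp)).1.mul hδ (hS Sp2 (by simp)).2
  obtain ⟨sl, hsl, hl'⟩ := exists_sign hl
  obtain ⟨sm, hsm, hm'⟩ := exists_sign hm
  obtain ⟨Npp, hNpp, hSp, -⟩ := exists_tendsto_heaviside_integrals (hpp.integrable hδ)
    (hpp.differentiable hδ) hsl hsm hl' hm'
  obtain ⟨Nmm, hNmm, -, hSm⟩ := exists_tendsto_heaviside_integrals (hmm.integrable hδ)
    (hmm.differentiable hδ) hsl hsm hl' hm'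
  obtain ⟨M₁, hM₁⟩ := hpm.exists_norm_oscillatory_limit_sub_le hδ (Or.inr rfl : (-1 : ℝ) = 1 ∨ _)
    hsl hsm hl' hm'
  obtain ⟨M₂, hM₂⟩ := hmp.exists_norm_oscillatory_limit_sub_le hδ (Or.inl rfl : (1 : ℝ) = 1 ∨ _)
    hsl hsm hl' hm'
  choose! Npm hNpm using hM₁
  choose! Nmp hNmp using hM₂
  refine ⟨_, _, hSp, hSm, 1, fun t => ((lam : ℂ) - mu)⁻¹ *
    (exp ((tauFun lam0 t lam - tauFun lam0 t mu) / 2) * Npp +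
      exp ((tauFun lam0 t mu - tauFun lam0 t lam) / 2) * Nmm +
      exp ((tauFun lam0 t lam + tauFun lam0 t mu) / 2 + I * t * (lam0 : ℂ) ^ 2) * Npm t +
      exp (-((tauFun lam0 t lam + tauFun lam0 t mu) / 2 + I * t * (lam0 : ℂ) ^ 2)) * Nmp t),
    fun t ht => ?_, fun γ hγ => ?_⟩
  · have ht0 : 0 < t := by linarith
    have hinv : Tendsto (fun ε : ℝ => ((lam : ℂ) - mu - 2 * I * ε)⁻¹) (𝓝[>] 0)
        (𝓝 ((lam : ℂ) - mu)⁻¹) := by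
      have hne : (lam : ℂ) - mu ≠ 0 := sub_ne_zero.2 (by exact_mod_cast hlm)
      have h : Continuous fun ε : ℝ => (lam : ℂ) - mu - 2 * I * ε := by fun_prop
      have h' := h.tendsto 0
      simp only [ofReal_zero, mul_zero, sub_zero] at h'
      exact (h'.mono_left nhdsWithin_le_nhds).inv₀ hne
    refine (hinv.mul ((((hNpp.const_mul _).add (hNmm.const_mul _)).add
      ((hNpm t ht0).1.const_mul _)).add ((hNmp t ht0).1.const_mul _))).congr' ?_
    filter_upwards [self_mem_nhdsWithin] with ε hε
    have hε : 0 < ε := hε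
    have hint : ∀ G : ℝ → ℂ, Integrable G → Integrable fun x : ℝ =>
        G x * (((x : ℂ) - mu - I * ε)⁻¹ - ((x : ℂ) - lam + I * ε)⁻¹) := fun G hG => by
      simp only [mul_sub]
      exact (integrable_mul_inv_sub hG mu hε).sub (integrable_mul_inv_add hG lam hε)
    have i1 := hint _ (hpp.integrable hδ)
    have i2 := hint _ (hmm.integrable hδ)
    have i3 := hint _ (hpm.integrable_quadraticPhase_mul hδ lam0 (-1) t)
    have i4 := hint _ (hmp.integrable_quadraticPhase_mul hδ lam0 1 t)
    simp only [Vreg_mul_Vreg lam mu lam0 t hε]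
    rw [integral_const_mul, integral_linear_combination i1 i2 i3 i4]
  · refine IsBigO.of_bound (‖((lam : ℂ) - mu)⁻¹‖ * (|M₁| + |M₂|)) ?_
    filter_upwards [eventually_ge_atTop 1] with t ht
    have ht0 : 0 < t := by linarith
    obtain ⟨-, b₁⟩ := hNpm t ht0
    obtain ⟨-, b₂⟩ := hNmp t ht0
    have hrpow : 1 / √t ≤ ‖t ^ (-(1 / 2) + γ)‖ := by
      rw [Real.norm_of_nonneg (by positivity), Real.sqrt_eq_rpow, one_div,
        ← Real.rpow_neg ht0.le]
      exact Real.rpow_le_rpow_of_exponent_le ht (by linarith)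
    have hcle : ∀ M : ℝ, M / √t ≤ |M| * ‖t ^ (-(1 / 2) + γ)‖ := fun M => by
      rw [div_eq_mul_one_div]
      exact mul_le_mul (le_abs_self M) hrpow (by positivity) (abs_nonneg M)
    set a := tauFun lam0 t lam with ha
    set b := tauFun lam0 t mu with hb
    set d := I * (t : ℂ) * (lam0 : ℂ) ^ 2 with hd
    set E := exp ((a + b) / 2 + d) with hE
    set E' := exp (-((a + b) / 2 + d)) with hE'
    have hphase : (a + b) / 2 + d =
        ((t * ((lam - lam0) ^ 2 + (mu - lam0) ^ 2) / 2 : ℝ) : ℂ) * I := by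
      simp only [ha, hb, hd, tauFun]
      push_cast
      ring
    have nE : ‖E‖ = 1 := by rw [hE, hphase, norm_exp_ofReal_mul_I]
    have nE' : ‖E'‖ = 1 := by rw [hE', hphase, ← neg_mul, ← ofReal_neg, norm_exp_ofReal_mul_I]
    have e1 : E * quadraticPhase lam0 (-1) t mu = exp ((a - b) / 2) := by
      rw [quadraticPhase_eq_exp_tauFun, ← exp_add]; congr 1; push_cast; ring
    have e2 : E * quadraticPhase lam0 (-1) t lam = exp ((b - a) / 2) := by
      rw [quadraticPhase_eq_exp_tauFun, ← exp_add]; congr 1; push_cast; ring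
    have e3 : E' * quadraticPhase lam0 1 t mu = exp ((b - a) / 2) := by
      rw [quadraticPhase_eq_exp_tauFun, ← exp_add]; congr 1; push_cast; ring
    have e4 : E' * quadraticPhase lam0 1 t lam = exp ((a - b) / 2) := by
      rw [quadraticPhase_eq_exp_tauFun, ← exp_add]; congr 1; push_cast; ring
    set X := I * Real.pi * ((1 + ((-1 : ℝ) : ℂ) * sm) *
      (quadraticPhase lam0 (-1) t mu * (Sp1 lam mu * Sm2 mu mu)) +
      (1 - ((-1 : ℝ) : ℂ) * sl) * (quadraticPhase lam0 (-1) t lam * (Sp1 lam lam * Sm2 lam mu)))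
      with hX
    set Y := I * Real.pi * ((1 + ((1 : ℝ) : ℂ) * sm) *
      (quadraticPhase lam0 1 t mu * (Sm1 lam mu * Sp2 mu mu)) +
      (1 - ((1 : ℝ) : ℂ) * sl) * (quadraticPhase lam0 1 t lam * (Sm1 lam lam * Sp2 lam mu)))
      with hY
    have hEX : E * X = I * Real.pi * (-(1 - sm) * (exp ((a - b) / 2) * (Sp1 lam mu * Sp2 mu mu)) -
        (1 + sl) * (exp ((b - a) / 2) * (Sm1 lam lam * Sm2 lam mu))) := by
      rw [hX, ← e1, ← e2, hdiag2 mu, hdiag1 lam]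
      push_cast
      ring
    have hEY : E' * Y = I * Real.pi * (-(1 + sm) * (exp ((b - a) / 2) * (Sm1 lam mu * Sm2 mu mu)) -
        (1 - sl) * (exp ((a - b) / 2) * (Sp1 lam lam * Sp2 lam mu))) := by
      rw [hY, ← e3, ← e4, hdiag2 mu, hdiag1 lam]
      push_cast
      ring
    have hmain : ∀ p q : ℂ, p = Npp - I * Real.pi * ((1 - sm) * (Sp1 lam mu * Sp2 mu mu) +
          (1 - sl) * (Sp1 lam lam * Sp2 lam mu)) →
        q = Nmm - I * Real.pi * ((1 + sm) * (Sm1 lam mu * Sm2 mu mu) +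
          (1 + sl) * (Sm1 lam lam * Sm2 lam mu)) →
        ((lam : ℂ) - mu)⁻¹ * (exp ((a - b) / 2) * Npp + exp ((b - a) / 2) * Nmm + E * Npm t +
          E' * Nmp t) - (exp ((a - b) / 2) * p + exp ((b - a) / 2) * q) / ((lam : ℂ) - mu) =
        ((lam : ℂ) - mu)⁻¹ * (E * (Npm t - X) + E' * (Nmp t - Y)) := by
      rintro p q rfl rfl
      rw [mul_sub E, mul_sub E', hEX, hEY]
      ring
    rw [hmain _ _ rfl rfl, norm_mul, mul_assoc]
    gcongr
    calc ‖E * (Npm t - X) + E' * (Nmp t - Y)‖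
        ≤ ‖Npm t - X‖ + ‖Nmp t - Y‖ := by
          refine (norm_add_le _ _).trans (le_of_eq ?_)
          rw [norm_mul, norm_mul, nE, nE', one_mul, one_mul]
      _ ≤ M₁ / √t + M₂ / √t := add_le_add b₁ b₂
      _ ≤ (|M₁| + |M₂|) * ‖t ^ (-(1 / 2) + γ)‖ := by
          rw [add_mul]
          exact add_le_add (hcle M₁) (hcle M₂)
end

section
/- Let λ₀∈ℝ and let g:ℝ→ℂ be continuous, bounded and Lebesgue integrable. Then for every real λ with λ≠λ₀: (i) lim_{ε→0⁺} ∫_ℝ g(ν)·[θ(ν−λ₀)·((ν−λ−iε)⁻¹−(ν−λ+iε)⁻¹) + θ(λ₀−ν)·((ν−λ+iε)⁻¹−(ν−λ−iε)⁻¹)] dν = 2πi·sign(λ−λ₀)·g(λ); and (ii) the same expression with the two regularizations (ν−λ−iε)⁻¹ and (ν−λ+iε)⁻¹ everywhere interchanged has limit −2πi·sign(λ−λ₀)·g(λ). -/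
open MeasureTheory Filter Complex Topology

/-- The Poisson kernel of the upper half-plane is an approximate identity. -/
lemma tendsto_integral_poisson_kernel {h : ℝ → ℂ} {a : ℝ} (hh : Integrable h)
    (ha : ContinuousAt h a) :
    Tendsto (fun ε : ℝ => ∫ x : ℝ, (Real.pi⁻¹ * (ε / ((x - a) ^ 2 + ε ^ 2))) • h x)
      (𝓝[>] 0) (𝓝 (h a)) := by
  have hdecay : Tendsto (fun x : ℝ => ‖x‖ ^ Module.finrank ℝ ℝ * (Real.pi⁻¹ * (1 + x ^ 2)⁻¹))
      (Bornology.cobounded ℝ) (𝓝 0) := by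
    have hinv : Tendsto (fun x : ℝ => ‖x‖⁻¹) (Bornology.cobounded ℝ) (𝓝 0) :=
      tendsto_inv_atTop_zero.comp tendsto_norm_cobounded_atTop
    have hbound : Tendsto (fun x : ℝ => Real.pi⁻¹ * ‖x‖⁻¹) (Bornology.cobounded ℝ) (𝓝 0) := by
      simpa using hinv.const_mul Real.pi⁻¹
    refine squeeze_zero (fun x => by positivity) (fun x => ?_) hbound
    rw [Module.finrank_self, pow_one, mul_left_comm]
    gcongr
    rcases eq_or_ne x 0 with rfl | hx
    · simp
    · have hx' : 0 < ‖x‖ := norm_pos_iff.2 hx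
      rw [← div_eq_mul_inv, div_le_iff₀ (by positivity), inv_mul_eq_div, le_div_iff₀ hx',
        Real.norm_eq_abs, abs_mul_abs_self]
      nlinarith
  have hpeak := tendsto_integral_comp_smul_smul_of_integrable' (μ := (volume : Measure ℝ))
    (φ := fun x : ℝ => Real.pi⁻¹ * (1 + x ^ 2)⁻¹) (fun x => by positivity)
    (by rw [integral_const_mul, integral_univ_inv_one_add_sq, inv_mul_cancel₀ Real.pi_ne_zero])
    hdecay hh ha
  refine (hpeak.comp tendsto_inv_nhdsGT_zero).congr' ?_
  filter_upwards [self_mem_nhdsWithin] with ε hε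
  have hε : 0 < ε := hε
  refine integral_congr_ae (Eventually.of_forall fun x => ?_)
  have hden : (x - a) ^ 2 + ε ^ 2 ≠ 0 := by positivity
  have hden' : ε ^ 2 + (a - x) ^ 2 ≠ 0 := by positivity
  simp only [Module.finrank_self, pow_one, smul_eq_mul]
  congr 1
  field_simp
  ring

/-- The jump of the Cauchy kernel across the real axis is a multiple of the Poisson kernel. -/
lemma cauchy_kernel_jump {x ε : ℝ} (a : ℝ) (hε : 0 < ε) :
    ((x : ℂ) - (a : ℂ) - I * (ε : ℂ))⁻¹ - ((x : ℂ) - (a : ℂ) + I * (ε : ℂ))⁻¹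
      = 2 * (Real.pi : ℂ) * I * ((Real.pi⁻¹ * (ε / ((x - a) ^ 2 + ε ^ 2)) : ℝ) : ℂ) := by
  have hsub : (x : ℂ) - (a : ℂ) - I * (ε : ℂ) ≠ 0 := fun h => by
    simpa [hε.ne'] using congrArg Complex.im h
  have hadd : (x : ℂ) - (a : ℂ) + I * (ε : ℂ) ≠ 0 := fun h => by
    simpa [hε.ne'] using congrArg Complex.im h
  have hpi : (Real.pi : ℂ) ≠ 0 := ofReal_ne_zero.2 Real.pi_ne_zero
  have hmul : ((x : ℂ) - a) ^ 2 + (ε : ℂ) ^ 2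
      = ((x : ℂ) - a - I * ε) * ((x : ℂ) - a + I * ε) := by
    linear_combination (ε : ℂ) ^ 2 * I_sq
  push_cast
  rw [hmul]
  field_simp
  ring

lemma heaviside_sub_heaviside_neg (x : ℝ) : heaviside x - heaviside (-x) = Real.sign x := by
  rcases lt_trichotomy x 0 with h | rfl | h
  · simp [heaviside, Real.sign_of_neg h, h, h.le]
  · simp [heaviside]
  · simp [heaviside, Real.sign_of_pos h, h, h.le]

lemma continuousAt_real_sign {x : ℝ} (hx : x ≠ 0) : ContinuousAt Real.sign x := by
  rcases lt_or_gt_of_ne hx with h | h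
  · refine (continuousAt_const (y := (-1 : ℝ))).congr ?_
    filter_upwards [Iio_mem_nhds h] with y hy using (Real.sign_of_neg hy).symm
  · refine (continuousAt_const (y := (1 : ℝ))).congr ?_
    filter_upwards [Ioi_mem_nhds h] with y hy using (Real.sign_of_pos hy).symm

lemma measurable_real_sign : Measurable Real.sign :=
  Measurable.ite measurableSet_Iio measurable_const
    (Measurable.ite measurableSet_Ioi measurable_const measurable_const)

lemma abs_real_sign_le_one (x : ℝ) : |Real.sign x| ≤ 1 := by
  rcases Real.sign_apply_eq x with h | h | h <;> simp [h]

/-- Diagonal evaluation (equation (cond)) in the proof of Lemma 1: for `g : ℝ → ℂ`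
continuous, bounded and integrable and real `λ ≠ λ₀`,
(i) `lim_{ε→0⁺} ∫ g(ν)·[θ(ν−λ₀)((ν−λ−iε)⁻¹−(ν−λ+iε)⁻¹)+θ(λ₀−ν)((ν−λ+iε)⁻¹−(ν−λ−iε)⁻¹)]dν
   = 2πi·sign(λ−λ₀)·g(λ)`, and
(ii) the expression with the two regularizations interchanged tends to
   `−2πi·sign(λ−λ₀)·g(λ)`. -/
theorem diagonal_singular_limit (lam0 : ℝ) (g : ℝ → ℂ) (hg_cont : Continuous g)
    (hg_bdd : ∃ M : ℝ, ∀ x : ℝ, ‖g x‖ ≤ M) (hg_int : Integrable g)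
    (lam : ℝ) (hlam : lam ≠ lam0) :
    Tendsto (fun ε : ℝ => ∫ ν : ℝ, g ν *
        ((heaviside (ν - lam0) : ℂ) * (((ν : ℂ) - (lam : ℂ) - I * (ε : ℂ))⁻¹
            - ((ν : ℂ) - (lam : ℂ) + I * (ε : ℂ))⁻¹)
          + (heaviside (lam0 - ν) : ℂ) * (((ν : ℂ) - (lam : ℂ) + I * (ε : ℂ))⁻¹
            - ((ν : ℂ) - (lam : ℂ) - I * (ε : ℂ))⁻¹)))
      (𝓝[>] 0) (𝓝 (2 * (Real.pi : ℂ) * I * (Real.sign (lam - lam0) : ℂ) * g lam))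
    ∧
    Tendsto (fun ε : ℝ => ∫ ν : ℝ, g ν *
        ((heaviside (ν - lam0) : ℂ) * (((ν : ℂ) - (lam : ℂ) + I * (ε : ℂ))⁻¹
            - ((ν : ℂ) - (lam : ℂ) - I * (ε : ℂ))⁻¹)
          + (heaviside (lam0 - ν) : ℂ) * (((ν : ℂ) - (lam : ℂ) - I * (ε : ℂ))⁻¹
            - ((ν : ℂ) - (lam : ℂ) + I * (ε : ℂ))⁻¹)))
      (𝓝[>] 0) (𝓝 (-(2 * (Real.pi : ℂ) * I) * (Real.sign (lam - lam0) : ℂ) * g lam)) := by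
  have hint : Integrable fun ν : ℝ => (Real.sign (ν - lam0) : ℂ) * g ν := by
    refine hg_int.bdd_mul (c := 1) ?_ (Eventually.of_forall fun ν => ?_)
    · exact (measurable_ofReal.comp
        (measurable_real_sign.comp (measurable_id.sub_const lam0))).aestronglyMeasurable
    · simpa using abs_real_sign_le_one (ν - lam0)
  have hcont : ContinuousAt (fun ν : ℝ => (Real.sign (ν - lam0) : ℂ) * g ν) lam := by
    refine ContinuousAt.mul ?_ hg_cont.continuousAt
    refine continuous_ofReal.continuousAt.comp ?_
    exact ContinuousAt.comp (f := fun ν : ℝ => ν - lam0)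
      (continuousAt_real_sign (sub_ne_zero.2 hlam)) (by fun_prop)
  have hlim := (tendsto_integral_poisson_kernel hint hcont).const_mul (2 * (Real.pi : ℂ) * I)
  have hmain : Tendsto (fun ε : ℝ => ∫ ν : ℝ, g ν *
        ((heaviside (ν - lam0) : ℂ) * (((ν : ℂ) - (lam : ℂ) - I * (ε : ℂ))⁻¹
            - ((ν : ℂ) - (lam : ℂ) + I * (ε : ℂ))⁻¹)
          + (heaviside (lam0 - ν) : ℂ) * (((ν : ℂ) - (lam : ℂ) + I * (ε : ℂ))⁻¹
            - ((ν : ℂ) - (lam : ℂ) - I * (ε : ℂ))⁻¹)))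
      (𝓝[>] 0) (𝓝 (2 * (Real.pi : ℂ) * I * (Real.sign (lam - lam0) : ℂ) * g lam)) := by
    rw [mul_assoc (2 * (Real.pi : ℂ) * I)]
    refine hlim.congr' ?_
    filter_upwards [self_mem_nhdsWithin] with ε hε
    rw [← integral_const_mul]
    refine integral_congr_ae (Eventually.of_forall fun ν => ?_)
    have hjump := cauchy_kernel_jump (x := ν) lam hε
    have hsign : (heaviside (ν - lam0) : ℂ) - (heaviside (lam0 - ν) : ℂ)
        = (Real.sign (ν - lam0) : ℂ) := by
      rw [← heaviside_sub_heaviside_neg, neg_sub, ofReal_sub]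
    simp only [real_smul]
    rw [← hsign]
    linear_combination (-(g ν * ((heaviside (ν - lam0) : ℂ) - (heaviside (lam0 - ν) : ℂ)))) * hjump
  refine ⟨hmain, ?_⟩
  convert hmain.neg using 1
  · funext ε
    rw [← integral_neg]
    congr 1 with ν
    ring
  · congr 1
    ring
end

section
/- For t>0 and λ₀,λ∈ℝ define I₁(λ,λ₀,t) = iπ·e^{it(λ−λ₀)²−itλ₀²}·[1 + (2/√π)·e^{−iπ/4}·∫₀^{√t·(λ−λ₀)} e^{is²} ds]. Let f:ℝ→ℂ be smooth with compact support. Then, as t→+∞, ∫_ℝ I₁(λ,λ₀,t)·f(λ) dλ − 2πi·∫_{λ₀}^{∞} e^{it(λ−λ₀)²−itλ₀²}·f(λ) dλ = O(t^{−1/2}). -/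
open MeasureTheory Filter Complex Topology intervalIntegral Asymptotics

/-- The closed-form value (equation (Avalint)) of the regularized Gaussian singular
integral: `I₁(λ,λ₀,t) = iπ·e^{it(λ−λ₀)²−itλ₀²}·[1 + (2/√π)e^{−iπ/4}∫₀^{√t(λ−λ₀)} e^{is²} ds]`. -/
noncomputable def Ione (lam lam0 t : ℝ) : ℂ :=
  I * (Real.pi : ℂ) *
    Complex.exp (I * (t : ℂ) * ((lam : ℂ) - (lam0 : ℂ))^2 - I * (t : ℂ) * (lam0 : ℂ)^2) *
    (1 + (2 / (Real.sqrt Real.pi : ℂ)) * Complex.exp (-(I * (Real.pi : ℂ) / 4)) *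
      ∫ s in (0 : ℝ)..(Real.sqrt t * (lam - lam0)), Complex.exp (I * (s : ℂ)^2))

/-- Away from the origin, integrating by parts bounds Gaussian integrals uniformly up to the
oscillatory boundary `b.re = 0`. -/
lemma norm_integral_cexp_neg_mul_sq_le {b : ℂ} (hb : 0 ≤ b.re) (hb0 : b ≠ 0) {x y : ℝ}
    (hx : 0 < x) (hxy : x ≤ y) :
    ‖∫ s in x..y, Complex.exp (-b * (s : ℂ) ^ 2)‖ ≤ 1 / (‖b‖ * x) := by
  have hy : 0 < y := hx.trans_le hxy
  have hbn : 0 < ‖b‖ := norm_pos_iff.mpr hb0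
  have hexp (s : ℝ) : ‖Complex.exp (-b * (s : ℂ) ^ 2)‖ ≤ 1 := by
    rw [Complex.norm_exp, ← Complex.ofReal_pow, Complex.re_mul_ofReal, Real.exp_le_one_iff,
      Complex.neg_re]
    nlinarith [mul_nonneg hb (sq_nonneg s)]
  have hpos : ∀ s ∈ Set.uIcc x y, 0 < s := fun s hs => by
    rw [Set.uIcc_of_le hxy] at hs
    exact hx.trans_le hs.1
  have hne : ∀ s ∈ Set.uIcc x y, (s : ℂ) ≠ 0 := fun s hs =>
    Complex.ofReal_ne_zero.mpr (hpos s hs).ne'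
  have hderiv : ∀ s ∈ Set.uIcc x y,
      HasDerivAt (fun s : ℝ => -Complex.exp (-b * (s : ℂ) ^ 2) / (2 * b * s))
        (Complex.exp (-b * (s : ℂ) ^ 2) +
          Complex.exp (-b * (s : ℂ) ^ 2) / (2 * b * (s : ℂ) ^ 2)) s := fun s hs => by
    have hs0 := hne s hs
    have h1 : HasDerivAt (fun z : ℂ => -Complex.exp (-b * z ^ 2) / (2 * b * z)) _ (s : ℂ) :=
      ((((hasDerivAt_id (s : ℂ)).pow 2).const_mul (-b)).cexp.neg).div
        ((hasDerivAt_id (s : ℂ)).const_mul (2 * b)) (by simp [hb0, hs0])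
    refine h1.comp_ofReal.congr_deriv ?_
    simp
    field_simp
  have hc1 : IntervalIntegrable (fun s : ℝ => Complex.exp (-b * (s : ℂ) ^ 2)) volume x y :=
    (by fun_prop : Continuous fun s : ℝ => Complex.exp (-b * (s : ℂ) ^ 2)).intervalIntegrable _ _
  have hc2 : IntervalIntegrable
      (fun s : ℝ => Complex.exp (-b * (s : ℂ) ^ 2) / (2 * b * (s : ℂ) ^ 2)) volume x y := by
    refine ContinuousOn.intervalIntegrable (ContinuousOn.div (by fun_prop) (by fun_prop) ?_)
    intro s hs
    simp [hb0, hne s hs]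
  have hparts := integral_eq_sub_of_hasDerivAt hderiv (hc1.add hc2)
  rw [integral_add hc1 hc2] at hparts
  have hrem : ‖∫ s in x..y, Complex.exp (-b * (s : ℂ) ^ 2) / (2 * b * (s : ℂ) ^ 2)‖
      ≤ 1 / (2 * ‖b‖) * (1 / x - 1 / y) := by
    have hd : ∀ s ∈ Set.uIcc x y,
        HasDerivAt (fun s : ℝ => -(1 / (2 * ‖b‖)) * s⁻¹) (1 / (2 * ‖b‖) * (s ^ 2)⁻¹) s :=
      fun s hs => ((hasDerivAt_inv (hpos s hs).ne').const_mul _).congr_deriv (by ring)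
    have hintg : IntervalIntegrable (fun s : ℝ => 1 / (2 * ‖b‖) * (s ^ 2)⁻¹) volume x y := by
      refine ContinuousOn.intervalIntegrable (continuousOn_const.mul
        (ContinuousOn.inv₀ (by fun_prop) fun s hs => ?_))
      exact pow_ne_zero 2 (hpos s hs).ne'
    calc _ ≤ ∫ s in x..y, 1 / (2 * ‖b‖) * (s ^ 2)⁻¹ := by
          refine norm_integral_le_of_norm_le hxy (Eventually.of_forall fun s hs => ?_) hintg
          have hs0 : 0 < s := hx.trans hs.1
          rw [norm_div, norm_mul, norm_mul, norm_pow, Complex.norm_real, Complex.norm_ofNat,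
            Real.norm_of_nonneg hs0.le, ← one_div, one_div_mul_one_div]
          gcongr
          exact hexp s
      _ = _ := by
          rw [integral_eq_sub_of_hasDerivAt hd hintg]
          ring
  have hbd (s : ℝ) (hs : 0 < s) :
      ‖-Complex.exp (-b * (s : ℂ) ^ 2) / (2 * b * s)‖ ≤ 1 / (2 * ‖b‖) * (1 / s) := by
    rw [norm_div, norm_neg, norm_mul, norm_mul, Complex.norm_real, Complex.norm_ofNat,
      Real.norm_of_nonneg hs.le, one_div_mul_one_div]
    gcongr
    exact hexp s
  rw [eq_sub_of_add_eq hparts]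
  calc _ ≤ _ := (norm_sub_le _ _).trans (add_le_add_left (norm_sub_le _ _) _)
    _ ≤ (1 / (2 * ‖b‖) * (1 / y) + 1 / (2 * ‖b‖) * (1 / x))
        + 1 / (2 * ‖b‖) * (1 / x - 1 / y) :=
      add_le_add (add_le_add (hbd y hy) (hbd x hx)) hrem
    _ = 1 / (‖b‖ * x) := by field_simp; ring

/-- Rate of convergence of truncated Gaussian integrals. -/
lemma norm_integral_cexp_neg_mul_sq_sub_le {b : ℂ} (hb : 0 < b.re) {x : ℝ} (hx : 0 < x) :
    ‖(∫ s in (0 : ℝ)..x, Complex.exp (-b * (s : ℂ) ^ 2)) - (Real.pi / b) ^ (1 / 2 : ℂ) / 2‖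
      ≤ 1 / (‖b‖ * x) := by
  have hb0 : b ≠ 0 := fun h => by simp [h] at hb
  have hlim := intervalIntegral_tendsto_integral_Ioi 0
    (integrable_cexp_neg_mul_sq hb).integrableOn tendsto_id
  rw [integral_gaussian_complex_Ioi hb] at hlim
  refine le_of_tendsto (tendsto_const_nhds.sub hlim).norm ?_
  filter_upwards [eventually_ge_atTop x] with y hy
  have hintg (u v : ℝ) :
      IntervalIntegrable (fun s : ℝ => Complex.exp (-b * (s : ℂ) ^ 2)) volume u v :=
    (by fun_prop : Continuous fun s : ℝ => Complex.exp (-b * (s : ℂ) ^ 2)).intervalIntegrable _ _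
  rw [norm_sub_rev, id, integral_interval_sub_left (hintg _ _) (hintg _ _)]
  exact norm_integral_cexp_neg_mul_sq_le hb.le hb0 hx hy

/-- Rate of convergence of the Fresnel integral. -/
lemma norm_fresnel_sub_le {x : ℝ} (hx : 0 < x) :
    ‖(∫ s in (0 : ℝ)..x, Complex.exp (I * (s : ℂ) ^ 2)) - (Real.pi * I) ^ (1 / 2 : ℂ) / 2‖
      ≤ 1 / x := by
  let β : ℝ → ℂ := fun ε => ε - I
  have hβ : Continuous β := by fun_prop
  have hβ0 : β 0 = -I := by simp [β]
  have hJ : Continuous fun ε : ℝ => ∫ s in (0 : ℝ)..x, Complex.exp (-β ε * (s : ℂ) ^ 2) :=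
    continuous_parametric_intervalIntegral_of_continuous' (by fun_prop) 0 x
  have hval : (Real.pi : ℂ) / -I = Real.pi * I := by
    rw [div_neg, Complex.div_I, neg_neg]
  have hpow : ContinuousAt (fun ε : ℝ => (Real.pi / β ε) ^ (1 / 2 : ℂ) / 2) 0 := by
    refine (ContinuousAt.cpow (continuousAt_const.div hβ.continuousAt ?_) continuousAt_const
      ?_).div_const 2
    · simp [hβ0]
    · simp [hβ0, hval, Complex.mem_slitPlane_iff, Real.pi_ne_zero]
  have hlim := ((hJ.continuousAt.sub hpow).norm.tendsto).mono_left
    (nhdsWithin_le_nhds (s := Set.Ioi (0 : ℝ)))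
  simp only [Pi.sub_apply, hβ0, neg_neg, hval] at hlim
  refine le_of_tendsto hlim ?_
  filter_upwards [self_mem_nhdsWithin] with ε hε
  have hre : 0 < (β ε).re := by simpa [β] using hε
  refine (norm_integral_cexp_neg_mul_sq_sub_le hre hx).trans ?_
  have hone : 1 ≤ ‖β ε‖ := by
    simpa [β] using Complex.abs_im_le_norm (β ε)
  gcongr
  exact le_mul_of_one_le_left hx.le hone

/-- The principal square root of `πi`. -/
lemma pi_mul_I_cpow_half :
    ((Real.pi : ℂ) * I) ^ (1 / 2 : ℂ) =
      (Real.sqrt Real.pi : ℂ) * Complex.exp (I * Real.pi / 4) := by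
  have hpi : (Real.pi : ℂ) ≠ 0 := Complex.ofReal_ne_zero.mpr Real.pi_ne_zero
  rw [Complex.cpow_def_of_ne_zero (mul_ne_zero hpi I_ne_zero),
    Complex.log_ofReal_mul Real.pi_pos I_ne_zero, Complex.log_I, Real.sqrt_eq_rpow,
    Real.rpow_def_of_pos Real.pi_pos, Complex.ofReal_exp, ← Complex.exp_add]
  congr 1
  push_cast
  ring

/-- The error function appearing in `Ione` approaches `1` at rate `1 / x`. -/
lemma norm_one_sub_fresnel_le {x : ℝ} (hx : 0 < x) :
    ‖1 - (2 / (Real.sqrt Real.pi : ℂ)) * Complex.exp (-(I * (Real.pi : ℂ) / 4)) *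
      ∫ s in (0 : ℝ)..x, Complex.exp (I * (s : ℂ) ^ 2)‖ ≤ 2 / Real.sqrt Real.pi * (1 / x) := by
  have hpi : (Real.sqrt Real.pi : ℂ) ≠ 0 :=
    Complex.ofReal_ne_zero.mpr (Real.sqrt_pos.mpr Real.pi_pos).ne'
  have hc : ‖(2 / (Real.sqrt Real.pi : ℂ)) * Complex.exp (-(I * (Real.pi : ℂ) / 4))‖ =
      2 / Real.sqrt Real.pi := by
    rw [norm_mul, Complex.norm_exp]
    simp [abs_of_nonneg (Real.sqrt_nonneg _)]
  have hone : (1 : ℂ) = (2 / (Real.sqrt Real.pi : ℂ)) * Complex.exp (-(I * (Real.pi : ℂ) / 4)) *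
      ((Real.pi * I) ^ (1 / 2 : ℂ) / 2) := by
    rw [pi_mul_I_cpow_half, Complex.exp_neg]
    field_simp
  nth_rewrite 1 [hone]
  rw [← mul_sub, norm_mul, hc, norm_sub_rev]
  gcongr
  exact norm_fresnel_sub_le hx

lemma Ione_add (lam0 t y : ℝ) :
    Ione (lam0 + y) lam0 t = I * (Real.pi : ℂ) *
      Complex.exp (I * (t : ℂ) * (y : ℂ) ^ 2 - I * (t : ℂ) * (lam0 : ℂ) ^ 2) *
      (1 + (2 / (Real.sqrt Real.pi : ℂ)) * Complex.exp (-(I * (Real.pi : ℂ) / 4)) *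
        ∫ s in (0 : ℝ)..(Real.sqrt t * y), Complex.exp (I * (s : ℂ) ^ 2)) := by
  simp [Ione]

lemma Ione_sub (lam0 t y : ℝ) :
    Ione (lam0 - y) lam0 t = I * (Real.pi : ℂ) *
      Complex.exp (I * (t : ℂ) * (y : ℂ) ^ 2 - I * (t : ℂ) * (lam0 : ℂ) ^ 2) *
      (1 - (2 / (Real.sqrt Real.pi : ℂ)) * Complex.exp (-(I * (Real.pi : ℂ) / 4)) *
        ∫ s in (0 : ℝ)..(Real.sqrt t * y), Complex.exp (I * (s : ℂ) ^ 2)) := by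
  have hodd : ∫ s in (0 : ℝ)..(Real.sqrt t * -y), Complex.exp (I * (s : ℂ) ^ 2) =
      -∫ s in (0 : ℝ)..(Real.sqrt t * y), Complex.exp (I * (s : ℂ) ^ 2) := by
    have h := integral_comp_neg (a := 0) (b := Real.sqrt t * y)
      fun s : ℝ => Complex.exp (I * (s : ℂ) ^ 2)
    simp only [Complex.ofReal_neg, neg_sq, neg_zero] at h
    rw [h, mul_neg, integral_symm]
  rw [sub_eq_add_neg, Ione_add, hodd]
  simp [sub_eq_add_neg]

lemma continuous_Ione (lam0 t : ℝ) : Continuous fun lam => Ione lam lam0 t := by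
  have hF : Continuous fun x : ℝ => ∫ s in (0 : ℝ)..x, Complex.exp (I * (s : ℂ) ^ 2) :=
    continuous_primitive (fun a b =>
      (by fun_prop : Continuous fun s : ℝ =>
        Complex.exp (I * (s : ℂ) ^ 2)).intervalIntegrable a b) 0
  unfold Ione
  exact (by fun_prop : Continuous _).mul
    (continuous_const.add (continuous_const.mul (hF.comp (by fun_prop))))

/-- Splitting an integral over `ℝ` at `a` and folding it onto the half line. -/
lemma integral_eq_integral_Ioi_add_sub {g : ℝ → ℂ} (hg : Integrable g) (a : ℝ) :
    ∫ x, g x = ∫ y in Set.Ioi (0 : ℝ), (g (a + y) + g (a - y)) := by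
  have ha : Integrable fun y => g (a + y) := hg.comp_add_left a
  have hs : Integrable fun y => g (a - y) := hg.comp_sub_left a
  rw [integral_add ha.integrableOn hs.integrableOn, ← integral_add_left_eq_self g a,
    ← integral_Iic_add_Ioi (b := 0) ha.integrableOn ha.integrableOn, add_comm]
  congr 1
  have h := integral_comp_neg_Iic (0 : ℝ) fun y => g (a - y)
  simpa using h

/-- The weak asymptotic estimate (Aestweak) of the paper: for smooth compactly
supported `f`, as `t → +∞`,
`∫_ℝ I₁(λ,λ₀,t) f(λ) dλ − 2πi ∫_{λ₀}^∞ e^{it(λ−λ₀)²−itλ₀²} f(λ) dλ = O(t^{−1/2})`. -/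
theorem Ione_weak_asymptotics (lam0 : ℝ) (f : ℝ → ℂ)
    (hf : ContDiff ℝ (⊤ : ℕ∞) f) (hsupp : HasCompactSupport f) :
    (fun t : ℝ =>
        (∫ lam : ℝ, Ione lam lam0 t * f lam) -
          2 * (Real.pi : ℂ) * I *
            ∫ lam in Set.Ioi lam0,
              Complex.exp (I * (t : ℂ) * ((lam : ℂ) - (lam0 : ℂ))^2
                - I * (t : ℂ) * (lam0 : ℂ)^2) * f lam)
      =O[atTop] fun t : ℝ => t ^ (-(1/2) : ℝ) := by
  obtain ⟨L, hL⟩ := hf.lipschitzWith_of_hasCompactSupport hsupp (by simp)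
  obtain ⟨M, hM0, hM⟩ : ∃ M : ℝ, 0 < M ∧ ∀ y, M < |y| → f (lam0 + y) = 0 := by
    obtain ⟨M, hM0, hM⟩ := (hsupp.isCompact.isBounded).subset_closedBall_lt 0 lam0
    refine ⟨M, hM0, fun y hy => ?_⟩
    by_contra h
    have := hM (subset_tsupport f h)
    rw [Metric.mem_closedBall, Real.dist_eq, add_sub_cancel_left] at this
    exact hy.not_ge this
  refine IsBigO.of_bound (Real.pi * (2 / Real.sqrt Real.pi) * (2 * L) * M) ?_
  filter_upwards [eventually_gt_atTop 0] with t ht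
  have hsq : 0 < Real.sqrt t := Real.sqrt_pos.mpr ht
  have hI : Integrable fun lam => Ione lam lam0 t * f lam :=
    ((continuous_Ione lam0 t).mul hf.continuous).integrable_of_hasCompactSupport hsupp.mul_left
  have hE : Integrable fun lam : ℝ => Complex.exp (I * (t : ℂ) * ((lam : ℂ) - (lam0 : ℂ)) ^ 2
      - I * (t : ℂ) * (lam0 : ℂ) ^ 2) * f lam :=
    (Continuous.mul (by fun_prop) hf.continuous).integrable_of_hasCompactSupport hsupp.mul_left
  let D : ℝ → ℂ := fun y => Ione (lam0 + y) lam0 t * f (lam0 + y)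
    + Ione (lam0 - y) lam0 t * f (lam0 - y)
    - 2 * (Real.pi : ℂ) * I * (Complex.exp (I * (t : ℂ) * ((lam0 + y : ℝ) - (lam0 : ℂ)) ^ 2
      - I * (t : ℂ) * (lam0 : ℂ) ^ 2) * f (lam0 + y))
  have hfold : (∫ lam : ℝ, Ione lam lam0 t * f lam) - 2 * (Real.pi : ℂ) * I *
      ∫ lam in Set.Ioi lam0, Complex.exp (I * (t : ℂ) * ((lam : ℂ) - (lam0 : ℂ)) ^ 2
        - I * (t : ℂ) * (lam0 : ℂ) ^ 2) * f lam = ∫ y in Set.Ioi (0 : ℝ), D y := by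
    have hshift := (measurePreserving_add_left volume lam0).setIntegral_preimage_emb
      (measurableEmbedding_addLeft lam0) (fun lam : ℝ =>
      Complex.exp (I * (t : ℂ) * ((lam : ℂ) - (lam0 : ℂ)) ^ 2
        - I * (t : ℂ) * (lam0 : ℂ) ^ 2) * f lam) (Set.Ioi lam0)
    rw [Set.preimage_const_add_Ioi, sub_self] at hshift
    rw [integral_eq_integral_Ioi_add_sub hI lam0, ← hshift, ← MeasureTheory.integral_const_mul]
    exact (MeasureTheory.integral_sub
      ((hI.comp_add_left lam0).add (hI.comp_sub_left lam0)).integrableOn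
      ((hE.comp_add_left lam0).const_mul _).integrableOn).symm
  have hD (y : ℝ) : D y = I * (Real.pi : ℂ) *
      Complex.exp (I * (t : ℂ) * (y : ℂ) ^ 2 - I * (t : ℂ) * (lam0 : ℂ) ^ 2) *
      (1 - (2 / (Real.sqrt Real.pi : ℂ)) * Complex.exp (-(I * (Real.pi : ℂ) / 4)) *
        ∫ s in (0 : ℝ)..(Real.sqrt t * y), Complex.exp (I * (s : ℂ) ^ 2)) *
      (f (lam0 - y) - f (lam0 + y)) := by
    simp only [D, Ione_add, Ione_sub, Complex.ofReal_add, add_sub_cancel_left]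
    ring
  have hzero : ∀ y ∈ Set.Ioi (0 : ℝ) \ Set.Ioc 0 M, D y = 0 := fun y hy => by
    have hyM : M < y := by
      by_contra h
      exact hy.2 ⟨hy.1, not_lt.mp h⟩
    have hyabs : M < |y| := hyM.trans_le (le_abs_self y)
    rw [hD, hM y hyabs, sub_eq_add_neg lam0, hM (-y) (by rwa [abs_neg]), sub_self, mul_zero]
  have hbound : ∀ y ∈ Set.Ioc (0 : ℝ) M,
      ‖D y‖ ≤ Real.pi * (2 / Real.sqrt Real.pi) * (2 * L) / Real.sqrt t := fun y hy => by
    have hphase : ‖Complex.exp (I * (t : ℂ) * (y : ℂ) ^ 2 - I * (t : ℂ) * (lam0 : ℂ) ^ 2)‖ = 1 := by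
      rw [Complex.norm_exp]
      simp [← Complex.ofReal_pow]
    have hlip : ‖f (lam0 - y) - f (lam0 + y)‖ ≤ L * (2 * y) := by
      refine (hL.norm_sub_le _ _).trans_eq ?_
      rw [show lam0 - y - (lam0 + y) = -(2 * y) by ring, norm_neg,
        Real.norm_of_nonneg (by linarith [hy.1])]
    have hpos := hy.1
    rw [hD, norm_mul, norm_mul, norm_mul, norm_mul, hphase, Complex.norm_I, Complex.norm_real,
      Real.norm_of_nonneg Real.pi_pos.le]
    calc
      _ ≤ 1 * Real.pi * 1 * (2 / Real.sqrt Real.pi * (1 / (Real.sqrt t * y))) * (L * (2 * y)) := by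
          gcongr
          exact norm_one_sub_fresnel_le (mul_pos hsq hpos)
      _ = _ := by field_simp
  rw [hfold, setIntegral_eq_of_subset_of_forall_sdiff_eq_zero measurableSet_Ioi
    Set.Ioc_subset_Ioi_self hzero]
  refine (norm_setIntegral_le_of_norm_le_const measure_Ioc_lt_top hbound).trans_eq ?_
  rw [Real.volume_real_Ioc_of_le hM0.le, Real.norm_of_nonneg (Real.rpow_nonneg ht.le _),
    Real.rpow_neg ht.le, ← Real.sqrt_eq_rpow]
  ring
end

section
/- Let λ₀∈ℝ, δ>0, C>0, and let φ be holomorphic on the strip {z∈ℂ:|Im z|≤δ} with |φ(z)|≤C/(1+|Re z|²) there. Set τ(u)=it(u−λ₀)²−itλ₀² for t>0. Fix a real λ≠λ₀. Then for each t>0 the iterated limit J₋(t)=lim_{ε→0⁺} lim_{R→∞} ∫_{−R}^{R} e^{τ(u)}·φ(u)/(u−λ−iε) du exists, and as t→+∞, J₋(t) = 2πi·e^{τ(λ)}·φ(λ)·θ(λ−λ₀) + O(t^{−1/2}). Similarly, J₊(t)=lim_{ε→0⁺} lim_{R→∞} ∫_{−R}^{R} e^{τ(u)}·φ(u)/(u−λ+iε)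 du exists, and as t→+∞, J₊(t) = −2πi·e^{τ(λ)}·φ(λ)·θ(λ₀−λ) + O(t^{−1/2}). -/
open MeasureTheory Filter Complex Topology intervalIntegral Asymptotics

/-- Shifting the half-line `[0, ∞)` upwards to height `h`, for a holomorphic function with
quadratic decay. -/
lemma integral_Ioi_eq_shift {F : ℂ → ℂ} {h M : ℝ} (hh : 0 < h)
    (hF : DifferentiableOn ℂ F {z : ℂ | 0 ≤ z.re ∧ 0 ≤ z.im ∧ z.im ≤ h})
    (hM : ∀ z : ℂ, 0 ≤ z.re → 0 ≤ z.im → z.im ≤ h → ‖F z‖ ≤ M / (1 + z.re ^ 2)) :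
    ∫ x in Set.Ioi (0 : ℝ), F x =
      (∫ x in Set.Ioi (0 : ℝ), F (x + h * I)) + I * ∫ y in (0 : ℝ)..h, F (y * I) := by
  have hint : ∀ y : ℝ, 0 ≤ y → y ≤ h →
      IntegrableOn (fun x : ℝ => F (x + y * I)) (Set.Ioi 0) := by
    intro y hy0 hyh
    refine Integrable.mono' (g := fun x : ℝ => M * (1 + x ^ 2)⁻¹)
      (integrable_inv_one_add_sq.const_mul M).integrableOn ?_ ?_
    · refine ContinuousOn.aestronglyMeasurable ?_ measurableSet_Ioi
      refine hF.continuousOn.comp (by fun_prop) ?_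
      intro x hx
      simpa using ⟨le_of_lt hx, hy0, hyh⟩
    · filter_upwards [ae_restrict_mem measurableSet_Ioi] with x hx
      have := hM (x + y * I) (by simpa using le_of_lt hx) (by simpa using hy0) (by simpa using hyh)
      simpa [div_eq_mul_inv] using this
  have h0 : Tendsto (fun R : ℝ => ∫ x in (0 : ℝ)..R, F x) atTop
      (𝓝 (∫ x in Set.Ioi (0 : ℝ), F x)) :=
    intervalIntegral_tendsto_integral_Ioi 0 (by simpa using hint 0 le_rfl hh.le) tendsto_id
  have h1 : Tendsto (fun R : ℝ => ∫ x in (0 : ℝ)..R, F (x + h * I)) atTop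
      (𝓝 (∫ x in Set.Ioi (0 : ℝ), F (x + h * I))) :=
    intervalIntegral_tendsto_integral_Ioi 0 (hint h hh.le le_rfl) tendsto_id
  have h2 : Tendsto (fun R : ℝ => ∫ y in (0 : ℝ)..h, F (R + y * I)) atTop (𝓝 0) := by
    have hlim : Tendsto (fun R : ℝ => M / (1 + R ^ 2) * |h - 0|) atTop (𝓝 0) := by
      have : Tendsto (fun R : ℝ => 1 + R ^ 2) atTop atTop :=
        tendsto_atTop_add_const_left _ _ (tendsto_pow_atTop two_ne_zero)
      simpa using (this.const_div_atTop M).mul_const |h - 0|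
    refine squeeze_zero_norm' ?_ hlim
    filter_upwards [eventually_ge_atTop (0 : ℝ)] with R hR
    refine intervalIntegral.norm_integral_le_of_norm_le_const fun y hy => ?_
    rw [Set.uIoc_of_le hh.le] at hy
    simpa using hM (R + y * I) (by simpa using hR) (by simpa using hy.1.le) (by simpa using hy.2)
  have hrect : ∀ᶠ R : ℝ in atTop, (∫ x in (0 : ℝ)..R, F x) =
      (∫ x in (0 : ℝ)..R, F (x + h * I)) - I * (∫ y in (0 : ℝ)..h, F (R + y * I))
        + I * ∫ y in (0 : ℝ)..h, F (y * I) := by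
    filter_upwards [eventually_ge_atTop (0 : ℝ)] with R hR
    have := Complex.integral_boundary_rect_eq_zero_of_differentiableOn F 0 (R + h * I)
      (hF.mono ?_)
    · simp only [zero_re, zero_im, add_re, ofReal_re, mul_re, I_re, mul_zero, ofReal_im, I_im,
        mul_one, sub_self, add_zero, add_im, mul_im, zero_add, ofReal_zero, zero_mul,
        smul_eq_mul] at this
      linear_combination this
    · intro z hz
      rw [mem_reProdIm] at hz
      simp only [zero_re, zero_im, add_re, ofReal_re, mul_re, I_re, mul_zero, ofReal_im, I_im,
        mul_one, sub_self, add_zero, add_im, mul_im, zero_add, Set.uIcc_of_le hR,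
        Set.uIcc_of_le hh.le] at hz
      exact ⟨hz.1.1, hz.2.1, hz.2.2⟩
  have h3 := ((h1.sub (h2.const_mul I)).add_const (I * ∫ y in (0 : ℝ)..h, F (y * I)))
  have := tendsto_nhds_unique (h0.congr' hrect) h3
  simpa using this

/-- The Gaussian-oscillating Cauchy integrand with pole `p`. -/
noncomputable def gaussCauchy (t : ℝ) (ψ : ℂ → ℂ) (p z : ℂ) : ℂ :=
  Complex.exp (I * t * z ^ 2) * ψ z / (z - p)

/-- Poles that do not obstruct moving `[0, ∞)` into the upper half-plane. -/
def admissiblePoles (c : ℝ) : Set ℂ := {p | p.re ≤ -c ∨ (p.re = c ∧ p.im < 0)}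

lemma norm_exp_I_mul_sq (t : ℝ) (z : ℂ) :
    ‖Complex.exp (I * t * z ^ 2)‖ = Real.exp (-(2 * t * z.re * z.im)) := by
  rw [Complex.norm_exp]
  congr 1
  simp [pow_two]
  ring

lemma min_im_le_norm_sub {c : ℝ} {p z : ℂ} (hp : p.re ≤ -c ∨ (p.re = c ∧ p.im ≤ 0))
    (hz : 0 ≤ z.re) : min c (z.im - p.im) ≤ ‖z - p‖ := by
  rcases hp with hp | ⟨-, hp⟩
  · have := (le_abs_self _).trans (abs_re_le_norm (z - p))
    rw [sub_re] at this
    exact (min_le_left _ _).trans (by linarith)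
  · have := (le_abs_self _).trans (abs_im_le_norm (z - p))
    rw [sub_im] at this
    exact (min_le_right _ _).trans this

lemma exists_pos_le_norm_sub {c : ℝ} (hc : 0 < c) {p : ℂ} (hp : p ∈ admissiblePoles c) :
    ∃ m > 0, ∀ z : ℂ, 0 ≤ z.re → 0 ≤ z.im → m ≤ ‖z - p‖ := by
  rcases hp with hp | hp
  · refine ⟨c, hc, fun z hz _ => ?_⟩
    have := (le_abs_self _).trans (abs_re_le_norm (z - p))
    rw [sub_re] at this
    linarith
  · refine ⟨min c (-p.im), lt_min hc (by linarith [hp.2]), fun z hz hz' => ?_⟩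
    refine le_trans ?_ (min_im_le_norm_sub (Or.inr ⟨hp.1, hp.2.le⟩) hz)
    exact min_le_min_left _ (by linarith)

lemma norm_gaussCauchy_le {t M m : ℝ} {ψ : ℂ → ℂ} {p z : ℂ} (ht : 0 ≤ t) (hm : 0 < m)
    (hψ : ‖ψ z‖ ≤ M / (1 + z.re ^ 2)) (hz : 0 ≤ z.re * z.im) (hp : m ≤ ‖z - p‖) :
    ‖gaussCauchy t ψ p z‖ ≤ M / m / (1 + z.re ^ 2) := by
  have h1 : ‖Complex.exp (I * t * z ^ 2)‖ ≤ 1 := by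
    rw [norm_exp_I_mul_sq, Real.exp_le_one_iff]
    have := mul_nonneg ht hz
    linarith
  rw [gaussCauchy, norm_div, norm_mul, div_right_comm]
  have h0 : 0 ≤ M / (1 + z.re ^ 2) := (norm_nonneg _).trans hψ
  calc _ ≤ 1 * (M / (1 + z.re ^ 2)) / m := by gcongr
    _ = _ := by ring

lemma differentiableOn_gaussCauchy {t δ : ℝ} {ψ : ℂ → ℂ} {s : Set ℂ} {p : ℂ}
    (hψ : DifferentiableOn ℂ ψ {z : ℂ | |z.im| ≤ δ}) (hs : s ⊆ {z : ℂ | |z.im| ≤ δ})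
    (hp : p ∉ s) : DifferentiableOn ℂ (gaussCauchy t ψ p) s := by
  unfold gaussCauchy
  refine DifferentiableOn.div ((Differentiable.differentiableOn (by fun_prop)).mul (hψ.mono hs))
    (Differentiable.differentiableOn (by fun_prop)) fun z hz h => hp ?_
  rwa [← sub_eq_zero.1 h]

section HalfLine

variable {δ M c t : ℝ} {ψ : ℂ → ℂ}

lemma integral_gaussCauchy_eq_shift (hc : 0 < c) (ht : 0 < t)
    (hψ : DifferentiableOn ℂ ψ {z : ℂ | |z.im| ≤ δ})
    (hM : ∀ z : ℂ, |z.im| ≤ δ → ‖ψ z‖ ≤ M / (1 + z.re ^ 2)) {h : ℝ} (hh : 0 < h) (hhδ : h ≤ δ)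
    {p : ℂ} (hp : p ∈ admissiblePoles c) :
    ∫ x in Set.Ioi (0 : ℝ), gaussCauchy t ψ p x =
      (∫ x in Set.Ioi (0 : ℝ), gaussCauchy t ψ p (x + h * I)) +
        I * ∫ y in (0 : ℝ)..h, gaussCauchy t ψ p (y * I) := by
  obtain ⟨m, hm, hmp⟩ := exists_pos_le_norm_sub hc hp
  have habs : ∀ z : ℂ, 0 ≤ z.im → z.im ≤ h → |z.im| ≤ δ := fun z h0 h1 => by
    rw [abs_of_nonneg h0]; linarith
  refine integral_Ioi_eq_shift (M := M / m) hh
    (differentiableOn_gaussCauchy hψ (fun z hz => habs z hz.2.1 hz.2.2) ?_) ?_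
  · intro hz
    have := hmp p hz.1 hz.2.1
    simp at this
    linarith
  · intro z hz hz0 hz1
    exact norm_gaussCauchy_le ht.le hm (hM z (habs z hz0 hz1)) (mul_nonneg hz hz0) (hmp z hz hz0)

lemma exists_tendsto_integral_gaussCauchy (hδ : 0 < δ) (hc : 0 < c) (ht : 0 < t)
    (hψ : DifferentiableOn ℂ ψ {z : ℂ | |z.im| ≤ δ})
    (hM : ∀ z : ℂ, |z.im| ≤ δ → ‖ψ z‖ ≤ M / (1 + z.re ^ 2)) {p₀ : ℂ}
    (hp₀ : p₀.re ≤ -c ∨ (p₀.re = c ∧ p₀.im ≤ 0)) :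
    ∃ L, Tendsto (fun p => ∫ x in Set.Ioi (0 : ℝ), gaussCauchy t ψ p x)
      (𝓝[admissiblePoles c] p₀) (𝓝 L) := by
  have hm : 0 < min c δ := lt_min hc hδ
  have hhor : ∀ p : ℂ, (p.re ≤ -c ∨ (p.re = c ∧ p.im ≤ 0)) → ∀ x : ℝ, 0 < x →
      min c δ ≤ ‖(x + δ * I : ℂ) - p‖ := by
    intro p hp x hx
    rcases hp with hp | hp
    · have := (le_abs_self _).trans (abs_re_le_norm ((x + δ * I : ℂ) - p))
      simp at this
      exact (min_le_left _ _).trans (by linarith)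
    · refine le_trans ?_ (min_im_le_norm_sub (Or.inr hp) (by simpa using hx.le))
      exact min_le_min_left _ (by simpa using hp.2)
  have hver : ∀ p : ℂ, (p.re ≤ -c ∨ (p.re = c ∧ p.im ≤ 0)) → ∀ y : ℝ,
      c ≤ ‖(y * I : ℂ) - p‖ := by
    intro p hp y
    have := abs_re_le_norm ((y * I : ℂ) - p)
    simp at this
    refine le_trans ?_ this
    rcases hp with hp | hp
    · exact le_trans (by linarith) (neg_le_abs _)
    · rw [hp.1]; exact le_abs_self _
  have hadm : ∀ p ∈ admissiblePoles c, p.re ≤ -c ∨ (p.re = c ∧ p.im ≤ 0) := fun p hp =>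
    hp.imp_right fun h => ⟨h.1, h.2.le⟩
  have hcont : ∀ z : ℂ, z ≠ p₀ →
      Tendsto (fun p => gaussCauchy t ψ p z) (𝓝[admissiblePoles c] p₀)
        (𝓝 (gaussCauchy t ψ p₀ z)) := by
    intro z hz
    refine Tendsto.mono_left ?_ nhdsWithin_le_nhds
    exact tendsto_const_nhds.div (tendsto_const_nhds.sub tendsto_id) (sub_ne_zero.2 hz)
  have hH : Tendsto (fun p => ∫ x in Set.Ioi (0 : ℝ), gaussCauchy t ψ p (x + δ * I))
      (𝓝[admissiblePoles c] p₀)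
      (𝓝 (∫ x in Set.Ioi (0 : ℝ), gaussCauchy t ψ p₀ (x + δ * I))) := by
    refine MeasureTheory.tendsto_integral_filter_of_dominated_convergence
      (fun x : ℝ => M / min c δ * (1 + x ^ 2)⁻¹) ?_ ?_ ?_ ?_
    · filter_upwards [self_mem_nhdsWithin] with p hp
      refine ContinuousOn.aestronglyMeasurable ?_ measurableSet_Ioi
      have hd : DifferentiableOn ℂ (gaussCauchy t ψ p) {z : ℂ | 0 ≤ z.re ∧ z.im = δ} := by
        refine differentiableOn_gaussCauchy hψ (fun z hz => ?_) fun hz => ?_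
        · simp [hz.2, abs_of_pos hδ]
        · rcases hp with hp | hp
          · linarith [hz.1]
          · linarith [hz.2, hp.2]
      refine hd.continuousOn.comp (by fun_prop) fun x hx => ?_
      simpa using le_of_lt hx
    · filter_upwards [self_mem_nhdsWithin] with p hp
      filter_upwards [ae_restrict_mem measurableSet_Ioi] with x hx
      have hx' : (0 : ℝ) < x := hx
      have := norm_gaussCauchy_le (z := x + δ * I) ht.le hm
        (hM _ (by simp [abs_of_pos hδ])) (by simp; positivity) (hhor p (hadm p hp) x hx)
      simpa [div_eq_mul_inv] using this
    · exact (integrable_inv_one_add_sq.const_mul _).integrableOn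
    · filter_upwards [ae_restrict_mem measurableSet_Ioi] with x hx
      refine hcont _ fun h => ?_
      have := hhor p₀ hp₀ x hx
      rw [h] at this
      simp at this
      rcases this with h | h <;> linarith
  have hV : Tendsto (fun p => ∫ y in (0 : ℝ)..δ, gaussCauchy t ψ p (y * I))
      (𝓝[admissiblePoles c] p₀) (𝓝 (∫ y in (0 : ℝ)..δ, gaussCauchy t ψ p₀ (y * I))) := by
    refine intervalIntegral.tendsto_integral_filter_of_dominated_convergence
      (fun _ : ℝ => M / c) ?_ ?_ ?_ ?_
    · filter_upwards [self_mem_nhdsWithin] with p hp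
      refine ContinuousOn.aestronglyMeasurable ?_ measurableSet_uIoc
      have hd : DifferentiableOn ℂ (gaussCauchy t ψ p) {z : ℂ | z.re = 0 ∧ |z.im| ≤ δ} := by
        refine differentiableOn_gaussCauchy hψ (fun z hz => hz.2) fun hz => ?_
        rcases hp with hp | hp
        · linarith [hz.1]
        · linarith [hz.1, hp.1]
      refine hd.continuousOn.comp (by fun_prop) fun y hy => ?_
      rw [Set.uIoc_of_le hδ.le] at hy
      simpa [abs_of_pos hy.1] using hy.2
    · filter_upwards [self_mem_nhdsWithin] with p hp
      refine Eventually.of_forall fun y hy => ?_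
      rw [Set.uIoc_of_le hδ.le] at hy
      have := norm_gaussCauchy_le (z := y * I) ht.le hc
        (hM _ (by simpa [abs_of_pos hy.1] using hy.2)) (by simp) (hver p (hadm p hp) y)
      simpa using this
    · exact intervalIntegrable_const
    · refine Eventually.of_forall fun y _ => hcont _ fun h => ?_
      have := hver p₀ hp₀ y
      rw [h] at this
      simp at this
      linarith
  refine ⟨_, (hH.add (hV.const_mul I)).congr' ?_⟩
  filter_upwards [self_mem_nhdsWithin] with p hp
  exact (integral_gaussCauchy_eq_shift hc ht hψ hM hδ le_rfl hp).symm

lemma norm_integral_gaussCauchy_le (hM0 : 0 ≤ M) (hc : 0 < c) (ht : 0 < t)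
    (hψ : DifferentiableOn ℂ ψ {z : ℂ | |z.im| ≤ δ})
    (hM : ∀ z : ℂ, |z.im| ≤ δ → ‖ψ z‖ ≤ M / (1 + z.re ^ 2)) {h : ℝ} (hh : 0 < h) (hhδ : h ≤ δ)
    (hth : t * h ^ 2 = 1) {p : ℂ} (hp : p ∈ admissiblePoles c) :
    ‖∫ x in Set.Ioi (0 : ℝ), gaussCauchy t ψ p x‖ ≤ 3 * M / c * h := by
  have hk : 0 < t * h := mul_pos ht hh
  have hkh : t * h * h = 1 := by rw [← hth]; ring
  rw [integral_gaussCauchy_eq_shift hc ht hψ hM hh hhδ hp]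
  have hV : ‖I * ∫ y in (0 : ℝ)..h, gaussCauchy t ψ p (y * I)‖ ≤ M / c * h := by
    rw [norm_mul, norm_I, one_mul]
    have := intervalIntegral.norm_integral_le_of_norm_le_const (a := 0) (b := h) (C := M / c)
      (f := fun y : ℝ => gaussCauchy t ψ p (y * I)) fun y hy => ?_
    · simpa [abs_of_pos hh] using this
    · rw [Set.uIoc_of_le hh.le] at hy
      have hcp : c ≤ ‖(y * I : ℂ) - p‖ := by
        have := abs_re_le_norm ((y * I : ℂ) - p)
        simp at this
        refine le_trans ?_ this
        rcases hp with hp | hp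
        · exact le_trans (by linarith) (neg_le_abs _)
        · rw [hp.1]; exact le_abs_self _
      have := norm_gaussCauchy_le (z := y * I) ht.le hc
        (hM _ (by simpa [abs_of_pos hy.1] using hy.2.trans hhδ)) (by simp) hcp
      simpa using this
  have hdist : ∀ x : ℝ, 0 < x → Real.exp (-(t * h) * x) * (c / 2) ≤ ‖(x + h * I : ℂ) - p‖ := by
    intro x hx
    have hkx : 0 < t * h * x := mul_pos hk hx
    have he1 : Real.exp (-(t * h) * x) ≤ 1 := Real.exp_le_one_iff.2 (by linarith)
    by_cases hfar : c / 2 ≤ ‖(x + h * I : ℂ) - p‖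
    · exact le_trans (mul_le_of_le_one_left (by positivity) he1) hfar
    · rcases hp with hp | hp
      · have := (le_abs_self _).trans (abs_re_le_norm ((x + h * I : ℂ) - p))
        simp at this
        linarith
      · have h1 := (neg_le_abs _).trans (abs_re_le_norm ((x + h * I : ℂ) - p))
        have h2 := (le_abs_self _).trans (abs_im_le_norm ((x + h * I : ℂ) - p))
        simp at h1 h2
        have hxc : c / 2 ≤ x := by linarith [hp.1]
        have he2 : t * h * x * Real.exp (-(t * h) * x) ≤ 1 := by
          have h3 := Real.add_one_le_exp (t * h * x)
          have h4 : Real.exp (t * h * x) * Real.exp (-(t * h) * x) = 1 := by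
            rw [← Real.exp_add]; simp
          have := Real.exp_pos (-(t * h) * x)
          nlinarith
        calc Real.exp (-(t * h) * x) * (c / 2) ≤ Real.exp (-(t * h) * x) * x := by gcongr
          _ = h * (t * h * x * Real.exp (-(t * h) * x)) := by
            linear_combination (-Real.exp (-(t * h) * x) * x) * hkh
          _ ≤ h * 1 := by gcongr
          _ ≤ _ := by linarith [hp.2]
  have hH : ‖∫ x in Set.Ioi (0 : ℝ), gaussCauchy t ψ p (x + h * I)‖ ≤ 2 * M / c * h := by
    have hint : ∫ x in Set.Ioi (0 : ℝ), 2 * M / c * Real.exp (-(t * h) * x) = 2 * M / c * h := by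
      rw [MeasureTheory.integral_const_mul, integral_exp_mul_Ioi (by linarith)]
      have : h = 1 / (t * h) := by field_simp; linarith
      rw [mul_zero, Real.exp_zero, neg_div_neg_eq, ← this]
    rw [← hint]
    refine MeasureTheory.norm_integral_le_of_norm_le
      ((integrableOn_exp_mul_Ioi (by linarith) 0).const_mul _) ?_
    filter_upwards [ae_restrict_mem measurableSet_Ioi] with x hx
    have hx' : (0 : ℝ) < x := hx
    have hψx : ‖ψ (x + h * I)‖ ≤ M := by
      refine (hM _ (by simpa [abs_of_pos hh] using hhδ)).trans (div_le_self hM0 ?_)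
      have := sq_nonneg ((x + h * I : ℂ).re)
      linarith
    have hE : ‖Complex.exp (I * t * (x + h * I : ℂ) ^ 2)‖ =
        Real.exp (-(t * h) * x) * Real.exp (-(t * h) * x) := by
      rw [norm_exp_I_mul_sq, ← Real.exp_add]
      congr 1
      simp
      ring
    have hd := hdist x hx
    have hdpos : 0 < ‖(x + h * I : ℂ) - p‖ := lt_of_lt_of_le (by positivity) hd
    rw [gaussCauchy, norm_div, norm_mul, div_le_iff₀ hdpos, hE]
    calc _ ≤ Real.exp (-(t * h) * x) * Real.exp (-(t * h) * x) * M := by gcongr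
      _ = 2 * M / c * Real.exp (-(t * h) * x) * (Real.exp (-(t * h) * x) * (c / 2)) := by
        field_simp
      _ ≤ _ := by gcongr
  calc _ ≤ _ := norm_add_le _ _
    _ ≤ 2 * M / c * h + M / c * h := add_le_add hH hV
    _ = _ := by ring

end HalfLine

lemma integrable_div_sub {g : ℝ → ℂ} {M : ℝ} (hg : Continuous g)
    (hM : ∀ x, ‖g x‖ ≤ M / (1 + x ^ 2)) {p : ℂ} (hp : p.im ≠ 0) :
    Integrable fun x : ℝ => g x / (x - p) := by
  have hne : ∀ x : ℝ, (x : ℂ) - p ≠ 0 := fun x h => hp (by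
    rw [← sub_eq_zero.1 h, ofReal_im])
  refine Integrable.mono' (g := fun x : ℝ => M / |p.im| * (1 + x ^ 2)⁻¹)
    (integrable_inv_one_add_sq.const_mul _)
    (hg.div (by fun_prop) hne).aestronglyMeasurable (Eventually.of_forall fun x => ?_)
  have h1 : |p.im| ≤ ‖(x : ℂ) - p‖ := by
    have := abs_im_le_norm ((x : ℂ) - p)
    simpa using this
  have h0 : 0 ≤ M / (1 + x ^ 2) := (norm_nonneg _).trans (hM x)
  have h2 : 0 < |p.im| := abs_pos.2 hp
  rw [norm_div]
  calc _ ≤ M / (1 + x ^ 2) / |p.im| := by gcongr; exact hM x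
    _ = _ := by ring

lemma continuous_comp_ofReal {δ : ℝ} (hδ : 0 < δ) {ψ : ℂ → ℂ}
    (hψ : DifferentiableOn ℂ ψ {z : ℂ | |z.im| ≤ δ}) : Continuous fun x : ℝ => ψ x :=
  hψ.continuousOn.comp_continuous continuous_ofReal fun x => by simpa using hδ.le

/-- The integral over the whole line against a pole approaching `c > 0` from below is
`O(t ^ (-1/2))`. -/
lemma exists_tendsto_isBigO_integral_gaussCauchy {δ M c : ℝ} {ψ : ℂ → ℂ} (hδ : 0 < δ)
    (hM0 : 0 ≤ M) (hc : 0 < c) (hψ : DifferentiableOn ℂ ψ {z : ℂ | |z.im| ≤ δ})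
    (hM : ∀ z : ℂ, |z.im| ≤ δ → ‖ψ z‖ ≤ M / (1 + z.re ^ 2)) :
    ∃ J : ℝ → ℂ,
      (∀ t : ℝ, 0 < t → Tendsto (fun ε : ℝ => ∫ x : ℝ, gaussCauchy t ψ (c - I * ε) x)
        (𝓝[>] 0) (𝓝 (J t))) ∧ J =O[atTop] fun t : ℝ => t ^ (-(1 / 2) : ℝ) := by
  have hψ' : DifferentiableOn ℂ (fun z => ψ (-z)) {z : ℂ | |z.im| ≤ δ} :=
    hψ.comp (Differentiable.differentiableOn (by fun_prop)) fun z hz => by simpa using hz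
  have hM' : ∀ z : ℂ, |z.im| ≤ δ → ‖ψ (-z)‖ ≤ M / (1 + z.re ^ 2) := fun z hz => by
    simpa using hM (-z) (by simpa using hz)
  have hp1 : ∀ ε : ℝ, 0 < ε → (c - I * ε : ℂ) ∈ admissiblePoles c := fun ε hε =>
    Or.inr (by simpa using hε)
  have hp2 : ∀ ε : ℝ, (-(c - I * ε) : ℂ) ∈ admissiblePoles c := fun ε =>
    Or.inl (by simp)
  have hsplit : ∀ t ε : ℝ, 0 < ε → ∫ x : ℝ, gaussCauchy t ψ (c - I * ε) x =
      (∫ x in Set.Ioi (0 : ℝ), gaussCauchy t ψ (c - I * ε) x) -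
        ∫ x in Set.Ioi (0 : ℝ), gaussCauchy t (fun z => ψ (-z)) (-(c - I * ε)) x := by
    intro t ε hε
    have hint : Integrable fun x : ℝ => gaussCauchy t ψ (c - I * ε) x := by
      have hcont := continuous_comp_ofReal hδ hψ
      refine integrable_div_sub (M := M) (g := fun x : ℝ => Complex.exp (I * t * x ^ 2) * ψ x)
        (Continuous.mul (by fun_prop) hcont) (fun x => ?_) (by simpa using hε.ne')
      have := hM x (by simpa using hδ.le)
      rw [norm_mul, norm_exp_I_mul_sq]
      simpa using this
    rw [← intervalIntegral.integral_Iic_add_Ioi (b := 0) hint.integrableOn hint.integrableOn]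
    have := integral_comp_neg_Ioi 0 fun x : ℝ => gaussCauchy t ψ (c - I * ε) x
    rw [neg_zero] at this
    rw [← this, add_comm, sub_eq_add_neg _ (∫ x in Set.Ioi (0 : ℝ), gaussCauchy t _ _ (x : ℂ)),
      ← MeasureTheory.integral_neg]
    congr 2
    ext x
    simp only [gaussCauchy, ofReal_neg, even_two.neg_pow, ← div_neg]
    congr 1
    ring
  have hlim : ∀ t : ℝ, 0 < t → ∃ L, Tendsto
      (fun ε : ℝ => ∫ x : ℝ, gaussCauchy t ψ (c - I * ε) x) (𝓝[>] 0) (𝓝 L) := by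
    intro t ht
    have hc1 : Tendsto (fun ε : ℝ => (c - I * ε : ℂ)) (𝓝[>] 0) (𝓝 c) := by
      refine (Continuous.tendsto' ?_ _ _ (by simp)).mono_left nhdsWithin_le_nhds
      fun_prop
    obtain ⟨L₁, hL₁⟩ := exists_tendsto_integral_gaussCauchy (p₀ := c) hδ hc ht hψ hM
      (Or.inr (by simp))
    obtain ⟨L₂, hL₂⟩ := exists_tendsto_integral_gaussCauchy (p₀ := -c) hδ hc ht hψ' hM'
      (Or.inl (by simp))
    refine ⟨L₁ - L₂, ((hL₁.comp (tendsto_nhdsWithin_iff.2 ⟨hc1, ?_⟩)).sub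
      (hL₂.comp (tendsto_nhdsWithin_iff.2 ⟨hc1.neg, ?_⟩))).congr' ?_⟩
    · filter_upwards [self_mem_nhdsWithin] with ε hε using hp1 ε hε
    · exact Eventually.of_forall hp2
    · filter_upwards [self_mem_nhdsWithin] with ε hε using (hsplit t ε hε).symm
  choose! J hJ using hlim
  refine ⟨J, hJ, Asymptotics.IsBigO.of_bound (6 * M / c) ?_⟩
  filter_upwards [eventually_gt_atTop 0,
    (tendsto_rpow_neg_atTop (y := 1 / 2) (by norm_num)).eventually_le_const hδ] with t ht htδ
  have hh : (0 : ℝ) < t ^ (-(1 / 2) : ℝ) := Real.rpow_pos_of_pos ht _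
  have hth : t * (t ^ (-(1 / 2) : ℝ)) ^ 2 = 1 := by
    rw [← Real.rpow_natCast, ← Real.rpow_mul ht.le]
    norm_num
    rw [Real.rpow_neg_one, mul_inv_cancel₀ ht.ne']
  rw [Real.norm_of_nonneg hh.le]
  refine le_of_tendsto (hJ t ht).norm ?_
  filter_upwards [self_mem_nhdsWithin] with ε hε
  rw [hsplit t ε hε]
  calc _ ≤ _ := norm_sub_le _ _
    _ ≤ 3 * M / c * t ^ (-(1 / 2) : ℝ) + 3 * M / c * t ^ (-(1 / 2) : ℝ) :=
      add_le_add (norm_integral_gaussCauchy_le hM0 hc ht hψ hM hh htδ hth (hp1 ε hε))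
        (norm_integral_gaussCauchy_le hM0 hc ht hψ' hM' hh htδ hth (hp2 ε))
    _ = _ := by ring

/-- The Sokhotski–Plemelj jump formula on the real line. -/
lemma tendsto_integral_div_sub_sub_integral_div_sub {g : ℝ → ℂ} {M : ℝ} (hg : Continuous g)
    (hM : ∀ x, ‖g x‖ ≤ M / (1 + x ^ 2)) (a : ℝ) :
    Tendsto (fun ε : ℝ => (∫ x : ℝ, g x / (x - (a + I * ε))) - ∫ x : ℝ, g x / (x - (a - I * ε)))
      (𝓝[>] 0) (𝓝 (2 * Real.pi * I * g a)) := by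
  have hM0 : 0 ≤ M := by simpa using (norm_nonneg _).trans (hM 0)
  have hpoisson : ∀ ε : ℝ, 0 < ε →
      (∫ x : ℝ, g x / (x - (a + I * ε))) - ∫ x : ℝ, g x / (x - (a - I * ε)) =
        ∫ v : ℝ, 2 * I * g (ε * v + a) * ((1 + v ^ 2)⁻¹ : ℝ) := by
    intro ε hε
    rw [← MeasureTheory.integral_sub
      (integrable_div_sub hg hM (by simpa using hε.ne'))
      (integrable_div_sub hg hM (by simpa using hε.ne'))]
    rw [← MeasureTheory.integral_add_right_eq_self _ a]
    have := Measure.integral_comp_mul_left (fun y : ℝ => g (y + a) / (((y + a : ℝ) : ℂ) -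
      (a + I * ε)) - g (y + a) / (((y + a : ℝ) : ℂ) - (a - I * ε))) ε
    rw [abs_of_pos (inv_pos.2 hε), eq_inv_smul_iff₀ hε.ne'] at this
    rw [← this, ← MeasureTheory.integral_smul]
    congr 1
    ext v
    have hε' : (ε : ℂ) ≠ 0 := ofReal_ne_zero.2 hε.ne'
    have h1 : (v : ℂ) - I ≠ 0 := fun h => by simpa using congrArg Complex.im h
    have h2 : (v : ℂ) + I ≠ 0 := fun h => by simpa using congrArg Complex.im h
    have h3 : (1 + v ^ 2 : ℂ) = (v - I) * (v + I) := by
      linear_combination I_sq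
    have e1 : ((ε * v + a : ℝ) : ℂ) - (a + I * ε) = ε * (v - I) := by push_cast; ring
    have e2 : ((ε * v + a : ℝ) : ℂ) - (a - I * ε) = ε * (v + I) := by push_cast; ring
    rw [e1, e2, real_smul]
    push_cast
    rw [h3]
    field_simp
    ring
  have hval : 2 * Real.pi * I * g a = ∫ v : ℝ, 2 * I * g a * ((1 + v ^ 2)⁻¹ : ℝ) := by
    rw [MeasureTheory.integral_const_mul, integral_complex_ofReal, integral_univ_inv_one_add_sq]
    ring
  rw [hval]
  refine Tendsto.congr' (f₁ := fun ε : ℝ => ∫ v : ℝ, 2 * I * g (ε * v + a) * ((1 + v ^ 2)⁻¹ : ℝ))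
    (by filter_upwards [self_mem_nhdsWithin] with ε hε using (hpoisson ε hε).symm) ?_
  refine MeasureTheory.tendsto_integral_filter_of_dominated_convergence
    (fun v : ℝ => 2 * M * (1 + v ^ 2)⁻¹) ?_ ?_ (integrable_inv_one_add_sq.const_mul _) ?_
  · refine Eventually.of_forall fun ε => ?_
    refine AEStronglyMeasurable.mul (Continuous.aestronglyMeasurable (by fun_prop)) ?_
    exact integrable_inv_one_add_sq.ofReal.aestronglyMeasurable
  · refine Eventually.of_forall fun ε => Eventually.of_forall fun v => ?_
    have hgM : ‖g (ε * v + a)‖ ≤ M :=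
      (hM _).trans (div_le_self hM0 (by linarith [sq_nonneg (ε * v + a)]))
    have hv : 0 ≤ (1 + v ^ 2)⁻¹ := by positivity
    rw [norm_mul, norm_mul, norm_mul, norm_I, norm_real, Real.norm_of_nonneg hv]
    simp only [Complex.norm_ofNat, mul_one]
    gcongr
  · refine Eventually.of_forall fun v => Tendsto.mul_const _ (Tendsto.const_mul _ ?_)
    refine Tendsto.mono_left ?_ nhdsWithin_le_nhds
    exact Continuous.tendsto' (by fun_prop) _ _ (by simp)

/-- The steepest-descent asymptotic formulae (asymptII) of Appendix A: for `φ`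
holomorphic on the strip `|Im z| ≤ δ` with `|φ(z)| ≤ C/(1+|Re z|²)` there,
`τ(u) = it(u−λ₀)² − itλ₀²` and real `λ ≠ λ₀`, the iterated limits
`J∓(t) = lim_{ε→0⁺} lim_{R→∞} ∫_{−R}^{R} e^{τ(u)}φ(u)/(u−λ∓iε) du` exist for `t > 0`, and
as `t → +∞`,
`J₋(t) = 2πi·e^{τ(λ)}·φ(λ)·θ(λ−λ₀) + O(t^{−1/2})` and
`J₊(t) = −2πi·e^{τ(λ)}·φ(λ)·θ(λ₀−λ) + O(t^{−1/2})`. -/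
theorem singular_integral_steepest_descent (lam0 δ C : ℝ) (hδ : 0 < δ) (hC : 0 < C)
    (φ : ℂ → ℂ) (hφ : DifferentiableOn ℂ φ {z : ℂ | |z.im| ≤ δ})
    (hbd : ∀ z ∈ {z : ℂ | |z.im| ≤ δ}, ‖φ z‖ ≤ C / (1 + |z.re|^2))
    (lam : ℝ) (hlam : lam ≠ lam0) :
    ∃ Km Kp : ℝ → ℝ → ℂ, ∃ Jm Jp : ℝ → ℂ,
      (∀ t : ℝ, 0 < t → ∀ ε : ℝ, 0 < ε → Tendsto (fun R : ℝ =>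
          ∫ u in (-R)..R,
            Complex.exp (I * (t : ℂ) * ((u : ℂ) - (lam0 : ℂ))^2 - I * (t : ℂ) * (lam0 : ℂ)^2)
              * φ u / ((u : ℂ) - (lam : ℂ) - I * (ε : ℂ)))
        atTop (𝓝 (Km ε t))) ∧
      (∀ t : ℝ, 0 < t → Tendsto (fun ε : ℝ => Km ε t) (𝓝[>] 0) (𝓝 (Jm t))) ∧
      (fun t : ℝ => Jm t -
          2 * (Real.pi : ℂ) * I *
            Complex.exp (I * (t : ℂ) * ((lam : ℂ) - (lam0 : ℂ))^2 - I * (t : ℂ) * (lam0 : ℂ)^2)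
            * φ (lam : ℂ) * (heaviside (lam - lam0) : ℂ))
        =O[atTop] (fun t : ℝ => t ^ (-(1/2) : ℝ)) ∧
      (∀ t : ℝ, 0 < t → ∀ ε : ℝ, 0 < ε → Tendsto (fun R : ℝ =>
          ∫ u in (-R)..R,
            Complex.exp (I * (t : ℂ) * ((u : ℂ) - (lam0 : ℂ))^2 - I * (t : ℂ) * (lam0 : ℂ)^2)
              * φ u / ((u : ℂ) - (lam : ℂ) + I * (ε : ℂ)))
        atTop (𝓝 (Kp ε t))) ∧
      (∀ t : ℝ, 0 < t → Tendsto (fun ε : ℝ => Kp ε t) (𝓝[>] 0) (𝓝 (Jp t))) ∧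
      (fun t : ℝ => Jp t +
          2 * (Real.pi : ℂ) * I *
            Complex.exp (I * (t : ℂ) * ((lam : ℂ) - (lam0 : ℂ))^2 - I * (t : ℂ) * (lam0 : ℂ)^2)
            * φ (lam : ℂ) * (heaviside (lam0 - lam) : ℂ))
        =O[atTop] (fun t : ℝ => t ^ (-(1/2) : ℝ)) := by
  have hg : ∀ t : ℝ, Continuous fun u : ℝ => Complex.exp (I * (t : ℂ) * ((u : ℂ) - (lam0 : ℂ))^2 -
      I * (t : ℂ) * (lam0 : ℂ)^2) * φ u := fun t =>
    Continuous.mul (by fun_prop) (continuous_comp_ofReal hδ hφ)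
  have hgM : ∀ t u : ℝ, ‖Complex.exp (I * (t : ℂ) * ((u : ℂ) - (lam0 : ℂ))^2 -
      I * (t : ℂ) * (lam0 : ℂ)^2) * φ u‖ ≤ C / (1 + u ^ 2) := by
    intro t u
    have h1 : I * (t : ℂ) * ((u : ℂ) - (lam0 : ℂ))^2 - I * (t : ℂ) * (lam0 : ℂ)^2 =
        ((t * (u - lam0) ^ 2 - t * lam0 ^ 2 : ℝ) : ℂ) * I := by
      push_cast; ring
    rw [norm_mul, h1, norm_exp_ofReal_mul_I, one_mul]
    simpa using hbd u (by simpa using hδ.le)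
  have hE : ∀ t : ℝ, ‖Complex.exp (-(I * t * lam0 ^ 2))‖ = 1 := fun t => by
    have h1 : -(I * (t : ℂ) * lam0 ^ 2) = ((-(t * lam0 ^ 2) : ℝ) : ℂ) * I := by
      push_cast; ring
    rw [h1, norm_exp_ofReal_mul_I]
  have hshift : ∀ x y : ℝ, (y - lam0) ^ 2 = x ^ 2 →
      C / (1 + y ^ 2) ≤ 2 * C * (1 + lam0 ^ 2) / (1 + x ^ 2) := by
    intro x y hxy
    rw [div_le_div_iff₀ (by positivity) (by positivity), ← hxy]
    have : 1 + (y - lam0) ^ 2 ≤ 2 * (1 + lam0 ^ 2) * (1 + y ^ 2) := by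
      nlinarith [sq_nonneg (y + lam0), sq_nonneg (y * lam0)]
    nlinarith
  obtain ⟨G, hG⟩ : ∃ G : ℝ → ℝ → ℂ, ∀ t u : ℝ, Complex.exp (I * (t : ℂ) * ((u : ℂ) -
      (lam0 : ℂ))^2 - I * (t : ℂ) * (lam0 : ℂ)^2) * φ u = G t u := ⟨_, fun _ _ => rfl⟩
  simp only [hG] at hg hgM
  have hGlam : ∀ t : ℝ, 2 * (Real.pi : ℂ) * I * Complex.exp (I * (t : ℂ) * ((lam : ℂ) -
      (lam0 : ℂ))^2 - I * (t : ℂ) * (lam0 : ℂ)^2) * φ lam = 2 * Real.pi * I * G t lam := fun t => by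
    rw [← hG]; ring
  have hjump := fun t : ℝ =>
    tendsto_integral_div_sub_sub_integral_div_sub (hg t) (hgM t) lam
  have hR : ∀ t : ℝ, ∀ p : ℂ, p.im ≠ 0 → Tendsto (fun R : ℝ => ∫ u in (-R)..R, G t u / (u - p))
      atTop (𝓝 (∫ u : ℝ, G t u / (u - p))) := fun t p hp =>
    intervalIntegral_tendsto_integral (integrable_div_sub (hg t) (hgM t) hp)
      tendsto_neg_atTop_atBot tendsto_id
  have hM0 : 0 ≤ 2 * C * (1 + lam0 ^ 2) := by positivity
  have hden₁ : ∀ u ε : ℝ, (u : ℂ) - lam - I * ε = u - (lam + I * ε) := fun _ _ => by ring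
  have hden₂ : ∀ u ε : ℝ, (u : ℂ) - lam + I * ε = u - (lam - I * ε) := fun _ _ => by ring
  simp only [hG, hGlam, hden₁, hden₂]
  have hEO : ∀ J : ℝ → ℂ, J =O[atTop] (fun t : ℝ => t ^ (-(1/2) : ℝ)) →
      (fun t : ℝ => Complex.exp (-(I * t * lam0 ^ 2)) * J t) =O[atTop]
        (fun t : ℝ => t ^ (-(1/2) : ℝ)) := fun J hJ =>
    IsBigO.trans (IsBigO.of_norm_le fun t => by rw [norm_mul, hE, one_mul]) hJ.norm_left
  refine ⟨fun ε t => ∫ u : ℝ, G t u / (u - (lam + I * ε)),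
    fun ε t => ∫ u : ℝ, G t u / (u - (lam - I * ε)), ?_⟩
  rcases lt_or_gt_of_ne hlam with hlt | hgt
  · obtain ⟨J, hJ, hJO⟩ := exists_tendsto_isBigO_integral_gaussCauchy (ψ := fun z => φ (lam0 - z))
      (c := lam0 - lam) hδ hM0 (sub_pos.2 hlt)
      (hφ.comp (Differentiable.differentiableOn (by fun_prop)) fun z hz => by simpa using hz)
      (fun z hz => (hbd _ (by simpa using hz)).trans (by
        rw [sq_abs]; exact hshift _ _ (by simp)))
    have hKm : ∀ t : ℝ, 0 < t → Tendsto (fun ε : ℝ => ∫ u : ℝ, G t u / (u - (lam + I * ε)))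
        (𝓝[>] 0) (𝓝 (-(Complex.exp (-(I * t * lam0 ^ 2)) * J t))) := by
      intro t ht
      refine ((hJ t ht).const_mul _).neg.congr fun ε => ?_
      rw [← MeasureTheory.integral_const_mul, ← MeasureTheory.integral_neg,
        ← MeasureTheory.integral_sub_left_eq_self
          (fun u : ℝ => G t u / (u - (lam + I * ε))) volume lam0]
      congr 1
      ext u
      rw [← hG, gaussCauchy, ← mul_div_assoc, ← mul_assoc, ← Complex.exp_add, ← div_neg]
      push_cast
      congr 3 <;> ring_nf
    refine ⟨fun t => -(Complex.exp (-(I * t * lam0 ^ 2)) * J t),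
      fun t => -(Complex.exp (-(I * t * lam0 ^ 2)) * J t) - 2 * Real.pi * I * G t lam,
      fun t ht ε hε => hR t _ (by simpa using hε.ne'), hKm, ?_,
      fun t ht ε hε => hR t _ (by simpa using hε.ne'), fun t ht => ?_, ?_⟩
    · simpa [heaviside, hlt.not_gt] using hEO J hJO
    · simpa using (hKm t ht).sub (hjump t)
    · simpa [heaviside, hlt] using hEO J hJO
  · obtain ⟨J, hJ, hJO⟩ := exists_tendsto_isBigO_integral_gaussCauchy (ψ := fun z => φ (z + lam0))
      (c := lam - lam0) hδ hM0 (sub_pos.2 hgt)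
      (hφ.comp (Differentiable.differentiableOn (by fun_prop)) fun z hz => by simpa using hz)
      (fun z hz => (hbd _ (by simpa using hz)).trans (by
        rw [sq_abs]; exact hshift _ _ (by simp)))
    have hKp : ∀ t : ℝ, 0 < t → Tendsto (fun ε : ℝ => ∫ u : ℝ, G t u / (u - (lam - I * ε)))
        (𝓝[>] 0) (𝓝 (Complex.exp (-(I * t * lam0 ^ 2)) * J t)) := by
      intro t ht
      refine ((hJ t ht).const_mul _).congr fun ε => ?_
      rw [← MeasureTheory.integral_const_mul, ← MeasureTheory.integral_add_right_eq_self
        (fun u : ℝ => G t u / (u - (lam - I * ε))) lam0]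
      congr 1
      ext u
      rw [← hG, gaussCauchy, ← mul_div_assoc, ← mul_assoc, ← Complex.exp_add]
      push_cast
      congr 1
      · congr 2
        ring
      · ring
    refine ⟨fun t => Complex.exp (-(I * t * lam0 ^ 2)) * J t + 2 * Real.pi * I * G t lam,
      fun t => Complex.exp (-(I * t * lam0 ^ 2)) * J t,
      fun t ht ε hε => hR t _ (by simpa using hε.ne'), fun t ht => ?_, ?_,
      fun t ht ε hε => hR t _ (by simpa using hε.ne'), hKp, ?_⟩
    · simpa using (hKp t ht).add (hjump t)
    · simpa [heaviside, hgt] using hEO J hJO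
    · simpa [heaviside, hgt.not_gt] using hEO J hJO
end

section
/- Let λ₀∈ℝ and let g:ℝ→ℂ be smooth with compact support. Then lim_{t→+∞} √t · ∫_ℝ e^{it(u−λ₀)²}·g(u) du = √π·e^{iπ/4}·g(λ₀). -/
open MeasureTheory Filter Complex Topology

open scoped FourierTransform SchwartzMap

theorem tendsto_integral_cexp_mul_sq {ι : Type*} {l : Filter ι} [l.IsCountablyGenerated]
    {c : ι → ℂ} {c₀ : ℂ} {f : ℝ → ℂ} (hc : Tendsto c l (𝓝 c₀))
    (hre : ∀ᶠ i in l, (c i).re ≤ 0) (hf : Integrable f) :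
    Tendsto (fun i => ∫ x : ℝ, cexp (c i * (x : ℂ) ^ 2) * f x) l
      (𝓝 (∫ x : ℝ, cexp (c₀ * (x : ℂ) ^ 2) * f x)) := by
  refine tendsto_integral_filter_of_dominated_convergence (fun x => ‖f x‖) ?_ ?_ hf.norm ?_
  · refine Eventually.of_forall fun i => AEStronglyMeasurable.mul ?_ hf.aestronglyMeasurable
    exact Continuous.aestronglyMeasurable (by fun_prop)
  · filter_upwards [hre] with i hi
    refine ae_of_all _ fun x => ?_
    rw [norm_mul, Complex.norm_exp]
    refine mul_le_of_le_one_left (norm_nonneg _) (Real.exp_le_one_iff.2 ?_)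
    rw [← ofReal_pow, re_mul_ofReal]
    exact mul_nonpos_of_nonpos_of_nonneg hi (sq_nonneg x)
  · refine ae_of_all _ fun x => ?_
    exact ((hc.mul_const _).cexp).mul_const _

theorem integral_gaussian_mul_fourier_of_re_pos {b : ℂ} (hb : 0 < b.re) (φ : 𝓢(ℝ, ℂ)) :
    ∫ x : ℝ, cexp (-Real.pi * b * (x : ℂ) ^ 2) * 𝓕 φ x =
      1 / b ^ (1 / 2 : ℂ) * ∫ x : ℝ, cexp (-Real.pi / b * (x : ℂ) ^ 2) * φ x := by
  have hint : Integrable fun x : ℝ => cexp (-Real.pi * b * (x : ℂ) ^ 2) := by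
    have := integrable_cexp_neg_mul_sq (b := Real.pi * b)
      (by rw [re_ofReal_mul]; exact mul_pos Real.pi_pos hb)
    simpa only [neg_mul] using this
  have h := VectorFourier.integral_fourierIntegral_smul_eq_flip (L := innerₗ ℝ)
    Real.continuous_fourierChar continuous_inner hint (φ.integrable (μ := volume))
  have hL : ∀ f : ℝ → ℂ, VectorFourier.fourierIntegral Real.fourierChar volume (innerₗ ℝ) f = 𝓕 f :=
    fun _ => rfl
  rw [flip_innerₗ, hL, hL, fourier_gaussian_pi hb] at h
  simp only [smul_eq_mul, mul_assoc] at h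
  rw [integral_const_mul] at h
  simp only [mul_assoc]
  exact h.symm

/-- The Fourier transform duality for Gaussians, up to and including imaginary exponents. -/
theorem integral_gaussian_mul_fourier {b : ℂ} (hb : 0 ≤ b.re) (hb0 : b ≠ 0) (φ : 𝓢(ℝ, ℂ)) :
    ∫ x : ℝ, cexp (-Real.pi * b * (x : ℂ) ^ 2) * 𝓕 φ x =
      1 / b ^ (1 / 2 : ℂ) * ∫ x : ℝ, cexp (-Real.pi / b * (x : ℂ) ^ 2) * φ x := by
  have hlim : Tendsto (fun ε : ℝ => b + ε) (𝓝[>] 0) (𝓝 b) := by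
    have : Tendsto (fun ε : ℝ => b + ε) (𝓝 0) (𝓝 (b + (0 : ℝ))) :=
      (by fun_prop : Continuous fun ε : ℝ => b + (ε : ℂ)).tendsto 0
    simpa using this.mono_left nhdsWithin_le_nhds
  have hpos : ∀ᶠ ε : ℝ in 𝓝[>] 0, 0 < (b + ε).re := by
    filter_upwards [self_mem_nhdsWithin] with ε hε
    simpa using add_pos_of_nonneg_of_pos hb hε
  have hslit : b ∈ slitPlane := by
    rcases hb.lt_or_eq with h | h
    · exact Or.inl h
    · exact Or.inr fun him => hb0 (Complex.ext h.symm him)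
  have h₁ := tendsto_integral_cexp_mul_sq (hlim.const_mul (-Real.pi : ℂ))
    (hpos.mono fun ε hε => by
      rw [← ofReal_neg, re_ofReal_mul]
      exact mul_nonpos_of_nonpos_of_nonneg (neg_nonpos.2 Real.pi_pos.le) hε.le)
    ((𝓕 φ).integrable (μ := volume))
  have h₂ := tendsto_integral_cexp_mul_sq (c := fun ε : ℝ => -Real.pi / (b + ε)) ((tendsto_const_nhds (x := (-Real.pi : ℂ))).div hlim hb0)
    (hpos.mono fun ε hε => by
      rw [← ofReal_neg, div_eq_mul_inv, re_ofReal_mul, inv_re]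
      exact mul_nonpos_of_nonpos_of_nonneg (neg_nonpos.2 Real.pi_pos.le)
        (div_nonneg hε.le (normSq_nonneg _)))
    (φ.integrable (μ := volume))
  have h₃ : Tendsto (fun ε : ℝ => 1 / (b + ε) ^ (1 / 2 : ℂ)) (𝓝[>] 0)
      (𝓝 (1 / b ^ (1 / 2 : ℂ))) :=
    tendsto_const_nhds.div (hlim.cpow tendsto_const_nhds hslit) (by simp [cpow_eq_zero_iff, hb0])
  refine tendsto_nhds_unique h₁ ((h₃.mul h₂).congr' ?_)
  filter_upwards [hpos] with ε hε
  exact (integral_gaussian_mul_fourier_of_re_pos hε φ).symm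

theorem one_div_cpow_half_neg_I_mul {t : ℝ} (ht : 0 < t) :
    (Real.sqrt t : ℂ) * (1 / (-I * (t / Real.pi : ℝ)) ^ (1 / 2 : ℂ)) =
      (Real.sqrt Real.pi : ℂ) * cexp (I * Real.pi / 4) := by
  have hp := Real.pi_pos
  have hq : 0 < t / Real.pi := div_pos ht hp
  have hb : ((t / Real.pi : ℝ) : ℂ) ≠ 0 := ofReal_ne_zero.2 hq.ne'
  have hI : (-I) ^ (1 / 2 : ℂ) = cexp (-(I * Real.pi / 4)) := by
    rw [cpow_def_of_ne_zero (neg_ne_zero.2 I_ne_zero), log_neg_I]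
    ring_nf
  have hr : ((t / Real.pi : ℝ) : ℂ) ^ (1 / 2 : ℂ) = (Real.sqrt t : ℂ) / Real.sqrt Real.pi := by
    rw [← ofReal_div, ← Real.sqrt_div ht.le, Real.sqrt_eq_rpow, ofReal_cpow (by positivity)]
    norm_num
  have hst : (Real.sqrt t : ℂ) ≠ 0 := ofReal_ne_zero.2 (Real.sqrt_pos.2 ht).ne'
  have hsp : (Real.sqrt Real.pi : ℂ) ≠ 0 := ofReal_ne_zero.2 (Real.sqrt_pos.2 hp).ne'
  rw [mul_comm (-I), cpow_def_of_ne_zero (mul_ne_zero hb (neg_ne_zero.2 I_ne_zero)),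
    log_ofReal_mul hq (neg_ne_zero.2 I_ne_zero), ofReal_log hq.le, add_mul, exp_add,
    ← cpow_def_of_ne_zero hb, ← cpow_def_of_ne_zero (neg_ne_zero.2 I_ne_zero), hr, hI, exp_neg]
  field_simp

/-- Stationary-phase evaluation of the Gaussian oscillatory integral with stationary
point `λ₀`: for smooth compactly supported `g : ℝ → ℂ`,
`lim_{t→+∞} √t ∫_ℝ e^{it(u−λ₀)²} g(u) du = √π·e^{iπ/4}·g(λ₀)`. -/
theorem gaussian_stationary_phase (lam0 : ℝ) (g : ℝ → ℂ)
    (hg : ContDiff ℝ (⊤ : ℕ∞) g) (hsupp : HasCompactSupport g) :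
    Tendsto (fun t : ℝ => (Real.sqrt t : ℂ) *
        ∫ u : ℝ, Complex.exp (I * (t : ℂ) * ((u : ℂ) - (lam0 : ℂ))^2) * g u)
      atTop (𝓝 ((Real.sqrt Real.pi : ℂ) * Complex.exp (I * (Real.pi : ℂ) / 4) * g lam0)) := by
  have hcont : ContDiff ℝ (⊤ : ℕ∞) fun x => g (x + lam0) :=
    hg.comp (contDiff_id.add contDiff_const)
  have hcomp : HasCompactSupport fun x => g (x + lam0) :=
    hsupp.comp_homeomorph (Homeomorph.addRight lam0)
  set φ : 𝓢(ℝ, ℂ) := 𝓕⁻ (hcomp.toSchwartzMap hcont) with hφ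
  have hφg : ∀ x, 𝓕 φ x = g (x + lam0) := fun x => by
    rw [hφ, FourierTransform.fourier_fourierInv_eq]
    rfl
  have hφ0 : ∫ x : ℝ, cexp (0 * (x : ℂ) ^ 2) * φ x = g lam0 := by
    have := hφg 0
    rw [SchwartzMap.fourier_coe, Real.fourier_real_eq] at this
    simpa using this
  have hinv : Tendsto (fun t : ℝ => -Real.pi / (-I * (t / Real.pi : ℝ))) atTop (𝓝 0) := by
    have h : Tendsto (fun t : ℝ => ((t⁻¹ : ℝ) : ℂ)) atTop (𝓝 ((0 : ℝ) : ℂ)) :=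
      (continuous_ofReal.tendsto 0).comp tendsto_inv_atTop_zero
    have h' := h.const_mul (-Real.pi / (-I * (Real.pi : ℂ)⁻¹))
    rw [ofReal_zero, mul_zero] at h'
    refine h'.congr fun t => ?_
    push_cast
    simp only [div_eq_mul_inv, mul_inv]
    ring
  have hlim := tendsto_integral_cexp_mul_sq hinv
    (Eventually.of_forall fun t => by
      rw [← ofReal_neg, div_eq_mul_inv, re_ofReal_mul, inv_re, re_mul_ofReal]
      simp)
    (φ.integrable (μ := volume))
  rw [hφ0] at hlim
  refine (hlim.const_mul ((Real.sqrt Real.pi : ℂ) * cexp (I * Real.pi / 4))).congr' ?_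
  filter_upwards [eventually_gt_atTop 0] with t ht
  have hb0 : -I * (t / Real.pi : ℝ) ≠ 0 :=
    mul_ne_zero (neg_ne_zero.2 I_ne_zero) (ofReal_ne_zero.2 (div_pos ht Real.pi_pos).ne')
  rw [← one_div_cpow_half_neg_I_mul ht, mul_assoc,
    ← integral_gaussian_mul_fourier (by rw [re_mul_ofReal]; simp) hb0,
    ← integral_add_right_eq_self
      (fun u : ℝ => cexp (I * (t : ℂ) * ((u : ℂ) - (lam0 : ℂ)) ^ 2) * g u) lam0]
  congr 2 with x
  rw [hφg]
  congr 2
  have : (Real.pi : ℂ) ≠ 0 := ofReal_ne_zero.2 Real.pi_ne_zero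
  push_cast
  field_simp
  ring
end

section
/- Let t>0, λ₀∈ℝ, and z∈ℂ with Im z ≠ 0. Then the improper integral lim_{R→∞} ∫_{−R}^{R} e^{it(u−λ₀)²}/(u−z) du exists (the limit is a finite complex number). -/
open MeasureTheory Filter Complex Topology intervalIntegral

theorem ofReal_sub_ne_zero_of_im_ne_zero {z : ℂ} (hz : z.im ≠ 0) (u : ℝ) : (u : ℂ) - z ≠ 0 := by
  intro h
  have := congrArg Complex.im h
  simp at this
  exact hz this

theorem integrable_inv_ofReal_sub_sq {z : ℂ} (hz : z.im ≠ 0) :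
    Integrable fun u : ℝ => (((u : ℂ) - z) ^ 2)⁻¹ := by
  have h1 : Integrable fun u : ℝ => (z.im ^ 2)⁻¹ * (1 + ((u - z.re) / z.im) ^ 2)⁻¹ :=
    ((integrable_inv_one_add_sq.comp_div hz).comp_sub_right z.re).const_mul _
  have hc : Continuous fun u : ℝ => (((u : ℂ) - z) ^ 2)⁻¹ :=
    Continuous.inv₀ (by fun_prop) fun u => pow_ne_zero 2 (ofReal_sub_ne_zero_of_im_ne_zero hz u)
  refine h1.mono' hc.aestronglyMeasurable (Eventually.of_forall fun u => le_of_eq ?_)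
  rw [norm_inv, norm_pow, ← Complex.normSq_eq_norm_sq, Complex.normSq_apply, ← mul_inv]
  congr 1
  simp
  field_simp
  ring

theorem integrable_inv_ofReal_sub_cube {z : ℂ} (hz : z.im ≠ 0) :
    Integrable fun u : ℝ => (((u : ℂ) - z) ^ 3)⁻¹ := by
  have hc : Continuous fun u : ℝ => ((u : ℂ) - z)⁻¹ :=
    Continuous.inv₀ (by fun_prop) (ofReal_sub_ne_zero_of_im_ne_zero hz)
  have h := (integrable_inv_ofReal_sub_sq hz).bdd_mul (c := |z.im|⁻¹)
    hc.aestronglyMeasurable (Eventually.of_forall fun u => ?_)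
  · refine h.congr (Eventually.of_forall fun u => ?_)
    simp only [← mul_inv]
    congr 1
    ring
  · rw [norm_inv]
    refine inv_anti₀ (abs_pos.mpr hz) ?_
    simpa using Complex.abs_im_le_norm ((u : ℂ) - z)

theorem norm_exp_I_mul_ofReal_mul_sq (t lam0 u : ℝ) :
    ‖Complex.exp (I * (t : ℂ) * ((u : ℂ) - (lam0 : ℂ)) ^ 2)‖ = 1 := by
  have : I * (t : ℂ) * ((u : ℂ) - (lam0 : ℂ)) ^ 2 = ((t * (u - lam0) ^ 2 : ℝ) : ℂ) * I := by
    push_cast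
    ring
  rw [this, Complex.norm_exp_ofReal_mul_I]

theorem tendsto_inv_ofReal_sub_sq_cocompact (z : ℂ) :
    Tendsto (fun u : ℝ => (((u : ℂ) - z) ^ 2)⁻¹) (cocompact ℝ) (𝓝 0) := by
  have h1 : Tendsto (fun u : ℝ => (u : ℂ) - z) (cocompact ℝ) (cocompact ℂ) :=
    (Homeomorph.subRight z).isClosedEmbedding.tendsto_cocompact.comp
      Complex.isometry_ofReal.isClosedEmbedding.tendsto_cocompact
  have h2 := (tendsto_inv₀_cobounded (α := ℂ)).comp (by
    rwa [← Metric.cobounded_eq_cocompact (α := ℂ)] at h1)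
  simpa [Function.comp_def] using h2.pow 2

theorem hasDerivAt_exp_div_sub_sq {t : ℝ} (ht : t ≠ 0) (lam0 : ℝ) {z : ℂ} (hz : z.im ≠ 0)
    (u : ℝ) :
    HasDerivAt
      (fun u : ℝ => Complex.exp (I * (t : ℂ) * ((u : ℂ) - (lam0 : ℂ)) ^ 2) *
        ((2 * I * t)⁻¹ * (((u : ℂ) - z) ^ 2)⁻¹))
      (Complex.exp (I * (t : ℂ) * ((u : ℂ) - (lam0 : ℂ)) ^ 2) / ((u : ℂ) - z) -
        Complex.exp (I * (t : ℂ) * ((u : ℂ) - (lam0 : ℂ)) ^ 2) *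
          ((lam0 - z) * (((u : ℂ) - z) ^ 2)⁻¹ + (I * t)⁻¹ * (((u : ℂ) - z) ^ 3)⁻¹)) u := by
  have hne := ofReal_sub_ne_zero_of_im_ne_zero hz u
  have ht' : (t : ℂ) ≠ 0 := by exact_mod_cast ht
  have hid : HasDerivAt (fun u : ℝ => (u : ℂ)) 1 u := Complex.ofRealCLM.hasDerivAt
  have h1 := (((hid.sub_const (lam0 : ℂ)).pow 2).const_mul (I * (t : ℂ))).cexp
  have h2 := (((hid.sub_const z).pow 2).inv (pow_ne_zero 2 hne)).const_mul (2 * I * (t : ℂ))⁻¹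
  refine (h1.mul h2).congr_deriv ?_
  simp only [Pi.pow_apply, Pi.inv_apply]
  have hI := Complex.I_ne_zero
  field_simp
  push_cast
  ring

/-- Convergence of the regularized Gaussian singular integral: for `t > 0`, `λ₀ ∈ ℝ` and
`z ∈ ℂ` with `Im z ≠ 0`, the improper integral
`lim_{R→∞} ∫_{−R}^{R} e^{it(u−λ₀)²}/(u−z) du` exists. -/
theorem gaussian_singular_integral_converges (t : ℝ) (ht : 0 < t) (lam0 : ℝ)
    (z : ℂ) (hz : z.im ≠ 0) :
    ∃ L : ℂ, Tendsto (fun R : ℝ =>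
        ∫ u in (-R)..R,
          Complex.exp (I * (t : ℂ) * ((u : ℂ) - (lam0 : ℂ))^2) / ((u : ℂ) - z))
      atTop (𝓝 L) := by
  set E : ℝ → ℂ := fun u => Complex.exp (I * (t : ℂ) * ((u : ℂ) - (lam0 : ℂ)) ^ 2) with hE
  set F : ℝ → ℂ := fun u => E u * ((2 * I * t)⁻¹ * (((u : ℂ) - z) ^ 2)⁻¹) with hF
  set g : ℝ → ℂ := fun u =>
    E u * ((lam0 - z) * (((u : ℂ) - z) ^ 2)⁻¹ + (I * t)⁻¹ * (((u : ℂ) - z) ^ 3)⁻¹) with hg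
  have hne := ofReal_sub_ne_zero_of_im_ne_zero hz
  have hEn : ∀ u, ‖E u‖ = 1 := norm_exp_I_mul_ofReal_mul_sq t lam0
  have hEc : Continuous E := by fun_prop
  have hgi : Integrable g :=
    (((integrable_inv_ofReal_sub_sq hz).const_mul _).add
      ((integrable_inv_ofReal_sub_cube hz).const_mul _)).bdd_mul (c := 1)
      hEc.aestronglyMeasurable (Eventually.of_forall fun u => (hEn u).le)
  have hfc : Continuous fun u : ℝ => E u / ((u : ℂ) - z) :=
    hEc.div (by fun_prop) hne
  have hF0 : Tendsto F (cocompact ℝ) (𝓝 0) := by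
    have h := ((tendsto_inv_ofReal_sub_sq_cocompact z).const_mul (2 * I * (t : ℂ))⁻¹).norm
    rw [mul_zero, norm_zero] at h
    rw [tendsto_zero_iff_norm_tendsto_zero]
    refine h.congr fun u => ?_
    rw [hF, norm_mul (E u), hEn, one_mul]
  have hint : ∀ R : ℝ, ∫ u in (-R)..R, E u / ((u : ℂ) - z) =
      F R - F (-R) + ∫ u in (-R)..R, g u := by
    intro R
    have hf := hfc.intervalIntegrable (μ := volume) (-R) R
    have hgI := hgi.intervalIntegrable (a := -R) (b := R)
    rw [← integral_eq_sub_of_hasDerivAt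
      (fun u _ => hasDerivAt_exp_div_sub_sq ht.ne' lam0 hz u) (hf.sub hgI),
      ← integral_add (hf.sub hgI) hgI]
    simp only [hE, hg, sub_add_cancel]
  refine ⟨0 - 0 + ∫ u, g u, ?_⟩
  refine Tendsto.congr (fun R => (hint R).symm) ?_
  exact ((hF0.mono_left atTop_le_cocompact).sub
    ((hF0.mono_left atBot_le_cocompact).comp tendsto_neg_atTop_atBot)).add
    (intervalIntegral_tendsto_integral hgi tendsto_neg_atTop_atBot tendsto_id)
end

section
/- Let c>0 and define h(λ,μ)=(λ−μ+ic)/(ic)∈ℂ for λ,μ∈ℝ (note h(λ,μ)≠0, so a logarithm log h(λ,μ) is defined). Let A be an associative unital ℂ-algebra and let p_A, p_D, p_ψ, q_A, q_D, q_ψ : ℝ→A be families of elements satisfying: [p_A(λ),q_ψ(μ)]=[p_ψ(λ),q_A(μ)]=log h(μ,λ)·1, [p_D(λ),q_ψ(μ)]=[p_ψ(λ),q_D(μ)]=log h(λ,μ)·1, [p_ψ(λ),q_ψ(μ)]=log(h(λ,μ)h(μ,λ))·1, and all other commutators among the elements {p_A(λ),p_D(λ),p_ψ(λ),q_A(λ),q_D(λ),q_ψ(λ)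 : λ∈ℝ} vanish (in particular all p's commute with each other, all q's commute with each other, and [p_A(λ),q_A(μ)]=[p_A(λ),q_D(μ)]=[p_D(λ),q_A(μ)]=[p_D(λ),q_D(μ)]=0). Define the dual fields φ_A(λ)=q_A(λ)+p_D(λ), φ_D(λ)=q_D(λ)+p_A(λ), ψ(λ)=q_ψ(λ)+p_ψ(λ). Then for all λ,μ∈ℝ: [ψ(λ),ψ(μ)]=0, [ψ(λ),φ_A(μ)]=0, [ψ(λ),φ_D(μ)]=0, [φ_A(λ),φ_A(μ)]=0, [φ_D(λ),φ_D(μ)]=0, and [φ_A(λ),φ_D(μ)]=0. -/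
open Complex

/-- The ringCommutator `[a,b] = ab − ba` in an associative algebra. -/
def ringCommutator {A : Type*} [Ring A] (a b : A) : A := a * b - b * a

/-- `h(λ,μ) = (λ−μ+ic)/(ic)`. -/
noncomputable def hfun (c lam mu : ℝ) : ℂ := ((lam : ℂ) - (mu : ℂ) + I * (c : ℂ)) / (I * (c : ℂ))

theorem ringCommutator_comm_eq_zero {A : Type*} [Ring A] {a b : A}
    (h : ringCommutator a b = 0) : ringCommutator b a = 0 := by
  rw [ringCommutator, sub_eq_zero] at *
  exact h.symm

/-- Sums `q + p` and `q' + p'` commute when `q, q'` commute, `p, p'` commute and the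
mixed commutators agree. -/
theorem ringCommutator_add_add_eq_zero {A : Type*} [Ring A] {q p q' p' : A}
    (hq : ringCommutator q q' = 0) (hp : ringCommutator p p' = 0)
    (hm : ringCommutator p q' = ringCommutator p' q) :
    ringCommutator (q + p) (q' + p') = 0 := by
  have key : ringCommutator (q + p) (q' + p') =
      ringCommutator q q' + ringCommutator p p' +
        (ringCommutator p q' - ringCommutator p' q) := by
    simp only [ringCommutator]
    noncomm_ring
  rw [key, hq, hp, hm, sub_self, add_zero, add_zero]

/-- The claim (Abel) of the paper: the dual fields `ψ(λ) = q_ψ(λ) + p_ψ(λ)`,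
`φ_A(λ) = q_A(λ) + p_D(λ)`, `φ_D(λ) = q_D(λ) + p_A(λ)`, built from creation and
annihilation parts obeying the commutation relations (commutators), form an Abelian
family. -/
theorem dual_fields_commute (c : ℝ) (hc : 0 < c)
    {A : Type*} [Ring A] [Algebra ℂ A]
    (pA pD pψ qA qD qψ : ℝ → A)
    (h1 : ∀ lam mu : ℝ, ringCommutator (pA lam) (qψ mu) = algebraMap ℂ A (Complex.log (hfun c mu lam)))
    (h2 : ∀ lam mu : ℝ, ringCommutator (pψ lam) (qA mu) = algebraMap ℂ A (Complex.log (hfun c mu lam)))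
    (h3 : ∀ lam mu : ℝ, ringCommutator (pD lam) (qψ mu) = algebraMap ℂ A (Complex.log (hfun c lam mu)))
    (h4 : ∀ lam mu : ℝ, ringCommutator (pψ lam) (qD mu) = algebraMap ℂ A (Complex.log (hfun c lam mu)))
    (h5 : ∀ lam mu : ℝ, ringCommutator (pψ lam) (qψ mu)
            = algebraMap ℂ A (Complex.log (hfun c lam mu * hfun c mu lam)))
    (hpp : ∀ lam mu : ℝ, ringCommutator (pA lam) (pA mu) = 0 ∧ ringCommutator (pA lam) (pD mu) = 0 ∧
            ringCommutator (pA lam) (pψ mu) = 0 ∧ ringCommutator (pD lam) (pD mu) = 0 ∧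
            ringCommutator (pD lam) (pψ mu) = 0 ∧ ringCommutator (pψ lam) (pψ mu) = 0)
    (hqq : ∀ lam mu : ℝ, ringCommutator (qA lam) (qA mu) = 0 ∧ ringCommutator (qA lam) (qD mu) = 0 ∧
            ringCommutator (qA lam) (qψ mu) = 0 ∧ ringCommutator (qD lam) (qD mu) = 0 ∧
            ringCommutator (qD lam) (qψ mu) = 0 ∧ ringCommutator (qψ lam) (qψ mu) = 0)
    (hpq : ∀ lam mu : ℝ, ringCommutator (pA lam) (qA mu) = 0 ∧ ringCommutator (pA lam) (qD mu) = 0 ∧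
            ringCommutator (pD lam) (qA mu) = 0 ∧ ringCommutator (pD lam) (qD mu) = 0) :
    ∀ lam mu : ℝ,
      ringCommutator (qψ lam + pψ lam) (qψ mu + pψ mu) = 0 ∧
      ringCommutator (qψ lam + pψ lam) (qA mu + pD mu) = 0 ∧
      ringCommutator (qψ lam + pψ lam) (qD mu + pA mu) = 0 ∧
      ringCommutator (qA lam + pD lam) (qA mu + pD mu) = 0 ∧
      ringCommutator (qD lam + pA lam) (qD mu + pA mu) = 0 ∧
      ringCommutator (qA lam + pD lam) (qD mu + pA mu) = 0 := by
  intro lam mu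
  obtain ⟨ppAA, -, -, ppDD, -, ppψψ⟩ := hpp lam mu
  obtain ⟨-, ppAD, ppAψ, -, ppDψ, -⟩ := hpp mu lam
  obtain ⟨qqAA, qqAD, -, qqDD, -, qqψψ⟩ := hqq lam mu
  obtain ⟨-, -, qqAψ, -, qqDψ, -⟩ := hqq mu lam
  obtain ⟨-, pqAD, pqDA, pqDD⟩ := hpq lam mu
  obtain ⟨pqAA', pqAD', pqDA', -⟩ := hpq mu lam
  refine ⟨ringCommutator_add_add_eq_zero qqψψ ppψψ ?_,
    ringCommutator_add_add_eq_zero (ringCommutator_comm_eq_zero qqAψ)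
      (ringCommutator_comm_eq_zero ppDψ) ?_,
    ringCommutator_add_add_eq_zero (ringCommutator_comm_eq_zero qqDψ)
      (ringCommutator_comm_eq_zero ppAψ) ?_,
    ringCommutator_add_add_eq_zero qqAA ppDD (pqDA.trans pqDA'.symm),
    ringCommutator_add_add_eq_zero qqDD ppAA (pqAD.trans pqAD'.symm),
    ringCommutator_add_add_eq_zero qqAD (ringCommutator_comm_eq_zero ppAD)
      (pqDD.trans pqAA'.symm)⟩
  · rw [h5, h5, mul_comm]
  · rw [h2, h3]
  · rw [h4, h1]
end
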